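/- Let w be a permutation with w(i) > w(i−1) for all i ≤ 0 and let μ = (μ₁ ≥ … ≥ μ_n ≥ 0) be a partition. For a permutation u and an rc-graph U with w_U = u, let N(U) denote the number of pairs (R, Y) where R is an rc-graph with w_R = w and Y is a semistandard Young tableau of shape μ with entries in {1,…,n} such that R ← Y = U. Then N(U) depends only on the permutation u = w_U (write c^u_{w,μ} for this common value), and S_w · s_μ = Σ_u c^u_{w,μ} · S_u, a finite sum over all permutations u; thus c^u_{w,μ} is the generalized Littlewood–Richardson coefficient of S_u in the product S_w · s_μ. -/

import Mathlib

open scoped Classical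

noncomputable section

namespace RCGraphs

/-- The simple transposition `s j`, interchanging `j` and `j+1`. -/
def sT (j : ℤ) : Equiv.Perm ℤ := Equiv.swap j (j + 1)

/-- The Coxeter length of a permutation of `ℤ`: the minimal length of an expression
as a product of simple transpositions. -/
def len (w : Equiv.Perm ℤ) : ℕ :=
  sInf {m : ℕ | ∃ l : List ℤ, l.length = m ∧ (l.map sT).prod = w}

/-- The permutations considered in the paper: bijections of `ℤ` fixing every `i > n`
and fixing all sufficiently small integers. -/
def IsPermZ (n : ℤ) (w : Equiv.Perm ℤ) : Prop :=
  (∀ i : ℤ, n < i → w i = i) ∧ ∃ N : ℤ, ∀ i : ℤ, i < N → w i = i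

/-- The reading order on positions `(i,k)`: rows (second coordinate) from `n` downward,
and within a row in order of increasing first coordinate. -/
def rcOrder (p q : ℤ × ℤ) : Prop :=
  q.2 < p.2 ∨ (p.2 = q.2 ∧ p.1 ≤ q.1)

instance : DecidableRel rcOrder := fun p q => by
  unfold rcOrder; infer_instance

instance : IsTrans (ℤ × ℤ) rcOrder :=
  ⟨fun a b c h₁ h₂ => by unfold rcOrder at *; omega⟩

instance : IsAntisymm (ℤ × ℤ) rcOrder :=
  ⟨fun a b h₁ h₂ => by
    unfold rcOrder at *
    have h3 : a.1 = b.1 ∧ a.2 = b.2 := by omega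
    exact Prod.ext h3.1 h3.2⟩

instance : IsTotal (ℤ × ℤ) rcOrder :=
  ⟨fun a b => by unfold rcOrder; omega⟩

/-- The permutation `w_R` associated to a finite set of positions `R`: the product of the
simple transpositions `s_{i+k-n-1}`, `(i,k) ∈ R`, in the reading order. -/
def wR (n : ℤ) (R : Finset (ℤ × ℤ)) : Equiv.Perm ℤ :=
  ((R.sort rcOrder).map fun p => sT (p.1 + p.2 - n - 1)).prod

/-- `R` is an rc-graph: positions lie in the grid `{(i,k) : i ≤ n, k ≤ n}` and the
reading word is reduced. -/
def IsRC (n : ℤ) (R : Finset (ℤ × ℤ)) : Prop :=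
  (∀ p ∈ R, p.1 ≤ n ∧ p.2 ≤ n) ∧ len (wR n R) = R.card

/-- Condition (*): `w_R(i) > w_R(i-1)` for all `i ≤ 0`; equivalently no two strands with
nonpositive labels cross. -/
def Star (n : ℤ) (R : Finset (ℤ × ℤ)) : Prop :=
  ∀ i : ℤ, i ≤ 0 → wR n R (i - 1) < wR n R i

/-- Strand labels in the wiring diagram of `R` (for diagrams all of whose crossings lie in
rows `k ≥ 1`, as is the case under condition (*)).  `lab n R true i k` is the label of the
strand entering position `(i,k)` from the west (the strand passing above, if `(i,k)` is not
a crossing); `lab n R false i k` is the label of the strand entering from the south (the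
strand passing below).  Each strand is labeled by the row where it begins. -/
def lab (n : ℤ) (R : Finset (ℤ × ℤ)) : Bool → ℤ → ℤ → ℤ
  | true, i, k =>
      if h : n ≤ i then k
      else if (i + 1, k) ∈ R then lab n R true (i + 1) k else lab n R false (i + 1) k
  | false, i, k =>
      if h : k ≤ 0 then i + k - n - 1
      else if (i, k - 1) ∈ R then lab n R false i (k - 1) else lab n R true i (k - 1)
  termination_by b i k => ((n - i).toNat + k.toNat)
  decreasing_by
    all_goals simp_wf
    all_goals omega

/-- The label of the strand leaving position `(i,r)` northward. -/
def northLabel (n : ℤ) (R : Finset (ℤ × ℤ)) (i r : ℤ) : ℤ :=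
  if (i, r) ∈ R then lab n R false i r else lab n R true i r

/-- `(i,k)` is an open space: not a crossing, the strand passing below it has a
nonpositive label and the strand passing above it has a positive label. -/
def OpenSpace (n : ℤ) (R : Finset (ℤ × ℤ)) (i k : ℤ) : Prop :=
  i ≤ n ∧ (i, k) ∉ R ∧ lab n R false i k ≤ 0 ∧ 0 < lab n R true i k

/-- The main loop of the Bergeron--Billey insertion algorithm, recording the trace:
the list of pairs (current diagram, crossing just added).  `R` always contains the
crossing `p` that was just added. -/
def insertSteps (n : ℤ) : ℕ → Finset (ℤ × ℤ) → ℤ × ℤ → List (Finset (ℤ × ℤ) × (ℤ × ℤ))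
  | 0, _, _ => []
  | fuel + 1, R, p =>
      (R, p) ::
        if IsRC n R then []
        else
          let a := lab n R true p.1 p.2
          let b := lab n R false p.1 p.2
          -- the unique other crossing of the two strands that cross at `p`
          let C := R.filter fun q =>
            q ≠ p ∧ ((lab n R true q.1 q.2 = a ∧ lab n R false q.1 q.2 = b) ∨
                     (lab n R true q.1 q.2 = b ∧ lab n R false q.1 q.2 = a))
          let q := (C.sort rcOrder).headI
          let R' := R.erase q
          let i' := sInf {x : ℤ | q.1 < x ∧ OpenSpace n R' x q.2}
          insertSteps n fuel (insert (i', q.2) R') (i', q.2)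

/-- The trace of the insertion of `k` into `R`: the states of the algorithm together with
the crossings added at each step. -/
def insertStepsOf (n : ℤ) (R : Finset (ℤ × ℤ)) (k : ℤ) : List (Finset (ℤ × ℤ) × (ℤ × ℤ)) :=
  let i₁ := sInf {x : ℤ | OpenSpace n R x k}
  insertSteps n ((n + 1 - k).toNat + 1) (insert (i₁, k) R) (i₁, k)

/-- The insertion `R ← k` of Bergeron and Billey. -/
def insertOne (n : ℤ) (R : Finset (ℤ × ℤ)) (k : ℤ) : Finset (ℤ × ℤ) :=
  ((insertStepsOf n R k).getLast?.getD (R, (0, 0))).1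

/-- The insertion `R ← v` of a word. -/
def insertWord (n : ℤ) (R : Finset (ℤ × ℤ)) (v : List ℕ) : Finset (ℤ × ℤ) :=
  v.foldl (fun S a => insertOne n S (a : ℤ)) R

/-- The column (first coordinate) at which the strand labeled `a` of the diagram `R`
leaves row `r` northward. -/
def strandCol (n : ℤ) (R : Finset (ℤ × ℤ)) (a r : ℤ) : ℤ :=
  sSup {i : ℤ | i ≤ n ∧ northLabel n R i r = a}

/-- Given the trace `L` of an insertion, the column occupied in row `r` by the left path
(`left = true`) or the right path (`left = false`) of the insertion.  Between the rows of
the `t`-th and `(t+1)`-st added crossings, the left path is the piece `s_t` of the strand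
whose label changes from `a_t` to `b_t`, and the right path is the piece `s^t` whose label
changes from `b_t` to `a_t`. -/
def pathCol (n : ℤ) (L : List (Finset (ℤ × ℤ) × (ℤ × ℤ))) (left : Bool) (r : ℤ) : ℤ :=
  match (L.filter fun e => e.2.2 ≤ r).getLast? with
  | some e => strandCol n e.1 (lab n e.1 left e.2.1 e.2.2) r
  | none => 0

/-- A semistandard Young tableau with at most `n` rows (rows indexed `1,…,n`, row `j`
having `μ j` boxes, columns indexed from `0`), with entries in `{1,…,n}`, weakly
increasing along rows and strictly increasing down columns; entries outside the shape
are `0`. -/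
structure SSYT (n : ℕ) (μ : ℕ → ℕ) where
  entry : ℕ → ℕ → ℕ
  entry_mem : ∀ j c, 1 ≤ j → j ≤ n → c < μ j → 1 ≤ entry j c ∧ entry j c ≤ n
  row_weak : ∀ j c₁ c₂, 1 ≤ j → j ≤ n → c₁ ≤ c₂ → c₂ < μ j → entry j c₁ ≤ entry j c₂
  col_strict : ∀ j₁ j₂ c, 1 ≤ j₁ → j₁ < j₂ → j₂ ≤ n → c < μ j₂ → entry j₁ c < entry j₂ c
  outside : ∀ j c, j = 0 ∨ n < j ∨ μ j ≤ c → entry j c = 0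

/-- `μ` is a partition with (at most) `n` parts `μ 1 ≥ μ 2 ≥ … ≥ μ n ≥ 0`
(and `μ j = 0` outside `1,…,n`). -/
def IsPartition (n : ℕ) (μ : ℕ → ℕ) : Prop :=
  (∀ j, 1 ≤ j → j < n → μ (j + 1) ≤ μ j) ∧ ∀ j, j = 0 ∨ n < j → μ j = 0

/-- The reading word of a tableau: the rows read left to right, from the bottom row
to the top one. -/
def readingWord (n : ℕ) (μ : ℕ → ℕ) (Y : SSYT n μ) : List ℕ :=
  ((List.range n).reverse.map (· + 1)).flatMap fun j =>
    (List.range (μ j)).map fun c => Y.entry j c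

/-- An elementary Knuth move. -/
def KnuthMove (w₁ w₂ : List ℕ) : Prop :=
  (∃ (u v : List ℕ) (x y z : ℕ), x < y ∧ y ≤ z ∧
      w₁ = u ++ y :: x :: z :: v ∧ w₂ = u ++ y :: z :: x :: v) ∨
  (∃ (u v : List ℕ) (x y z : ℕ), x ≤ y ∧ y < z ∧
      w₁ = u ++ x :: z :: y :: v ∧ w₂ = u ++ z :: x :: y :: v)

/-- Knuth equivalence: the equivalence relation generated by elementary Knuth moves. -/
def KnuthEquiv (w₁ w₂ : List ℕ) : Prop := Relation.EqvGen KnuthMove w₁ w₂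

/-- The monomial `x^R = ∏_{(i,k) ∈ R} x_k`. -/
def xR (R : Finset (ℤ × ℤ)) : MvPolynomial ℕ ℤ :=
  ∏ p ∈ R, MvPolynomial.X p.2.toNat

/-- The monomial `x^Y = ∏ x_i`, one factor for each entry `i` of `Y`. -/
def xY (n : ℕ) (μ : ℕ → ℕ) (Y : SSYT n μ) : MvPolynomial ℕ ℤ :=
  ((readingWord n μ Y).map MvPolynomial.X).prod

/-- The Schubert polynomial `S_w = Σ_{R : w_R = w} x^R`. -/
def Schub (n : ℤ) (w : Equiv.Perm ℤ) : MvPolynomial ℕ ℤ :=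
  ∑ᶠ R ∈ {R : Finset (ℤ × ℤ) | IsRC n R ∧ wR n R = w}, xR R

/-- The Schur polynomial `s_μ(x₁,…,x_n) = Σ_Y x^Y`, summing over all semistandard Young
tableaux of shape `μ` with entries in `{1,…,n}`. -/
def SchurP (n : ℕ) (μ : ℕ → ℕ) : MvPolynomial ℕ ℤ :=
  ∑ᶠ Y : SSYT n μ, xY n μ Y

/-- The complete homogeneous symmetric polynomial
`h_m = Σ_{1 ≤ i₁ ≤ … ≤ i_m ≤ n} x_{i₁} ⋯ x_{i_m}`. -/
def hPoly (n m : ℕ) : MvPolynomial ℕ ℤ :=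
  ∑ s ∈ (Finset.Icc 1 n).sym m, (s.1.map MvPolynomial.X).prod

/-- The top rc-graph `R(μ) = {(i,k) : 1 ≤ k ≤ n, n - μ_k + 1 ≤ i ≤ n}` of a partition. -/
def Rmu (n : ℕ) (μ : ℕ → ℕ) : Finset (ℤ × ℤ) :=
  (Finset.Icc 1 (n : ℤ)).biUnion fun k =>
    (Finset.Icc ((n : ℤ) - μ k.toNat + 1) (n : ℤ)).image fun i => (i, k)


/-- Carried letter (west strand, nonpositive labels replaced by 0) in a row. -/
def car (k : ℕ) (f : ℕ → ℕ) (D : Finset ℕ) : ℕ → ℕ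
  | 0 => k
  | p + 1 => if p ∈ D then car k f D p else f p

/-- The word on top of a row. -/
def out (k : ℕ) (f : ℕ → ℕ) (D : Finset ℕ) (p : ℕ) : ℕ :=
  if p ∈ D then f p else car k f D p

def Legit (k : ℕ) (f : ℕ → ℕ) (D : Finset ℕ) : Prop := ∀ p ∈ D, f p < car k f D p

/-- The event (cover) at positions `P < z` from the word `f` to the word `f1`. -/
def Ev (f : ℕ → ℕ) (P z : ℕ) (f1 : ℕ → ℕ) : Prop :=
  P < z ∧ 0 < f P ∧ f z = 0 ∧ (∀ q, P < q → q < z → f P < f q) ∧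
    f1 P = 0 ∧ f1 z = f P ∧ ∀ q, q ≠ P → q ≠ z → f1 q = f q

def SleepS (hi : ℕ) (f : ℕ → ℕ) (D : Finset ℕ) (P : ℕ)
    (f1 : ℕ → ℕ) (D1 : Finset ℕ) (Q : ℕ) : Prop :=
  hi ≤ P ∧ f1 = f ∧ D1 = D ∧ Q = P

def StartS (B lo hi k : ℕ) (f : ℕ → ℕ) (D : Finset ℕ) (P : ℕ)
    (f1 : ℕ → ℕ) (D1 : Finset ℕ) (Q : ℕ) : Prop :=
  lo ≤ P ∧ P < hi ∧ f1 = f ∧ Q < B ∧ Q ∉ D ∧ 0 < car k f D Q ∧ f Q = 0 ∧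
    (∀ p, Q < p → p ∉ D ∧ f p = 0) ∧ D1 = insert Q D

def NoCrossS (B : ℕ) (f : ℕ → ℕ) (D : Finset ℕ) (P : ℕ)
    (f1 : ℕ → ℕ) (D1 : Finset ℕ) (Q : ℕ) : Prop :=
  P < B ∧ Q < B ∧ ∃ z, Ev f P z f1 ∧ ¬ (P ∉ D ∧ P + 1 ∈ D ∧ z = P + 1) ∧ D1 = D ∧
    Q = if P ∈ D then P else P + 1

def CrossS (B k : ℕ) (f : ℕ → ℕ) (D : Finset ℕ) (P : ℕ)
    (f1 : ℕ → ℕ) (D1 : Finset ℕ) (Q : ℕ) : Prop :=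
  P < B ∧ Ev f P (P + 1) f1 ∧ P ∉ D ∧ P + 1 ∈ D ∧ Q ≤ P ∧
    (∀ p, Q ≤ p → p ≤ P → p ∉ D) ∧ (∀ p, Q ≤ p → p < P → f p = 0) ∧
    0 < car k f D Q ∧ D1 = insert Q (D.erase (P + 1))

def RowStep (B lo hi k : ℕ) (f : ℕ → ℕ) (D : Finset ℕ) (P : ℕ)
    (f1 : ℕ → ℕ) (D1 : Finset ℕ) (Q : ℕ) : Prop :=
  SleepS hi f D P f1 D1 Q ∨ StartS B lo hi k f D P f1 D1 Q ∨
    NoCrossS B f D P f1 D1 Q ∨ CrossS B k f D P f1 D1 Q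

lemma Ev.z_unique {f P z f1 z' f1'} (h : Ev f P z f1) (h' : Ev f P z' f1') : z = z' := by
  obtain ⟨a1, a2, a3, a4, a5, a6, a7⟩ := h
  obtain ⟨b1, b2, b3, b4, b5, b6, b7⟩ := h'
  by_contra hne
  rcases Nat.lt_or_gt_of_ne hne with h | h
  · have := b4 z a1 h; omega
  · have := a4 z' b1 h; omega

lemma Ev.f_unique {f P z f1 z' f1'} (h : Ev f P z f1) (h' : Ev f P z' f1') : f1 = f1' := by
  have hz := h.z_unique h'
  subst hz
  obtain ⟨a1, a2, a3, a4, a5, a6, a7⟩ := h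
  obtain ⟨b1, b2, b3, b4, b5, b6, b7⟩ := h'
  funext q
  by_cases h1 : q = P
  · subst h1; omega
  by_cases h2 : q = z
  · subst h2; omega
  rw [a7 q h1 h2, b7 q h1 h2]

lemma car_succ (k f D p) : car k f D (p + 1) = if p ∈ D then car k f D p else f p := rfl

lemma car_congr_from {k k' f f' D D'} {a : ℕ} (h0 : car k f D a = car k' f' D' a) (p : ℕ) (hp : a ≤ p)
    (hf : ∀ q, a ≤ q → q < p → f q = f' q) (hD : ∀ q, a ≤ q → q < p → (q ∈ D ↔ q ∈ D')) :
    car k f D p = car k' f' D' p := by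
  induction p, hp using Nat.le_induction with
  | base => exact h0
  | succ p hp ih =>
    rw [car_succ, car_succ, ih (fun q h1 h2 => hf q h1 (by omega)) (fun q h1 h2 => hD q h1 (by omega)),
      hf p hp (by omega)]
    have := hD p hp (by omega)
    simp only [this]

lemma car_congr {k f f' D D'} (p : ℕ)
    (hf : ∀ q, q < p → f q = f' q) (hD : ∀ q, q < p → (q ∈ D ↔ q ∈ D')) :
    car k f D p = car k f' D' p :=
  car_congr_from (a := 0) (f' := f') (D' := D') (k' := k)
    (show car k f D 0 = car k f' D' 0 from rfl) p (Nat.zero_le _) (fun q _ h => hf q h) (fun q _ h => hD q h)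

lemma car_nocross {k f D P z f1} (hL : Legit k f D) (hE : Ev f P z f1)
    (hn : ¬ (P ∉ D ∧ P + 1 ∈ D ∧ z = P + 1)) (p : ℕ) :
    car k f1 D p = if p = P + 1 ∧ P ∉ D then 0 else if p = z + 1 ∧ z ∉ D then f P
      else car k f D p := by
  obtain ⟨a1, a2, a3, a4, a5, a6, a7⟩ := hE
  induction p with
  | zero => simp [car]
  | succ p ih =>
    have hLp := hL p
    have hP := car_succ k f D P
    have hz := car_succ k f D z
    rw [car_succ, car_succ, ih]
    grind

lemma car_cross {k f D P f1 q} (hE : Ev f P (P + 1) f1) (hP : P ∉ D) (hP1 : P + 1 ∈ D)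
    (hq : q ≤ P) (hD : ∀ p, q ≤ p → p ≤ P → p ∉ D) (hf : ∀ p, q ≤ p → p < P → f p = 0) (p : ℕ) :
    car k f1 (insert q (D.erase (P + 1))) p = if p = q + 1 then car k f D q
      else if q + 2 ≤ p ∧ p ≤ P + 1 then 0 else car k f D p := by
  obtain ⟨a1, a2, a3, a4, a5, a6, a7⟩ := hE
  induction p with
  | zero => simp [car]
  | succ p ih =>
    have h1 := car_succ k f D p
    have hP := car_succ k f D P
    rw [car_succ, ih]
    simp only [Finset.mem_insert, Finset.mem_erase]
    grind

lemma car_start {k f D q} (hq : q ∉ D) (hf0 : f q = 0)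
    (hD : ∀ p, q < p → p ∉ D ∧ f p = 0) (p : ℕ) :
    car k f (insert q D) p = if p = q + 1 then car k f D q else car k f D p := by
  induction p with
  | zero => simp [car]
  | succ p ih =>
    have h1 := car_succ k f D p
    have hP := car_succ k f D q
    rw [car_succ, ih]
    simp only [Finset.mem_insert]
    grind

lemma car_tail {k f D q} (hq : q ∉ D) (hf0 : f q = 0)
    (hD : ∀ p, q < p → p ∉ D ∧ f p = 0) (p : ℕ) (hp : q < p) : car k f D p = 0 := by
  cases p with
  | zero => omega
  | succ p => rw [car_succ]; grind

/-- First main row lemma: outputs are legitimate. -/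
lemma RowStep.legit {B lo hi k f D P f1 D1 Q} (h : RowStep B lo hi k f D P f1 D1 Q)
    (hL : Legit k f D) : Legit k f1 D1 := by
  rcases h with ⟨_, rfl, rfl, _⟩ | ⟨_, _, rfl, _, h1, h2, h3, h4, rfl⟩ | ⟨_, _, z, hE, hn, rfl, _⟩ |
    ⟨_, hE, h1, h2, h3, h4, h5, h6, rfl⟩
  · exact hL
  · intro p hp
    rw [car_start h1 h3 h4]
    have := hL p
    grind
  · intro p hp
    have hc := car_nocross hL hE hn p
    rw [hc]
    have := hL p hp
    have hP := car_nocross hL hE hn P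
    obtain ⟨a1, a2, a3, a4, a5, a6, a7⟩ := hE
    have hP1 := car_succ k f D1 P
    have hz1 := car_succ k f D1 z
    by_cases hpz : p = z
    · subst hpz
      -- carry at z exceeds f P
      have key : ∀ q, P < q → q ≤ p → (∀ r, r ≤ p → P < r → True) → (q = P + 1 ∧ P ∉ D1) ∨ f P < car k f D1 q := by
        intro q hq
        induction q, hq using Nat.le_induction with
        | base => intro _ _; have := hL P; grind
        | succ q hq ih =>
          intro hqp _
          have := ih (by omega) (fun _ _ _ => trivial)
          have h2 := hL q
          have h3 := a4 q (by omega) (by omega)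
          have := car_succ k f D1 q
          grind
      have := key p a1 le_rfl (fun _ _ _ => trivial)
      grind
    · grind
  · intro p hp
    rw [car_cross hE h1 h2 h3 h4 h5]
    have := hL p
    obtain ⟨a1, a2, a3, a4, a5, a6, a7⟩ := hE
    grind

lemma StartS.event {B lo hi k f D P f1 D1 Q} (h : StartS B lo hi k f D P f1 D1 Q) :
    Ev (out k f D) Q (Q + 1) (out k f1 D1) := by
  obtain ⟨_, _, rfl, _, h1, h2, h3, h4, rfl⟩ := h
  refine ⟨by omega, ?_, ?_, by omega, ?_, ?_, ?_⟩
  · simp only [out]; grind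
  · have := car_succ k f1 D Q
    simp only [out]; grind
  · simp only [out]; grind
  · have := car_start h1 h3 h4 (k := k) (Q+1)
    simp only [out]; grind
  · intro q hq hq1
    have := car_start h1 h3 h4 (k := k) q
    simp only [out]; grind

lemma nocross_event {k f D P z f1 Q} (hE : Ev f P z f1)
    (hn : ¬ (P ∉ D ∧ P + 1 ∈ D ∧ z = P + 1)) (hQ : Q = if P ∈ D then P else P + 1)
    (hL : Legit k f D) :
    Ev (out k f D) Q (if z ∈ D then z else z + 1) (out k f1 D) := by
  subst hQ
  have hc := car_nocross hL hE hn
  have hP := car_succ k f D P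
  have hz := car_succ k f D z
  have hLz := hL (z+1)
  have hLP := hL (P+1)
  obtain ⟨a1, a2, a3, a4, a5, a6, a7⟩ := hE
  refine ⟨by grind, ?_, ?_, ?_, ?_, ?_, ?_⟩
  · simp only [out]; grind
  · simp only [out]; grind
  · intro q h1 h2
    have hLq := hL q
    have key : ∀ q, P < q → q ≤ z → (q = P + 1 ∧ P ∉ D) ∨ f P < car k f D q := by
      intro q hq
      induction q, hq using Nat.le_induction with
      | base => intro _; have := hL P; grind
      | succ q hq ih =>
        intro hqp
        have := ih (by omega)
        have h2 := hL q
        have h3 := a4 q (by omega) (by omega)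
        have := car_succ k f D q
        grind
    have := key q
    have := a4 q
    simp only [out]; grind
  · have := hc P
    have := hc (P+1)
    simp only [out]; grind
  · have := hc z
    have := hc (z+1)
    simp only [out]; grind
  · intro q hq1 hq2
    have := hc q
    simp only [out]; grind

lemma CrossS.event {B k f D P f1 D1 Q} (h : CrossS B k f D P f1 D1 Q) :
    Ev (out k f D) Q (Q + 1) (out k f1 D1) := by
  obtain ⟨_, hE, h1, h2, h3, h4, h5, h6, rfl⟩ := h
  have hc := car_cross (k := k) hE h1 h2 h3 h4 h5
  have hQ1 := car_succ k f D Q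
  have hP1 := car_succ k f D P
  obtain ⟨a1, a2, a3, a4, a5, a6, a7⟩ := hE
  refine ⟨by omega, ?_, ?_, by omega, ?_, ?_, ?_⟩
  · simp only [out]; grind
  · simp only [out]; grind
  · simp only [out]; grind
  · have := hc (Q+1)
    simp only [out]; grind
  · intro q hq1 hq2
    have hcq := hc q
    have : ∀ q, Q < q → q ≤ P → car k f D q = 0 := by
      intro q h h'
      obtain ⟨q, rfl⟩ : ∃ r, q = r + 1 := ⟨q - 1, by omega⟩
      rw [car_succ]; grind
    have := this q
    simp only [out]; grind

lemma RowStep.event {B lo hi k f D P f1 D1 Q} (h : RowStep B lo hi k f D P f1 D1 Q)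
    (hL : Legit k f D) : (Q < B ∧ ∃ z, Ev (out k f D) Q z (out k f1 D1)) ∨
      (hi ≤ Q ∧ Q = P ∧ out k f1 D1 = out k f D) := by
  rcases h with ⟨_, rfl, rfl, rfl⟩ | h | ⟨_, hQ, z, hE, hn, rfl, rfl⟩ | h
  · right; grind
  · exact Or.inl ⟨h.2.2.2.1, _, h.event⟩
  · exact Or.inl ⟨hQ, _, nocross_event hE hn rfl hL⟩
  · exact Or.inl ⟨by have := h.1; have := h.2.2.2.2.1; omega, _, h.event⟩

lemma Ev.g_unique {f f' P z f1} (h : Ev f P z f1) (h' : Ev f' P z f1) : f = f' := by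
  obtain ⟨a1, a2, a3, a4, a5, a6, a7⟩ := h
  obtain ⟨b1, b2, b3, b4, b5, b6, b7⟩ := h'
  funext q
  grind

lemma CrossS.car_zero {B k f D P f1 D1 Q} (h : CrossS B k f D P f1 D1 Q) (p : ℕ) (h1 : Q < p)
    (h2 : p ≤ P) : car k f D p = 0 := by
  obtain ⟨_, hE, _, _, _, h4, h5, _⟩ := h
  obtain ⟨q, rfl⟩ : ∃ r, p = r + 1 := ⟨p - 1, by omega⟩
  rw [car_succ, if_neg (h4 q (by omega) (by omega)), h5 q (by omega) (by omega)]

lemma RowStep.det {B lo hi k f D P f1 D1 Q P' f1' D1' Q'} (hB : B ≤ lo) (hlo : lo ≤ hi)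
    (h : RowStep B lo hi k f D P f1 D1 Q) (h' : RowStep B lo hi k f D P' f1' D1' Q')
    (hP : P = P' ∨ (lo ≤ P ∧ P < hi ∧ lo ≤ P' ∧ P' < hi)) :
    f1 = f1' ∧ D1 = D1' ∧ Q = Q' := by
  rcases h with h | h | h | h <;> rcases h' with h' | h' | h' | h' <;>
    try (exfalso; simp only [SleepS, StartS, NoCrossS, CrossS] at h h'; omega)
  · unfold SleepS at *; grind
  · obtain ⟨_, _, rfl, _, a1, a2, a3, a4, rfl⟩ := h
    obtain ⟨_, _, rfl, _, b1, b2, b3, b4, rfl⟩ := h'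
    have : Q = Q' := by
      by_contra hne
      rcases Nat.lt_or_gt_of_ne hne with h | h
      · have := car_tail a1 a3 a4 (k := k) Q' h; omega
      · have := car_tail b1 b3 b4 (k := k) Q h; omega
    subst this; simp
  · obtain ⟨_, _, z, hE, hn, rfl, rfl⟩ := h
    obtain ⟨_, _, z', hE', hn', rfl, rfl⟩ := h'
    have : P = P' := by omega
    subst this
    exact ⟨hE.f_unique hE', rfl, rfl⟩
  · obtain ⟨_, _, z, hE, hn, rfl, rfl⟩ := h
    obtain ⟨_, hE', h1, h2, _⟩ := h'
    have : P = P' := by omega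
    subst this
    exact absurd ⟨h1, h2, hE.z_unique hE'⟩ hn
  · obtain ⟨_, _, z, hE, hn, rfl, rfl⟩ := h'
    obtain ⟨_, hE', h1, h2, _⟩ := h
    have : P = P' := by omega
    subst this
    exact absurd ⟨h1, h2, hE.z_unique hE'⟩ hn
  · have : P = P' := by simp only [CrossS] at h h'; omega
    subst this
    have e1 := h.car_zero Q'
    have e2 := h'.car_zero Q
    obtain ⟨_, hE, h1, h2, h3, h4, h5, h6, rfl⟩ := h
    obtain ⟨_, hE', g1, g2, g3, g4, g5, g6, rfl⟩ := h'
    have : Q = Q' := by omega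
    subst this
    exact ⟨hE.f_unique hE', rfl, rfl⟩

/-- Order comparison of consecutive steps. -/
lemma RowStep.order {B lo hi k f D X f1 D1 X' Y f2 D2 Y'} (hB : B ≤ lo) (hlo : lo ≤ hi)
    (hL : Legit k f D)
    (hx : RowStep B lo hi k f D X f1 D1 X') (hy : RowStep B lo hi k f1 D1 Y f2 D2 Y')
    (hxy : ¬ (lo ≤ X ∧ X < hi ∧ lo ≤ Y ∧ Y < hi ∧ Y < X)) :
    (X < Y → X' < Y') ∧ (Y < X → Y' < X') := by
  rcases hx with hx | hx | hx | hx
  · obtain ⟨a1, rfl, rfl, rfl⟩ := hx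
    unfold RowStep SleepS StartS NoCrossS CrossS at hy
    grind
  · obtain ⟨_, _, rfl, _, a1, a2, a3, a4, rfl⟩ := hx
    rcases hy with hy | hy | ⟨_, _, z, hE, hn, rfl, rfl⟩ | ⟨_, hE, _, _, _⟩
    · unfold SleepS at hy; grind
    · obtain ⟨_, _, rfl, _, b1, b2, b3, b4, rfl⟩ := hy
      have := b4 X'
      grind
    · obtain ⟨e1, e2, e3, e4, e5, e6, e7⟩ := hE
      have := a4 Y
      have := e4 X'
      grind
    · obtain ⟨e1, e2, e3, e4, e5, e6, e7⟩ := hE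
      have := a4 Y
      grind
  · obtain ⟨_, _, z, hE, hn, rfl, rfl⟩ := hx
    obtain ⟨e1, e2, e3, e4, e5, e6, e7⟩ := hE
    rcases hy with hy | hy | ⟨_, _, z', hE', hn', rfl, rfl⟩ | hy
    · unfold SleepS at hy; grind
    · obtain ⟨_, _, rfl, _, b1, b2, b3, b4, rfl⟩ := hy
      have := b4 z
      grind
    · obtain ⟨c1, c2, c3, c4, c5, c6, c7⟩ := hE'
      have := hL (X + 1)
      have := car_succ k f D2 X
      have := e4 (X+1)
      have := c4 (Y+1)
      grind
    · obtain ⟨_, hE', h1, h2, h3, h4, h5, h6, rfl⟩ := hy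
      obtain ⟨c1, c2, c3, c4, c5, c6, c7⟩ := hE'
      have hLY := hL (Y + 1)
      have hcY := car_succ k f D1 Y
      have h5' := h5 z
      refine ⟨fun hlt => ?_, fun hlt => ?_⟩
      · have := e4 Y hlt
        have := e4 (Y+1) (by omega)
        have hzY : z < Y := by grind
        grind
      · grind
  · obtain ⟨_, hE, h1, h2, h3, h4, h5, h6, rfl⟩ := hx
    obtain ⟨e1, e2, e3, e4, e5, e6, e7⟩ := hE
    rcases hy with hy | hy | ⟨_, _, z', hE', hn', rfl, rfl⟩ | hy
    · unfold SleepS at hy; grind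
    · obtain ⟨_, _, rfl, _, b1, b2, b3, b4, rfl⟩ := hy
      have := b4 (X+1)
      grind
    · obtain ⟨c1, c2, c3, c4, c5, c6, c7⟩ := hE'
      have := h5 Y
      have := c4 (X')
      grind
    · obtain ⟨_, hE', g1, g2, g3, g4, g5, g6, rfl⟩ := hy
      obtain ⟨c1, c2, c3, c4, c5, c6, c7⟩ := hE'
      have := h5 Y
      have := g4 X'
      grind

lemma NoCrossS.det_left {B k f D P f1 D1 Q f' D' P'}
    (hL : Legit k f D) (hL' : Legit k f' D') (ho : out k f D = out k f' D')
    (h : NoCrossS B f D P f1 D1 Q) (h' : NoCrossS B f' D' P' f1 D1 Q) :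
    f = f' ∧ D = D' ∧ P = P' := by
  obtain ⟨_, _, z, hE, hn, rfl, hQ⟩ := h
  obtain ⟨_, _, z', hE', hn', rfl, hQ'⟩ := h'
  have hz := (nocross_event hE hn hQ hL).z_unique (ho ▸ nocross_event hE' hn' hQ' hL')
  have hEE := hE
  have hEE' := hE'
  obtain ⟨a1, a2, a3, a4, a5, a6, a7⟩ := hE
  obtain ⟨b1, b2, b3, b4, b5, b6, b7⟩ := hE'
  have hP : P = P' := by
    have := b4 P
    have := a4 P'
    grind
  subst hP
  have hz' : z = z' := by
    have := hL z'
    have := hL' z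
    have := car_succ k f D1 z
    have := car_succ k f' D1 z'
    grind
  subst hz'
  exact ⟨hEE.g_unique hEE', rfl, rfl⟩

lemma NoCrossS.not_cross {B k f D P f1 D1 Q f' D' P'}
    (hL : Legit k f D) (ho : out k f D = out k f' D')
    (h : NoCrossS B f D P f1 D1 Q) (h' : CrossS B k f' D' P' f1 D1 Q) : False := by
  have hev := h'.event
  obtain ⟨_, _, z, hE, hn, rfl, hQ⟩ := h
  obtain ⟨_, hE', h1, h2, h3, h4, h5, h6, rfl⟩ := h'
  have hz := (nocross_event hE hn hQ hL).z_unique (ho ▸ hev)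
  obtain ⟨a1, a2, a3, a4, a5, a6, a7⟩ := hE
  obtain ⟨b1, b2, b3, b4, b5, b6, b7⟩ := hE'
  have := a4 Q
  have := a4 (Q+1)
  grind

lemma NoCrossS.not_start {B lo hi k f D P f1 D1 Q f' D' P'}
    (h : NoCrossS B f D P f1 D1 Q) (h' : StartS B lo hi k f' D' P' f1 D1 Q) : False := by
  obtain ⟨_, _, z, hE, hn, rfl, hQ⟩ := h
  obtain ⟨_, _, rfl, _, h1, h2, h3, h4, rfl⟩ := h'
  obtain ⟨a1, a2, a3, a4, a5, a6, a7⟩ := hE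
  have := h4 z
  grind

lemma RowStep.det_left {B lo hi k f D P f1 D1 Q f' D' P'} (hB : B ≤ lo) (hlo : lo ≤ hi)
    (hL : Legit k f D) (hL' : Legit k f' D') (ho : out k f D = out k f' D')
    (h : RowStep B lo hi k f D P f1 D1 Q) (h' : RowStep B lo hi k f' D' P' f1 D1 Q) :
    f = f' ∧ D = D' ∧ (P = P' ∨ (lo ≤ P ∧ P < hi ∧ lo ≤ P' ∧ P' < hi)) := by
  rcases h with h | h | h | h <;> rcases h' with h' | h' | h' | h' <;>
    try (exfalso; simp only [SleepS, StartS, NoCrossS, CrossS] at h h'; omega)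
  · unfold SleepS at *; grind
  · obtain ⟨_, _, rfl, _, a1, a2, a3, a4, rfl⟩ := h
    obtain ⟨_, _, rfl, _, b1, b2, b3, b4, hD⟩ := h'
    refine ⟨rfl, ?_, by omega⟩
    ext p
    have := Finset.ext_iff.1 hD p
    grind
  · exact (h'.not_start h).elim
  · exfalso
    obtain ⟨_, _, rfl, _, a1, a2, a3, a4, rfl⟩ := h
    obtain ⟨_, hE', h1, h2, h3, h4, h5, h6, _⟩ := h'
    obtain ⟨b1, b2, b3, b4, b5, b6, b7⟩ := hE'
    have := a4 (P'+1)
    grind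
  · exact (h.not_start h').elim
  · have := NoCrossS.det_left hL hL' ho h h'
    grind
  · exact (h.not_cross hL ho h').elim
  · exfalso
    obtain ⟨_, _, rfl, _, a1, a2, a3, a4, rfl⟩ := h'
    obtain ⟨_, hE', h1, h2, h3, h4, h5, h6, _⟩ := h
    obtain ⟨b1, b2, b3, b4, b5, b6, b7⟩ := hE'
    have := a4 (P+1)
    grind
  · exact (h'.not_cross hL' ho.symm h).elim
  · obtain ⟨_, hE, h1, h2, h3, h4, h5, h6, hD⟩ := h
    obtain ⟨_, hE', g1, g2, g3, g4, g5, g6, hD'⟩ := h'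
    have hPP : P = P' := by
      obtain ⟨a1, a2, a3, a4, a5, a6, a7⟩ := hE
      obtain ⟨b1, b2, b3, b4, b5, b6, b7⟩ := hE'
      rcases Nat.lt_trichotomy P P' with h | h | h
      · have := g5 (P+1); grind
      · exact h
      · have := h5 (P'+1); grind
    subst hPP
    refine ⟨hE.g_unique hE', ?_, Or.inl rfl⟩
    ext p
    have := Finset.ext_iff.1 (hD.symm.trans hD') p
    have := h4 Q
    have := g4 Q
    grind

/-- Searching to the right for the open space. -/
lemma exists_open {k f D} (P : ℕ) (hk : 0 < k) (hL : Legit k f D) (hP : P ∉ D) :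
    ∃ Q ≤ P, (∀ p, Q ≤ p → p ≤ P → p ∉ D) ∧ (∀ p, Q ≤ p → p < P → f p = 0) ∧ 0 < car k f D Q := by
  induction P with
  | zero => exact ⟨0, le_rfl, by grind, by grind, hk⟩
  | succ P ih =>
    by_cases h : 0 < car k f D (P + 1)
    · exact ⟨P + 1, le_rfl, by grind, by grind, h⟩
    · have h1 := car_succ k f D P
      have h2 := hL P
      obtain ⟨Q, h3, h4, h5, h6⟩ := ih (by grind)
      refine ⟨Q, by omega, by grind, ?_, h6⟩
      intro p hp hp'
      have := h5 p hp
      grind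

lemma Ev.exists_f1 {f P z} (h1 : P < z) (h2 : 0 < f P) (h3 : f z = 0) (h4 : ∀ q, P < q → q < z → f P < f q) :
    ∃ f1, Ev f P z f1 :=
  ⟨fun q => if q = P then 0 else if q = z then f P else f q, h1, h2, h3, h4, by simp,
    by simp; omega, by intro q h1 h2; simp [h1, h2]⟩

lemma RowStep.total {B lo hi k f D P c} (hk : 0 < k) (hL : Legit k f D)
    (hf : ∀ p, c ≤ p → f p = 0) (hD : ∀ p, c ≤ p → p ∉ D) (hc : c < B)
    (hP : hi ≤ P ∨ (lo ≤ P ∧ P < hi) ∨ (P < B ∧ ∃ z f1, Ev f P z f1)) :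
    ∃ f1 D1 Q, RowStep B lo hi k f D P f1 D1 Q := by
  rcases hP with h | ⟨h1, h2⟩ | ⟨hPB, z, f1, hE⟩
  · exact ⟨f, D, P, Or.inl ⟨h, rfl, rfl, rfl⟩⟩
  · obtain ⟨Q, h3, h4, h5, h6⟩ := exists_open c hk hL (hD c le_rfl)
    refine ⟨f, insert Q D, Q, Or.inr (Or.inl ⟨h1, h2, rfl, by omega, h4 Q le_rfl h3, h6, ?_, ?_, rfl⟩)⟩
    · grind
    · intro p hp
      rcases Nat.lt_or_ge p c with h | h
      · exact ⟨h4 p (by omega) (by omega), h5 p (by omega) h⟩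
      · exact ⟨hD p h, hf p h⟩
  · by_cases hn : P ∉ D ∧ P + 1 ∈ D ∧ z = P + 1
    · obtain ⟨h1, h2, rfl⟩ := hn
      obtain ⟨Q, h3, h4, h5, h6⟩ := exists_open P hk hL h1
      exact ⟨f1, _, Q, Or.inr (Or.inr (Or.inr ⟨hPB, hE, h1, h2, h3, h4, h5, h6, rfl⟩))⟩
    · refine ⟨f1, D, _, Or.inr (Or.inr (Or.inl ⟨hPB, ?_, z, hE, hn, rfl, rfl⟩))⟩
      obtain ⟨a1, a2, a3, a4, a5, a6, a7⟩ := hE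
      have := hf P
      split <;> grind

lemma RowStep.bd {B lo hi k f D P f1 D1 Q c} (h : RowStep B lo hi k f D P f1 D1 Q)
    (hf : ∀ p, c ≤ p → f p = 0) (hD : ∀ p, c ≤ p → p ∉ D) :
    (∀ p, c + 1 ≤ p → f1 p = 0) ∧ (∀ p, c + 1 ≤ p → p ∉ D1) := by
  rcases h with ⟨_, rfl, rfl, rfl⟩ | ⟨_, _, rfl, _, h1, h2, h3, h4, rfl⟩ | ⟨_, hQ, z, hE, hn, rfl, rfl⟩ |
    ⟨_, hE, h1, h2, h3, h4, h5, h6, rfl⟩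
  · grind
  · refine ⟨by grind, ?_⟩
    intro p hp hpD
    have : p = Q := by grind
    subst this
    obtain ⟨q, rfl⟩ : ∃ r, p = r + 1 := ⟨p - 1, by omega⟩
    rw [car_succ] at h2
    grind
  · obtain ⟨a1, a2, a3, a4, a5, a6, a7⟩ := hE
    have := a4 c
    have := hf P
    grind
  · obtain ⟨a1, a2, a3, a4, a5, a6, a7⟩ := hE
    have := hf P
    grind

/-- beyond a crossing whose carried letter is discharged. -/
lemma no_D_after {k f D Q} (P : ℕ) (hL : Legit k f D) (hQ1 : Q + 1 ∉ D) (hf : ∀ p, Q < p → p < P → f p = 0) :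
    ∀ p, Q < p → p ≤ P → p ∉ D := by
  intro p h1
  induction p, h1 using Nat.le_induction with
  | base => intro _; exact hQ1
  | succ p hp ih =>
    intro hpP hpD
    have h1 := ih (by omega)
    have h2 := hL _ hpD
    have h3 := car_succ k f D p
    have := hf p (by omega) (by omega)
    grind

lemma RowStep.exists_left_nocross {B k f1 D1 Q zs g} (hk : 0 < k) (hL : Legit k f1 D1)
    (hE : Ev g Q zs (out k f1 D1)) (hQB : Q < B)
    (hn : ¬ (Q ∈ D1 ∧ zs = Q + 1 ∧ Q + 1 ∉ D1)) :
    ∃ f P, NoCrossS B f D1 P f1 D1 Q ∧ Legit k f D1 ∧ out k f D1 = g ∧ ∃ z, Ev f P z f1 := by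
  have hEE := hE
  obtain ⟨a1, a2, a3, a4, a5, a6, a7⟩ := hE
  obtain ⟨P, hP, hf1P, hPD⟩ : ∃ P, Q = (if P ∈ D1 then P else P + 1) ∧ f1 P = 0 ∧ (P ∉ D1 → Q ∉ D1) := by
    by_cases hQ : Q ∈ D1
    · exact ⟨Q, by simp [hQ], by simpa [out, hQ] using a5, by grind⟩
    · have : car k f1 D1 Q = 0 := by simpa [out, hQ] using a5
      cases Q with
      | zero => simp [car] at this; omega
      | succ P =>
        have h1 := car_succ k f1 D1 P
        have := hL P
        exact ⟨P, by grind, by grind, by grind⟩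
  have hzs : ∀ q, Q < q → q < zs → g Q < out k f1 D1 q := by
    intro q h1 h2
    rw [a7 q (by omega) (by omega)]; exact a4 q h1 h2
  obtain ⟨z, hz, hfz⟩ : ∃ z, zs = (if z ∈ D1 then z else z + 1) ∧ f1 z = g Q ∧ (z ∉ D1 → zs ∉ D1) := by
    by_cases hQ : zs ∈ D1
    · exact ⟨zs, by simp [hQ], by simpa [out, hQ] using a6, by grind⟩
    · have h0 : car k f1 D1 zs = g Q := by simpa [out, hQ] using a6
      obtain ⟨z, rfl⟩ : ∃ r, zs = r + 1 := ⟨zs - 1, by omega⟩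
      have h1 := car_succ k f1 D1 z
      have h2 := hL z
      have h3 := hzs z
      simp only [out] at h3
      have : z ∉ D1 := by
        intro hz
        grind
      exact ⟨z, by grind, by grind, by grind⟩
  have hPz : P < z := by grind
  have hbet : ∀ q, P < q → q < z → g Q < f1 q := by
    intro q h1 h2
    have h3 := hzs q
    have h4 := hzs (q+1)
    have h5 := car_succ k f1 D1 q
    have h6 := hL (q+1)
    simp only [out] at h3 h4
    grind
  set f : ℕ → ℕ := fun q => if q = P then g Q else if q = z then 0 else f1 q with hfdef
  have hfP : f P = g Q := by simp [hfdef]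
  have hfz0 : f z = 0 := by simp [hfdef]; omega
  have hfo : ∀ q, q ≠ P → q ≠ z → f q = f1 q := by intro q h1 h2; simp [hfdef, h1, h2]
  have hev : Ev f P z f1 := by
    refine ⟨hPz, by omega, hfz0, ?_, hf1P, by omega, ?_⟩
    · intro q h1 h2
      rw [hfP, hfo q (by omega) (by omega)]; exact hbet q h1 h2
    · intro q h1 h2; exact (hfo q h1 h2).symm
  have hcar : ∀ p, car k f D1 p = if p = P + 1 ∧ P ∉ D1 then g Q else if p = z + 1 ∧ z ∉ D1 then 0
      else car k f1 D1 p := by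
    intro p
    clear_value f
    induction p with
    | zero => simp [car]
    | succ p ih =>
      rw [car_succ, car_succ, ih]
      have := hfo p
      grind
  have hLf : Legit k f D1 := by
    intro p hp
    have h1 := hcar p
    have h2 := hL p hp
    have h3 := hL (p + 1)
    have h4 := hfo p
    have h5 := hzs (p + 1)
    have h6 := car_succ k f1 D1 p
    simp only [out] at h5 a6
    clear_value f
    grind
  have hnc : ¬ (P ∉ D1 ∧ P + 1 ∈ D1 ∧ z = P + 1) := by grind
  have hev2 := nocross_event hev hnc hP hLf
  rw [← hz] at hev2
  refine ⟨f, P, ⟨by grind, hQB, z, hev, hnc, rfl, hP⟩, hLf, hev2.g_unique hEE, z, hev⟩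

lemma RowStep.exists_left_cross {B lo hi k f1 D1 Q g} (hL : Legit k f1 D1)
    (hf : ∀ p, B ≤ p → f1 p = 0) (hlohi : lo < hi)
    (hE : Ev g Q (Q + 1) (out k f1 D1)) (hQB : Q < B) (hQD : Q ∈ D1) (hQD1 : Q + 1 ∉ D1) :
    ∃ f D P, RowStep B lo hi k f D P f1 D1 Q ∧ Legit k f D ∧ out k f D = g ∧
      ((P < B ∧ ∃ z, Ev f P z f1) ∨ (P = lo ∧ f = f1)) := by
  have hEE := hE
  obtain ⟨a1, a2, a3, a4, a5, a6, a7⟩ := hE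
  have hcs := car_succ k f1 D1 Q
  have hcQ : 0 < car k f1 D1 Q := by simp only [out] at a6; grind
  have hfQ : f1 Q = 0 := by simpa [out, hQD] using a5
  by_cases hex : ∃ p, Q < p ∧ 0 < f1 p
  · obtain ⟨h1, h2⟩ := Nat.find_spec hex
    have hmin : ∀ p, Q < p → p < Nat.find hex → f1 p = 0 := by
      intro p h1 h2
      have := Nat.find_min hex h2
      grind
    obtain ⟨P, hP⟩ : ∃ P, Nat.find hex = P + 1 := ⟨Nat.find hex - 1, by omega⟩
    rw [hP] at h1 h2 hmin
    have hno := no_D_after (P + 1) hL hQD1 hmin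
    set f : ℕ → ℕ := fun q => if q = P then f1 (P + 1) else if q = P + 1 then 0 else f1 q with hfdef
    have hfP : f P = f1 (P + 1) := by simp [hfdef]
    have hfP1 : f (P + 1) = 0 := by simp [hfdef]
    have hfo : ∀ q, q ≠ P → q ≠ P + 1 → f q = f1 q := by intro q h1 h2; simp [hfdef, h1, h2]
    clear_value f
    set D := insert (P + 1) (D1.erase Q) with hD
    have hmD : ∀ p, p ∈ D ↔ p = P + 1 ∨ (p ≠ Q ∧ p ∈ D1) := by intro p; simp [hD]
    clear_value D
    have hev : Ev f P (P + 1) f1 := by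
      refine ⟨by omega, by omega, hfP1, by omega, ?_, by omega, fun q h1 h2 => (hfo q h1 h2).symm⟩
      rcases Nat.lt_or_ge Q P with h | h
      · exact hmin P h (by omega)
      · have : P = Q := by omega
        rw [this]; exact hfQ
    have hD1 : D1 = insert Q (D.erase (P + 1)) := by
      ext p
      have := hmD p
      have := hno p
      grind
    have hcar0 : car k f D Q = car k f1 D1 Q := by
      apply car_congr
      · intro q hq; exact hfo q (by omega) (by omega)
      · intro q hq; rw [hmD]; grind
    have g1 : ∀ p, Q ≤ p → p ≤ P → p ∉ D := by
      intro p h1 h2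
      have := hmD p
      have := hno p
      grind
    have g2 : ∀ p, Q ≤ p → p < P → f p = 0 := by
      intro p h1 h2
      have := hfo p
      have := hmin p
      grind
    have hcross : CrossS B k f D P f1 D1 Q := by
      refine ⟨?_, hev, g1 P (by omega) le_rfl, ?_, by omega, g1, g2, by omega, hD1⟩
      · by_contra hh
        have := hf (P + 1) (by omega)
        omega
      · rw [hmD]; simp
    refine ⟨f, D, P, Or.inr (Or.inr (Or.inr hcross)), ?_, hcross.event.g_unique hEE, Or.inl ⟨hcross.1, _, hev⟩⟩
    have hc := car_cross (k := k) hev hcross.2.2.1 hcross.2.2.2.1 hcross.2.2.2.2.1 g1 g2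
    rw [← hD1] at hc
    intro p hp
    have h1 := hc p
    have h2 := hL p
    have h3 := (hmD p).1 hp
    have h4 := car_succ k f D P
    have h5 := g1 p
    have := hfo p
    by_cases hpP : p = P + 1
    · subst hpP
      have := g1 P
      grind
    · have := hno p
      grind
  · have hz : ∀ p, Q < p → f1 p = 0 := by
      intro p hp
      by_contra h
      exact hex ⟨p, hp, by omega⟩
    have hno : ∀ p, Q < p → p ∉ D1 := fun p hp => no_D_after p hL hQD1 (fun q h1 _ => hz q h1) p hp le_rfl
    have hcc : car k f1 (D1.erase Q) Q = car k f1 D1 Q :=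
      car_congr Q (fun _ _ => rfl) (by intro q hq; simp; omega)
    have hst : StartS B lo hi k f1 (D1.erase Q) lo f1 D1 Q := by
      refine ⟨le_rfl, hlohi, rfl, hQB, by simp, by omega, hfQ, ?_, ?_⟩
      · intro p hp
        have := hno p hp
        exact ⟨by simp [this], hz p hp⟩
      · rw [Finset.insert_erase hQD]
    refine ⟨f1, D1.erase Q, lo, Or.inr (Or.inl hst), ?_, hst.event.g_unique hEE, Or.inr ⟨rfl, rfl⟩⟩
    obtain ⟨_, _, _, _, h1, h2, h3, h4, h5⟩ := hst
    intro p hp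
    have hc := car_start (k := k) h1 h3 h4 p
    rw [← h5] at hc
    have := hno p
    have := hL p
    grind

lemma RowStep.exists_left {B lo hi k f1 D1 Q zs g} (hk : 0 < k) (hL : Legit k f1 D1)
    (hf : ∀ p, B ≤ p → f1 p = 0) (hlohi : lo < hi)
    (hE : Ev g Q zs (out k f1 D1)) (hQB : Q < B) :
    ∃ f D P, RowStep B lo hi k f D P f1 D1 Q ∧ Legit k f D ∧ out k f D = g ∧
      ((P < B ∧ ∃ z, Ev f P z f1) ∨ (P = lo ∧ f = f1)) := by
  by_cases hn : (Q ∈ D1 ∧ zs = Q + 1 ∧ Q + 1 ∉ D1)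
  · obtain ⟨h1, rfl, h2⟩ := hn
    exact exists_left_cross hL hf hlohi hE hQB h1 h2
  · obtain ⟨f, P, h1, h2, h3, h4⟩ := exists_left_nocross hk hL hE hQB hn
    exact ⟨f, D1, P, Or.inr (Or.inr (Or.inl h1)), h2, h3, Or.inl ⟨h1.1, h4⟩⟩

lemma Ev.comm {f Q zQ fq S zS fs} (hq : Ev f Q zQ fq) (hs : Ev f S zS fs) (h : zQ < S) :
    ∃ g, Ev fq S zS g ∧ Ev fs Q zQ g := by
  obtain ⟨a1, a2, a3, a4, a5, a6, a7⟩ := hq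
  obtain ⟨b1, b2, b3, b4, b5, b6, b7⟩ := hs
  refine ⟨fun q => if q = S then 0 else if q = zS then f S else fq q,
    ⟨b1, by grind, by grind, by grind, by simp, by grind, by grind⟩,
    ⟨a1, by grind, by grind, by grind, by grind, by grind, by grind⟩⟩

lemma RowStep.comm_sleep {B lo hi k f D Q fq Dq Q' S fs Ds S'} (hB : B ≤ lo) (hlo : lo ≤ hi)
    (hq : RowStep B lo hi k f D Q fq Dq Q') (hs : RowStep B lo hi k f D S fs Ds S') (hS : hi ≤ S) :
    RowStep B lo hi k fq Dq S fq Dq S' ∧ RowStep B lo hi k fs Ds Q fq Dq Q' := by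
  have : f = fs ∧ D = Ds ∧ S = S' := RowStep.det hB hlo (Or.inl ⟨hS, rfl, rfl, rfl⟩) hs (Or.inl rfl)
  obtain ⟨rfl, rfl, rfl⟩ := this
  exact ⟨Or.inl ⟨hS, rfl, rfl, rfl⟩, hq⟩

lemma RowStep.comm {B lo hi k f D Q fq Dq Q' S fs Ds S' zQ} (hB : B ≤ lo) (hlo : lo ≤ hi)
    (hL : Legit k f D)
    (hq : RowStep B lo hi k f D Q fq Dq Q') (hE : Ev f Q zQ fq)
    (hs : RowStep B lo hi k f D S fs Ds S') (hQB : Q < B) (hQS : Q < S) (hz : zQ < S') :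
    ∃ g E, RowStep B lo hi k fq Dq S g E S' ∧ RowStep B lo hi k fs Ds Q g E Q' := by
  have hEE := hE
  obtain ⟨a1, a2, a3, a4, a5, a6, a7⟩ := hE
  rcases hs with hs | hs | hs | hs
  · have := RowStep.comm_sleep hB hlo hq (Or.inl hs) hs.1
    exact ⟨_, _, this⟩
  · obtain ⟨h1, h2, rfl, h4, h5, h6, h7, h8, rfl⟩ := hs
    rcases hq with hq | hq | hq | hq
    · exfalso; have := hq.1; omega
    · exfalso; have := hq.1; omega
    · obtain ⟨g1, g2, z, g3, g4, rfl, g5⟩ := hq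
      have := g3.z_unique hEE; subst this
      have hc := car_nocross hL g3 g4 S'
      refine ⟨fq, insert S' Dq, Or.inr (Or.inl ⟨h1, h2, rfl, h4, h5, ?_, ?_, ?_, rfl⟩),
        Or.inr (Or.inr (Or.inl ⟨g1, g2, z, g3, ?_, rfl, ?_⟩))⟩
      · grind
      · grind
      · intro p hp; have := h8 p; grind
      · grind
      · grind
    · obtain ⟨g1, g2, g3, g4, g5, g6, g7, g8, rfl⟩ := hq
      have := g2.z_unique hEE; subst this
      have hc := car_cross (k := k) g2 g3 g4 g5 g6 g7 S'
      refine ⟨fq, insert S' (insert Q' (D.erase (Q + 1))), Or.inr (Or.inl ⟨h1, h2, rfl, h4, ?_, ?_, ?_, ?_, rfl⟩),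
        Or.inr (Or.inr (Or.inr ⟨g1, g2, ?_, ?_, g5, ?_, ?_, ?_, ?_⟩))⟩
      · grind
      · grind
      · grind
      · intro p hp; have := h8 p; grind
      · grind
      · grind
      · grind
      · grind
      · rw [car_congr (f' := fs) (D' := D) Q' (fun _ _ => rfl) (by grind)]; exact g8
      · ext p; grind
  · obtain ⟨h1, h2, zS, h4, h5, rfl, h6⟩ := hs
    have hzS : zQ < S := by
      obtain ⟨b1, b2, b3, b4, b5, b6, b7⟩ := h4
      grind
    obtain ⟨g, e1, e2⟩ := hEE.comm h4 hzS
    rcases hq with hq | hq | hq | hq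
    · exfalso; have := hq.1; omega
    · exfalso; have := hq.1; omega
    · obtain ⟨g1, g2, z, g3, g4, rfl, g5⟩ := hq
      have := g3.z_unique hEE; subst this
      exact ⟨g, Dq, Or.inr (Or.inr (Or.inl ⟨h1, h2, zS, e1, h5, rfl, h6⟩)),
         Or.inr (Or.inr (Or.inl ⟨g1, g2, z, e2, g4, rfl, g5⟩))⟩
    · obtain ⟨g1, g2, g3, g4, g5, g6, g7, g8, rfl⟩ := hq
      have := g2.z_unique hEE; subst this
      obtain ⟨b1, b2, b3, b4, b5, b6, b7⟩ := h4
      refine ⟨g, insert Q' (Ds.erase (Q + 1)), Or.inr (Or.inr (Or.inl ⟨h1, h2, zS, e1, ?_, rfl, ?_⟩)),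
        Or.inr (Or.inr (Or.inr ⟨g1, e2, g3, g4, g5, g6, ?_, ?_, rfl⟩))⟩
      · grind
      · grind
      · intro p h1 h2; rw [b7 p (by omega) (by omega)]; exact g7 p h1 h2
      · rw [car_congr (f' := f) (D' := Ds) Q' (fun p hp => b7 p (by omega) (by omega)) (fun _ _ => Iff.rfl)]; exact g8
  · obtain ⟨h1, h2, h3, h4, h5, h6, h7, h8, rfl⟩ := hs
    obtain ⟨g, e1, e2⟩ := hEE.comm h2 (by omega)
    obtain ⟨b1, b2, b3, b4, b5, b6, b7⟩ := h2
    rcases hq with hq | hq | hq | hq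
    · exfalso; have := hq.1; omega
    · exfalso; have := hq.1; omega
    · obtain ⟨g1, g2, z, g3, g4, rfl, g5⟩ := hq
      have := g3.z_unique hEE; subst this
      have hc := car_nocross hL g3 g4 S'
      refine ⟨g, insert S' (Dq.erase (S+1)), Or.inr (Or.inr (Or.inr ⟨h1, e1, h3, h4, h5, h6, ?_, ?_, rfl⟩)),
         Or.inr (Or.inr (Or.inl ⟨g1, g2, z, e2, ?_, rfl, ?_⟩))⟩
      · intro p h1 h2; rw [a7 p (by omega) (by omega)]; exact h7 p h1 h2
      · grind
      · grind
      · grind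
    · obtain ⟨g1, g2, g3, g4, g5, g6, g7, g8, rfl⟩ := hq
      have := g2.z_unique hEE; subst this
      have hc := car_cross (k := k) g2 g3 g4 g5 g6 g7 S'
      refine ⟨g, insert S' ((insert Q' (D.erase (Q + 1))).erase (S + 1)),
        Or.inr (Or.inr (Or.inr ⟨h1, e1, ?_, ?_, h5, ?_, ?_, ?_, rfl⟩)),
        Or.inr (Or.inr (Or.inr ⟨g1, e2, ?_, ?_, g5, ?_, ?_, ?_, ?_⟩))⟩
      · grind
      · grind
      · intro p i1 i2; have := h6 p; grind
      · intro p h1 h2; rw [a7 p (by omega) (by omega)]; exact h7 p h1 h2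
      · grind
      · grind
      · grind
      · intro p i1 i2; have := g6 p; grind
      · intro p h1 h2; rw [b7 p (by omega) (by omega)]; exact g7 p h1 h2
      · rw [car_congr (f' := f) (D' := D) Q' (fun p hp => b7 p (by omega) (by omega)) (by grind)]; exact g8
      · ext p; grind

def NI (lo hi X Y : ℕ) : Prop := ¬ (lo ≤ X ∧ X < hi ∧ lo ≤ Y ∧ Y < hi ∧ Y < X)

def KRel (B : ℕ) (f : ℕ → ℕ) (P Q R P' Q' R' : ℕ) : Prop :=
  (Q < P ∧ P < R ∧ P' = P ∧ Q' = R ∧ R' = Q) ∨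
  (Q < R ∧ R < P ∧ P' = Q ∧ Q' = P ∧ R' = R) ∨
  (R = P ∧ Q < P ∧ P' = Q ∧ R' = P ∧ P < B ∧ Q' < B ∧ ∃ g, Ev f P Q' g)

lemma RowStep.gen {B lo hi k f D P f1 D1 Q} (hB : B ≤ lo) (hlo : lo ≤ hi) (hP : P < B)
    (h : RowStep B lo hi k f D P f1 D1 Q) : ∃ z, Ev f P z f1 ∧
     ((¬ (P ∉ D ∧ P + 1 ∈ D ∧ z = P + 1) ∧ D1 = D ∧ Q < B ∧ Q = if P ∈ D then P else P + 1) ∨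
      (z = P + 1 ∧ CrossS B k f D P f1 D1 Q)) := by
  rcases h with h | h | h | h
  · have := h.1; omega
  · have := h.1; omega
  · obtain ⟨g1, g2, z, g3, g4, rfl, g5⟩ := h
    exact ⟨z, g3, Or.inl ⟨g4, rfl, g2, g5⟩⟩
  · exact ⟨P + 1, h.2.1, Or.inr ⟨rfl, h⟩⟩

lemma RowStep.nonsleep {B lo hi k f D P f1 D1 Q} (hB : B ≤ lo) (hlo : lo ≤ hi) (hP : P < hi)
    (h : RowStep B lo hi k f D P f1 D1 Q) : P < B ∨ (lo ≤ P ∧ StartS B lo hi k f D P f1 D1 Q) := by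
  rcases h with h | h | h | h
  · have := h.1; omega
  · exact Or.inr ⟨h.1, h⟩
  · exact Or.inl h.1
  · exact Or.inl h.1

lemma knuth_T1 {B lo hi k f D P Q R f1 D1 Ps f2 D2 Qs f3 D3 Rs Pt f1' D1' f2' D2' Rt f3' D3' Qt}
    (hB : B ≤ lo) (hlo : lo ≤ hi) (hL : Legit k f D)
    (h1 : Q < P) (h2 : P < R)
    (a1 : RowStep B lo hi k f D P f1 D1 Ps) (a2 : RowStep B lo hi k f1 D1 Q f2 D2 Qs)
    (a3 : RowStep B lo hi k f2 D2 R f3 D3 Rs)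
    (b1 : RowStep B lo hi k f D P f1' D1' Pt) (b2 : RowStep B lo hi k f1' D1' R f2' D2' Rt)
    (b3 : RowStep B lo hi k f2' D2' Q f3' D3' Qt)
    (n1 : NI lo hi P Q) :
    f3 = f3' ∧ D3 = D3' ∧ Qs < Ps ∧ Ps < Rs ∧ Pt = Ps ∧ Rt = Rs ∧ Qt = Qs := by
  obtain ⟨rfl, rfl, rfl⟩ := RowStep.det hB hlo a1 b1 (Or.inl rfl)
  have hL1 := a1.legit hL
  have hPR := (RowStep.order hB hlo hL a1 b2 (by omega)).1 h2
  have hQP := (RowStep.order hB hlo hL a1 a2 n1).2 h1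
  suffices hs : ∃ g E, RowStep B lo hi k f2 D2 R g E Rt ∧ RowStep B lo hi k f2' D2' Q g E Qs by
    obtain ⟨g, E, c1, c2⟩ := hs
    obtain ⟨rfl, rfl, rfl⟩ := RowStep.det hB hlo a3 c1 (Or.inl rfl)
    obtain ⟨rfl, rfl, rfl⟩ := RowStep.det hB hlo b3 c2 (Or.inl rfl)
    exact ⟨rfl, rfl, hQP, hPR, rfl, rfl, rfl⟩
  by_cases hR : hi ≤ R
  · exact ⟨_, _, RowStep.comm_sleep hB hlo a2 b2 hR⟩
  · have hPh : P < hi := by omega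
    have hQB : Q < B := by
      rcases a2.nonsleep hB hlo (by omega) with h | h
      · exact h
      · exfalso; exact n1 ⟨by omega, by omega, by omega, by omega, by omega⟩
    obtain ⟨z, hE, -⟩ := a2.gen hB hlo hQB
    refine RowStep.comm hB hlo hL1 a2 hE b2 hQB (by omega) ?_
    refine lt_of_le_of_lt ?_ hPR
    by_contra hz
    obtain ⟨e1, e2, e3, e4, e5, e6, e7⟩ := hE
    have e4' := e4 Ps
    rcases a1 with a1 | a1 | a1 | a1
    · have := a1.1; omega
    · obtain ⟨_, _, rfl, _, i1, i2, i3, i4, _⟩ := a1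
      have := i4 Q
      grind
    · obtain ⟨_, _, z', hE', i1, _, i2⟩ := a1
      obtain ⟨c1, c2, c3, c4, c5, c6, c7⟩ := hE'
      have := e4 P
      grind
    · obtain ⟨_, hE', i1, i2, i3, i4, i5, i6, _⟩ := a1
      obtain ⟨c1, c2, c3, c4, c5, c6, c7⟩ := hE'
      have := i5 Q
      have := i5 Ps
      have := e4 P
      grind

lemma knuth_exc {B lo hi k De p Q f1 f2 D2 Qs f3 D3 Rs f2' f3' D3' Rt}
    (hB : B ≤ lo) (hlo : lo ≤ hi) (hL : Legit k f1 (insert p De)) (hpB : p < B)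
    (hp : p ∉ De) (hp1 : p + 1 ∉ De) (hQp : Q < p)
    (a2 : RowStep B lo hi k f1 (insert p De) Q f2 D2 Qs) (ea2 : Ev f1 Q p f2)
    (a3 : RowStep B lo hi k f2 D2 p f3 D3 Rs)
    (b3 : RowStep B lo hi k f2' (insert (p + 1) De) p f3' D3' Rt) (eb3 : Ev f2' p (p + 1) f3')
    (hag : ∀ q, q < p → q ≠ Q → f2' q = f1 q) (hagQ : f2' Q = 0)
    (hcp : 0 < car k f1 (insert p De) p) :
    D3 = D3' ∧ ((Qs = (if Q ∈ De then Q else Q + 1) ∧ Qs ≤ p ∧ Rs = p ∧ Rt = p) ∨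
      (Q + 1 = p ∧ Q ∉ De ∧ Qs ≤ Q ∧ Rs = p + 1 ∧ Rt = Qs)) := by
  obtain ⟨z2, e2, c2⟩ := a2.gen hB hlo (by omega)
  obtain ⟨z3, e3, c3⟩ := a3.gen hB hlo hpB
  obtain ⟨z4, e4, c4⟩ := b3.gen hB hlo hpB
  obtain rfl := e2.z_unique ea2
  obtain rfl := e4.z_unique eb3
  have c4' : CrossS B k f2' (insert (z2 + 1) De) z2 f3' D3' Rt := by
    rcases c4 with c4 | c4
    · exfalso; apply c4.1; grind
    · exact c4.2
  have hz4 := c4'.car_zero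
  obtain ⟨_, _, d1, d2, d3, d4, d5, d6, d7⟩ := c4'
  have hD3' : D3' = insert Rt De := by rw [d7]; ext q; grind
  rcases c2 with ⟨c2, rfl, _, hQs⟩ | ⟨hz, c2⟩
  · have hc := car_nocross hL ea2 c2 z2
    have hcc : car k f2' (insert (z2 + 1) De) z2 = car k f2 (insert z2 De) z2 := by
      obtain ⟨i1, i2, i3, i4, i5, i6, i7⟩ := ea2
      apply car_congr
      · intro q hq
        by_cases h : q = Q
        · subst h; omega
        · rw [hag q hq h, i7 q h (by omega)]
      · grind
    have hRt : Rt = z2 := by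
      have := hz4 z2
      grind
    subst hRt
    have c3' : D3 = insert Rt De ∧ Rs = Rt := by
      rcases c3 with ⟨_, i1, _, i2⟩ | ⟨_, c3⟩
      · exact ⟨i1, by rw [i2]; simp⟩
      · exact absurd (Finset.mem_insert_self _ _) c3.2.2.1
    exact ⟨by rw [c3'.1, hD3'], Or.inl ⟨by grind, by grind, c3'.2, rfl⟩⟩
  · have hz2 := c2.car_zero
    obtain ⟨_, _, g1, g2, g3, g4, g5, g6, g7⟩ := c2
    have hD2 : D2 = insert Qs De := by rw [g7]; ext q; grind
    have hzz : z2 ∉ D2 := by rw [hD2]; grind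
    have c3' : D3 = D2 ∧ Rs = z2 + 1 := by
      rcases c3 with ⟨_, i1, _, i2⟩ | ⟨_, c3⟩
      · exact ⟨i1, by rw [i2]; simp [hzz]⟩
      · exfalso
        have := c3.2.2.2.1
        rw [hD2] at this
        grind
    have hcc : ∀ q, q ≤ Q → car k f2' (insert (z2 + 1) De) q = car k f1 (insert z2 De) q := by
      intro q hq
      apply car_congr
      · intro q' hq'
        exact hag q' (by omega) (by omega)
      · grind
    have hRt : Rt = Qs := by
      have h1 := hz4 Qs
      have h2 := hz2 Rt
      have h3 := hcc Qs
      have h4 := hcc Rt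
      have h5 := car_succ k f2' (insert (z2 + 1) De) Q
      have h6 := d4 Q
      have : Rt ≠ z2 := by
        rintro rfl
        grind
      grind
    subst hRt
    exact ⟨by rw [c3'.1, hD3', hD2], Or.inr ⟨by omega, by grind, g3, c3'.2, rfl⟩⟩

set_option maxHeartbeats 2000000 in
lemma knuth_T2 {B lo hi k f D P Q R f1 D1 Ps f2 D2 Qs f3 D3 Rs Pt f1' D1' f2' D2' Rt f3' D3' Qt}
    (hB : B ≤ lo) (hlo : lo ≤ hi) (hL : Legit k f D)
    (h1 : Q < R) (h2 : R < P)
    (a1 : RowStep B lo hi k f D P f1 D1 Ps) (a2 : RowStep B lo hi k f1 D1 Q f2 D2 Qs)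
    (a3 : RowStep B lo hi k f2 D2 R f3 D3 Rs)
    (b1 : RowStep B lo hi k f D Q f1' D1' Qt) (b2 : RowStep B lo hi k f1' D1' P f2' D2' Pt)
    (b3 : RowStep B lo hi k f2' D2' R f3' D3' Rt)
    (n1 : NI lo hi P R) :
    f3 = f3' ∧ D3 = D3' ∧ KRel B (out k f D) Ps Qs Rs Qt Pt Rt := by
  have comm_case : (∃ g E, RowStep B lo hi k f1' D1' P g E Ps ∧ RowStep B lo hi k f1 D1 Q g E Qt) →
      f3 = f3' ∧ D3 = D3' ∧ KRel B (out k f D) Ps Qs Rs Qt Pt Rt := by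
    rintro ⟨g, E, c1, c2⟩
    have o1 := (RowStep.order hB hlo (a1.legit hL) a2 a3 (by omega)).1 h1
    have o2 := (RowStep.order hB hlo (b1.legit hL) b2 b3 n1).2 h2
    obtain ⟨rfl, rfl, rfl⟩ := RowStep.det hB hlo b2 c1 (Or.inl rfl)
    obtain ⟨rfl, rfl, rfl⟩ := RowStep.det hB hlo a2 c2 (Or.inl rfl)
    obtain ⟨rfl, rfl, rfl⟩ := RowStep.det hB hlo a3 b3 (Or.inl rfl)
    exact ⟨rfl, rfl, Or.inr (Or.inl ⟨o1, o2, rfl, rfl, rfl⟩)⟩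
  by_cases hP : hi ≤ P
  · exact comm_case ⟨_, _, RowStep.comm_sleep hB hlo b1 a1 hP⟩
  have hRB : R < B := by
    rcases a3.nonsleep hB hlo (by omega) with h | h
    · exact h
    · exfalso; exact n1 ⟨by omega, by omega, by omega, by omega, by omega⟩
  obtain ⟨z, hE, hb1⟩ := b1.gen hB hlo (by omega)
  by_cases hz : z < Ps
  · exact comm_case (RowStep.comm hB hlo hL b1 hE a1 (by omega) (by omega) hz)
  have hE0 := hE
  obtain ⟨e1, e2, e3, e4, e5, e6, e7⟩ := hE
  obtain ⟨zR, hER, -⟩ := a3.gen hB hlo hRB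
  have hER0 := hER
  obtain ⟨r1, r2, r3, r4, r5, r6, r7⟩ := hER
  -- facts common to the two exceptional cases
  have key : ∃ De, D1 = insert Ps De ∧ D2' = insert (Ps + 1) De ∧ Ps ∉ De ∧ Ps + 1 ∉ De ∧ z = Ps ∧
      (∀ q, q ≤ Ps → (q ∈ De ↔ q ∈ D)) ∧ Pt = Ps + 1 ∧ 0 < car k f D Ps ∧
      (∀ q, q ≤ Ps → f1 q = f q) ∧ f1 (Ps + 1) = 0 ∧
      (∀ q, q ≠ Q → q ≠ Ps → f2' q = f1 q) ∧ f2' Q = 0 ∧ f2' Ps = f Q ∧ Ps < B ∧ Ps + 1 < B ∧ R ≤ Ps := by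
    rcases a1 with a1 | a1 | a1 | a1
    · exfalso; exact hP a1.1
    · obtain ⟨i1, i2, rfl, i3, i4, i5, i6, i7, rfl⟩ := a1
      have hz' : z = Ps := by
        have := e4 Ps
        have := i7 Q
        grind
      subst hz'
      have hb1' : D1' = D := by
        rcases hb1 with hb1 | ⟨_, hb1⟩
        · exact hb1.2.1
        · have := hb1.2.2.2.1
          grind
      subst hb1'
      have b2' : StartS B lo hi k f1' D1' P f2' D2' Pt := by
        rcases b2.nonsleep hB hlo (by omega) with h | h
        · omega
        · exact h.2
      obtain ⟨_, _, rfl, j3, j4, j5, j6, j7, rfl⟩ := b2'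
      have hPt : Pt = z + 1 := by
        have h1 : z < Pt := by
          have := j7 z
          grind
        obtain ⟨q, rfl⟩ : ∃ q, Pt = q + 1 := ⟨Pt - 1, by omega⟩
        have := car_succ k f2' D1' q
        have := i7 q
        grind
      subst hPt
      refine ⟨D1', rfl, rfl, i4, j4, rfl, by grind, rfl, i5, by grind, by grind, by grind, by grind, by grind,
        i3, j3, ?_⟩
      by_contra hRz
      obtain ⟨u, hu, -⟩ := b3.gen hB hlo hRB
      obtain ⟨s1, s2, s3, s4, s5, s6, s7⟩ := hu
      have := i7 R
      grind
    · exfalso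
      obtain ⟨_, _, zP, hEP, _, _, i2⟩ := a1
      have hPz : P < z := by
        obtain ⟨c1, c2, c3, c4, c5, c6, c7⟩ := hEP
        have : P ≠ z := by grind
        grind
      obtain ⟨u, hu, -⟩ := b2.gen hB hlo (by assumption)
      obtain ⟨s1, s2, s3, s4, s5, s6, s7⟩ := hu
      have h1 := s4 z
      have h2 := e4 P
      have h3 := e4 u
      grind
    · obtain ⟨i0, hEP, i1, i2, i3, i4, i5, i6, rfl⟩ := a1
      have hEP0 := hEP
      obtain ⟨c1, c2, c3, c4, c5, c6, c7⟩ := hEP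
      have hQPs : Q < Ps := by
        have := i5 Q
        grind
      have hzP : z < P := by
        by_contra hzP
        have : P ≠ z := by grind
        obtain ⟨u, hu, -⟩ := b2.gen hB hlo i0
        obtain ⟨s1, s2, s3, s4, s5, s6, s7⟩ := hu
        have h1 := s4 z
        have h2 := e4 P
        have h3 := e4 u
        grind
      have hz' : z = Ps := by
        have := e4 Ps
        have := i5 Ps
        grind
      subst hz'
      have hb1' : D1' = D := by
        rcases hb1 with hb1 | ⟨_, hb1⟩
        · exact hb1.2.1
        · have := hb1.2.2.2.1
          have := i4 z
          grind
      subst hb1'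
      have b2' : CrossS B k f1' D1' P f2' D2' Pt := by
        obtain ⟨u, hu, hb⟩ := b2.gen hB hlo i0
        have hu' : u = P + 1 := by
          obtain ⟨s1, s2, s3, s4, s5, s6, s7⟩ := hu
          have h1 := s4 (P + 1)
          grind
        rcases hb with hb | hb
        · exfalso; exact hb.1 ⟨i1, i2, hu'⟩
        · exact hb.2
      obtain ⟨_, hu, j1, j2, j3, j4, j5, j6, rfl⟩ := b2'
      obtain ⟨s1, s2, s3, s4, s5, s6, s7⟩ := hu
      have hPt : Pt = z + 1 := by
        have h1 : z < Pt := by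
          have := j5 z
          grind
        obtain ⟨q, rfl⟩ : ∃ q, Pt = q + 1 := ⟨Pt - 1, by omega⟩
        have := car_succ k f1' D1' q
        have := i5 q
        have := i4 q
        grind
      subst hPt
      have := i4 z
      have := i4 (z + 1)
      refine ⟨D1'.erase (P + 1), rfl, rfl, by grind, by grind, rfl, by grind, rfl, i6, by grind, ?_, ?_, by grind,
        by grind, by omega, by omega, ?_⟩
      · have := i5 (z + 1)
        grind
      · intro q h1 h2
        by_cases h3 : q = P
        · subst h3; rw [s5, c5]
        by_cases h4 : q = P + 1
        · subst h4; rw [s6, c6, e7 _ (by omega) (by omega)]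
        rw [s7 q h3 h4, c7 q h3 h4, e7 q h1 h2]
      · by_contra hRz
        obtain ⟨u, hu, -⟩ := b3.gen hB hlo hRB
        obtain ⟨s1', s2', _⟩ := hu
        have := i5 R
        grind
  obtain ⟨De, rfl, rfl, k1, k2, rfl, k3, rfl, k4, k5, k6, k7, k8, k9, k10, k11, k12⟩ := key
  have ea2 : Ev f1 Q z f2 := by
    obtain ⟨u, hu, -⟩ := a2.gen hB hlo (by omega)
    have hu0 := hu
    obtain ⟨s1, s2, s3, s4, s5, s6, s7⟩ := hu
    have : u = z := by
      have := s4 z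
      have := e4 u
      grind
    subst this; exact hu0
  have hRz : R = z := by
    by_contra hne
    obtain ⟨s1, s2, s3, s4, s5, s6, s7⟩ := ea2
    have h1 := r4 z
    have h2 := s4 R
    have h3 := s4 zR
    grind
  subst hRz
  have hff : f2 = f2' := by
    obtain ⟨s1, s2, s3, s4, s5, s6, s7⟩ := ea2
    funext q
    grind
  subst hff
  have eb3 : Ev f2 R (R + 1) f3 := by
    have : zR = R + 1 := by
      have := r4 (R + 1)
      grind
    subst this; exact hER0
  obtain ⟨u, hu, -⟩ := b3.gen hB hlo hRB
  have hf3 := hER0.f_unique hu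
  subst hf3
  obtain ⟨hD, hres⟩ := knuth_exc hB hlo (a1.legit hL) k10 k1 k2 h1 a2 ea2 a3 b3 eb3
    (by intro q h1 h2; exact k7 q h2 (by omega)) k8 (by
      rw [car_congr (f' := f) (D' := D) R (fun q hq => k5 q (by omega)) (by intro q hq; rw [← k3 q (by omega)]; simp; omega)]
      exact k4)
  refine ⟨rfl, hD, ?_⟩
  have hb1' : Qt = if Q ∈ D then Q else Q + 1 := by
    rcases hb1 with hb1 | ⟨hh, hb1⟩
    · exact hb1.2.2.2
    · exfalso
      have := hb1.2.2.2.1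
      have := k3 R
      grind
  have htop : ∃ g, Ev (out k f D) R (R + 1) g := by
    rcases a1 with a1 | a1 | a1 | a1
    · exfalso; exact hP a1.1
    · exact ⟨_, a1.event⟩
    · exfalso
      obtain ⟨_, _, zP, hEP, _, i1, i2⟩ := a1
      have := Finset.ext_iff.1 i1 R
      grind
    · exact ⟨_, a1.event⟩
  have o2 := (RowStep.order hB hlo hL a1 a2 (by intro hh; omega)).2 (by omega)
  have hQD := k3 Q (by omega)
  rcases hres with ⟨i1, i2, rfl, rfl⟩ | ⟨i1, i2, i3, i4, i5⟩
  · refine Or.inr (Or.inr ⟨rfl, o2, by grind, rfl, k10, k11, htop⟩)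
  · exact Or.inl ⟨by omega, by omega, by grind, by omega, i5⟩

lemma ev_T3 {f P z1 f1 Q z2 f2 z3 f3 y1 f1' y2 f2' y3 f3'} (hQP : Q < P)
    (ea1 : Ev f P z1 f1) (ea2 : Ev f1 Q z2 f2) (ea3 : Ev f2 P z3 f3)
    (eb1 : Ev f Q y1 f1') (eb2 : Ev f1' z1 y2 f2') (eb3 : Ev f2' P y3 f3') :
    z2 = P ∧ y1 = z1 ∧ y3 = z1 ∧ z3 = y2 ∧ f3 = f3' ∧ f Q < f P ∧ z1 < z3 ∧
     (∀ q, Q < q → q < P → f Q < f q) := by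
  obtain ⟨a11, a12, a13, a14, a15, a16, a17⟩ := ea1
  obtain ⟨a21, a22, a23, a24, a25, a26, a27⟩ := ea2
  obtain ⟨a31, a32, a33, a34, a35, a36, a37⟩ := ea3
  obtain ⟨b11, b12, b13, b14, b15, b16, b17⟩ := eb1
  obtain ⟨b21, b22, b23, b24, b25, b26, b27⟩ := eb2
  obtain ⟨b31, b32, b33, b34, b35, b36, b37⟩ := eb3
  have i1 : z2 = P := by
    by_contra hne
    have h1 := a27 P (by omega) (fun h => hne h.symm)
    omega
  subst i1
  have i2 : y1 = z1 := by
    by_contra hne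
    have h1 := b17 z1 (by omega) (fun h => hne h.symm)
    omega
  subst i2
  have i3 : f Q < f z2 := b14 z2 hQP a11
  have i4 : y3 = y1 := by
    have e1 : f2' y1 = 0 := b25
    have e2 : f2' z2 = f z2 := by rw [b27 _ (by omega) (by omega), b17 _ (by omega) (by omega)]
    rcases lt_trichotomy y3 y1 with h | h | h
    · exfalso
      have h1 := a14 y3 b31 h
      rw [b27 _ (by omega) (by omega), b17 _ (by omega) (by omega)] at b33
      omega
    · exact h
    · have := b34 y1 a11 h; omega
  subst i4
  have e0 : f1 Q = f Q := a17 _ (by omega) (by omega)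
  have e1 : f2 y3 = f z2 := by rw [a27 _ (by omega) (by omega), a16]
  have i5 : y3 < z3 := by
    rcases lt_trichotomy z3 y3 with h | h | h
    · exfalso
      have h1 := a14 z3 a31 h
      rw [a27 _ (by omega) (by omega), a17 _ (by omega) (by omega)] at a33
      omega
    · subst h; omega
    · exact h
  have key : ∀ q, y3 < q → f2 q = f q ∧ f1' q = f q := by
    intro q hq
    rw [a27 _ (by omega) (by omega), a17 _ (by omega) (by omega), b17 _ (by omega) (by omega)]
    exact ⟨rfl, rfl⟩
  have i6 : z3 = y2 := by
    rcases lt_trichotomy z3 y2 with h | h | h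
    · have := b24 z3 i5 h
      have := key z3 i5
      omega
    · exact h
    · have := a34 y2 (by omega) h
      have := key y2 b21
      omega
  subst i6
  refine ⟨rfl, rfl, rfl, rfl, ?_, i3, i5, ?_⟩
  · funext q
    by_cases j1 : q = z2
    · subst j1; rw [a35, b35]
    by_cases j2 : q = z3
    · subst j2
      rw [a36, b37 _ (by omega) (by omega), b26, b16, a26, a17 _ (by omega) (by omega)]
    rw [a37 q j1 j2]
    by_cases j3 : q = y3
    · subst j3
      rw [a27 _ (by omega) (by omega), a16, b36, b27 _ (by omega) (by omega), b17 _ (by omega) (by omega)]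
    rw [b37 q j1 j3, b27 q j3 j2]
    by_cases j4 : q = Q
    · subst j4; rw [a25, b15]
    rw [a27 q j4 j1, a17 q j1 j3, b17 q j4 j3]
  · intro q h1 h2
    exact b14 q h1 (by omega)

set_option maxHeartbeats 2000000 in
lemma knuth_T3 {B lo hi k f D P Q m g f1 D1 Ps f2 D2 Qs f3 D3 Rs Qt f1' D1' f2' D2' Mt f3' D3' Pt}
    (hB : B ≤ lo) (hlo : lo ≤ hi) (hL : Legit k f D)
    (h1 : Q < P) (hPB : P < B) (hmB : m < B) (hm : Ev f P m g)
    (a1 : RowStep B lo hi k f D P f1 D1 Ps) (a2 : RowStep B lo hi k f1 D1 Q f2 D2 Qs)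
    (a3 : RowStep B lo hi k f2 D2 P f3 D3 Rs)
    (b1 : RowStep B lo hi k f D Q f1' D1' Qt) (b2 : RowStep B lo hi k f1' D1' m f2' D2' Mt)
    (b3 : RowStep B lo hi k f2' D2' P f3' D3' Pt) :
    f3 = f3' ∧ D3 = D3' ∧ KRel B (out k f D) Ps Qs Rs Qt Mt Pt := by
  have oQP := (RowStep.order hB hlo hL a1 a2 (by omega)).2 h1
  have hL1 := a1.legit hL
  have hL1' := b1.legit hL
  obtain ⟨z1, ea1, ca1⟩ := a1.gen hB hlo hPB
  obtain ⟨z2, ea2, ca2⟩ := a2.gen hB hlo (by omega)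
  obtain ⟨z3, ea3, ca3⟩ := a3.gen hB hlo hPB
  obtain ⟨y1, eb1, cb1⟩ := b1.gen hB hlo (by omega)
  obtain ⟨y2, eb2, cb2⟩ := b2.gen hB hlo hmB
  obtain ⟨y3, eb3, cb3⟩ := b3.gen hB hlo hPB
  obtain rfl := ea1.z_unique hm
  clear hm
  have hfacts := ev_T3 h1 ea1 ea2 ea3 eb1 eb2 eb3
  obtain ⟨rfl, rfl, rfl, rfl, rfl, hQP, hz13, hbet⟩ := hfacts
  -- first step of run B never crosses
  have cb1' : D1' = D ∧ Qt = if Q ∈ D then Q else Q + 1 := by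
    rcases cb1 with ⟨_, i1, _, i2⟩ | ⟨i1, _⟩
    · exact ⟨i1, i2⟩
    · exfalso; have := ea1.1; omega
  obtain ⟨rfl, hQt⟩ := cb1'
  have hnb1 : ¬ (Q ∉ D1' ∧ Q + 1 ∈ D1' ∧ y3 = Q + 1) := by
    have := ea1.1
    omega
  have cb2' : D2' = D1' ∧ Mt = if y3 ∈ D1' then y3 else y3 + 1 := by
    rcases cb2 with ⟨_, i1, _, i2⟩ | ⟨i1, i2⟩
    · exact ⟨i1, i2⟩
    · exfalso
      obtain ⟨_, _, j1, j2, _⟩ := i2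
      have h1 := hL _ j2
      have h2 := car_succ k f D1' y3
      have := ea1.2.2.1
      grind
  obtain ⟨rfl, hMt⟩ := cb2'
  have hMtB : Mt < B := by
    rcases cb2 with ⟨_, i1, i3, i2⟩ | ⟨i1, i2⟩
    · exact i3
    · have := i2.1; have := i2.2.2.2.2.1; omega
  refine ⟨rfl, ?_⟩
  rcases ca1 with ⟨hn, rfl, hPsB, hPs⟩ | ⟨hz1, ca1⟩
  · have ca2' : D2 = D1 ∧ Qs = if Q ∈ D1 then Q else Q + 1 := by
      rcases ca2 with ⟨_, i1, _, i2⟩ | ⟨i1, i2⟩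
      · exact ⟨i1, i2⟩
      · exfalso
        obtain ⟨_, _, j1, j2, _⟩ := i2
        have h1 := hL _ j2
        have h2 := car_succ k f D1 Q
        grind
    obtain ⟨rfl, hQs⟩ := ca2'
    have ca3' : D3 = D2 ∧ Rs = if z2 ∈ D2 then z2 else z2 + 1 := by
      rcases ca3 with ⟨_, i1, _, i2⟩ | ⟨i1, i2⟩
      · exact ⟨i1, i2⟩
      · exfalso; have := ea1.1; omega
    have cb3' : D3' = D2 ∧ Pt = if z2 ∈ D2 then z2 else z2 + 1 := by
      rcases cb3 with ⟨_, i1, _, i2⟩ | ⟨i1, i2⟩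
      · exact ⟨i1, i2⟩
      · exfalso; exact hn ⟨i2.2.2.1, i2.2.2.2.1, i1⟩
    refine ⟨by rw [ca3'.1, cb3'.1], Or.inr (Or.inr ⟨by rw [ca3'.2, hPs], oQP, by rw [hQt, hQs],
      by rw [cb3'.2, hPs], hPsB, hMtB, out k f1 D2, ?_⟩)⟩
    rw [hMt]
    exact nocross_event ea1 hn hPs hL
  · have ca10 := ca1
    have htop := ca1.event
    obtain ⟨_, _, d1, d2, d3, d4, d5, d6, rfl⟩ := ca1
    subst hz1
    have hPs : Ps = z2 := by
      by_contra hne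
      have h1 := d5 (z2 - 1) (by omega) (by omega)
      have h2 := hbet (z2 - 1)
      have := eb1.2.1
      by_cases h : z2 - 1 = Q
      · rw [h] at h1; omega
      · have := h2 (by omega) (by omega); omega
    subst hPs
    have hD2' : D2' = insert (Ps + 1) (D2'.erase (Ps + 1)) := by rw [Finset.insert_erase d2]
    have hp1 : Ps ∉ D2'.erase (Ps + 1) := by simp [d1]
    have hp2 : Ps + 1 ∉ D2'.erase (Ps + 1) := by simp
    rw [hD2'] at b3
    obtain ⟨hD, hres⟩ := knuth_exc hB hlo hL1 hPB hp1 hp2 h1 a2 ea2 a3 b3 eb3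
      (by
        obtain ⟨a11, a12, a13, a14, a15, a16, a17⟩ := ea1
        obtain ⟨b11, b12, b13, b14, b15, b16, b17⟩ := eb1
        obtain ⟨b21, b22, b23, b24, b25, b26, b27⟩ := eb2
        intro q h1 h2
        rw [b27 q (by omega) (by omega), b17 q h2 (by omega), a17 q (by omega) (by omega)])
      (by
        obtain ⟨b11, b12, b13, b14, b15, b16, b17⟩ := eb1
        obtain ⟨b21, b22, b23, b24, b25, b26, b27⟩ := eb2
        rw [b27 Q (by omega) (by omega), b15])
      (by
        have hc := car_cross (k := k) ea1 d1 d2 d3 d4 d5 Ps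
        rw [hc]
        simpa using d6)
    refine ⟨hD, ?_⟩
    have hMt' : Mt = Ps + 1 := by rw [hMt, if_pos d2]
    rcases hres with ⟨i1, i2, rfl, rfl⟩ | ⟨i1, i2, i3, i4, i5⟩
    · refine Or.inr (Or.inr ⟨rfl, oQP, ?_, rfl, hPB, hMtB, ?_⟩)
      · rw [hQt, i1]; grind
      · rw [hMt']; exact ⟨_, htop⟩
    · exact Or.inl ⟨by omega, by omega, by grind, by omega, i5⟩

/-- The Knuth relation is preserved by a row. -/
lemma knuth_row {B lo hi k f D P Q R f1 D1 Ps f2 D2 Qs f3 D3 Rs P' Q' R' Pt f1' D1' f2' D2' Rt f3' D3' Qt}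
    (hB : B ≤ lo) (hlo : lo ≤ hi) (hL : Legit k f D) (hK : KRel B f P Q R P' Q' R')
    (a1 : RowStep B lo hi k f D P f1 D1 Ps) (a2 : RowStep B lo hi k f1 D1 Q f2 D2 Qs)
    (a3 : RowStep B lo hi k f2 D2 R f3 D3 Rs)
    (b1 : RowStep B lo hi k f D P' f1' D1' Pt) (b2 : RowStep B lo hi k f1' D1' Q' f2' D2' Qt)
    (b3 : RowStep B lo hi k f2' D2' R' f3' D3' Rt)
    (n1 : NI lo hi P Q) (n2 : NI lo hi P R) :
    f3 = f3' ∧ D3 = D3' ∧ KRel B (out k f D) Ps Qs Rs Pt Qt Rt := by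
  rcases hK with ⟨h1, h2, rfl, rfl, rfl⟩ | ⟨h1, h2, rfl, rfl, rfl⟩ | ⟨rfl, h2, rfl, rfl, h3, h4, g, hg⟩
  · obtain ⟨e1, e2, e3, e4, e5, e6, e7⟩ := knuth_T1 hB hlo hL h1 h2 a1 a2 a3 b1 b2 b3 n1
    exact ⟨e1, e2, Or.inl ⟨e3, e4, e5, e6, e7⟩⟩
  · exact knuth_T2 hB hlo hL h1 h2 a1 a2 a3 b1 b2 b3 n2
  · exact knuth_T3 hB hlo hL h2 h3 h4 hg a1 a2 a3 b1 b2 b3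

/-- The word below row `r+1` of the diagram with row sets `D`. -/
def Fw (D : ℕ → Finset ℕ) : ℕ → ℕ → ℕ
  | 0 => fun _ => 0
  | r + 1 => out (r + 1) (Fw D r) (D r)

def LegitG (n : ℕ) (D : ℕ → Finset ℕ) : Prop := ∀ r < n, Legit (r + 1) (Fw D r) (D r)

def BdG (n c : ℕ) (D : ℕ → Finset ℕ) : Prop :=
  (∀ r ≤ n, ∀ p, c ≤ p → Fw D r p = 0) ∧ ∀ r < n, ∀ p, c ≤ p → p ∉ D r

/-- Trace of an insertion through the first rows. -/
def Tr (B : ℕ) (D D' : ℕ → Finset ℕ) : ℕ → ℕ → ℕ → Prop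
  | 0, P, Q => Q = P
  | r + 1, P, Q => ∃ M, Tr B D D' r P M ∧
      RowStep B ((r + 1) * B) ((r + 2) * B) (r + 1) (Fw D r) (D r) M (Fw D' r) (D' r) Q

lemma loB (B r : ℕ) : B ≤ (r + 1) * B := by nlinarith
lemma lohi (B r : ℕ) : (r + 1) * B ≤ (r + 2) * B := by nlinarith

lemma Fw_congr {D D' : ℕ → Finset ℕ} (r : ℕ) (h : ∀ s < r, D s = D' s) : Fw D r = Fw D' r := by
  induction r with
  | zero => rfl
  | succ r ih =>
    simp only [Fw]
    rw [ih (fun s hs => h s (by omega)), h r (by omega)]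

lemma Tr.inv {B D D' r P Q} (hP : B ≤ P) (h : Tr B D D' r P Q) :
    Q < B ∨ (Q = P ∧ (r + 1) * B ≤ P) := by
  induction r generalizing Q with
  | zero => right; simp only [Tr] at h; subst h; simpa using hP
  | succ r ih =>
    obtain ⟨M, h1, h2⟩ := h
    have := ih h1
    have hb := loB B r
    have hb2 := lohi B r
    rcases h2 with h2 | h2 | h2 | h2
    · obtain ⟨i1, i2, i3, i4⟩ := h2
      right
      have : (r + 1 + 1) * B = (r + 2) * B := by ring
      omega
    · exact Or.inl h2.2.2.2.1
    · exact Or.inl h2.2.1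
    · left; have := h2.1; have := h2.2.2.2.2.1; omega

lemma Tr.top {B D D' n x i Q} (hx : 1 ≤ x) (hxn : x ≤ n) (hi : i < B)
    (h : Tr B D D' n (x * B + i) Q) : Q < B := by
  rcases h.inv (by nlinarith) with h | ⟨h1, h2⟩
  · exact h
  · exfalso; nlinarith

lemma Tr.legit {B D D' n P Q} (h : Tr B D D' n P Q) (hL : LegitG n D) : LegitG n D' := by
  induction n generalizing Q with
  | zero => intro r hr; omega
  | succ n ih =>
    obtain ⟨M, h1, h2⟩ := h
    intro r hr
    rcases Nat.lt_succ_iff_lt_or_eq.1 hr with h | h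
    · exact ih h1 (fun s hs => hL s (by omega)) r h
    · subst h; exact h2.legit (hL r (by omega))

lemma Tr.mono {B D D' n P Q} (h : Tr B D D' (n + 1) P Q) : ∃ M, Tr B D D' n P M :=
  let ⟨M, h, _⟩ := h; ⟨M, h⟩

lemma Tr.bd {B D D' n P Q c} (h : Tr B D D' n P Q) (hb : BdG n c D) (hQ : Q < B) (hP : B ≤ P)
    (hL : LegitG n D) : BdG n (c + 1) D' := by
  have key : ∀ m ≤ n, ∀ r < m, ∀ P Q, Tr B D D' m P Q → (∀ p, c + 1 ≤ p → Fw D' r p = 0) ∧ (∀ p, c + 1 ≤ p → p ∉ D' r) := by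
    intro m
    induction m with
    | zero => intro hm r hr; omega
    | succ m ih =>
      intro hm r hr P Q h
      obtain ⟨M, h1, h2⟩ := h
      rcases Nat.lt_succ_iff_lt_or_eq.1 hr with h | h
      · exact ih (by omega) r h _ _ h1
      · subst h
        exact h2.bd (hb.1 r (by omega)) (hb.2 r (by omega))
  refine ⟨?_, fun r hr => (key n le_rfl r hr _ _ h).2⟩
  intro r hr
  rcases Nat.lt_or_eq_of_le hr with hr | rfl
  · exact (key n le_rfl r hr _ _ h).1
  · rcases r with _ | r
    · intro p _; rfl
    · obtain ⟨M, h1, h2⟩ := h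
      intro p hp
      obtain ⟨k1, k2⟩ := key (r + 1) le_rfl r (by omega) P Q ⟨M, h1, h2⟩
      rcases h2.event (hL r (by omega)) with ⟨_, z, e⟩ | ⟨e1, e2, e3⟩
      · obtain ⟨e1, e2, e3, e4, e5, e6, e7⟩ := e
        show out (r + 1) (Fw D' r) (D' r) p = 0
        by_cases hpz : p = z
        · exfalso
          have hQc : Q < c := by
            by_contra hc
            have := hb.1 (r + 1) le_rfl Q (by omega)
            simp only [Fw] at this
            omega
          have hc := e4 c hQc (by omega)
          have := hb.1 (r + 1) le_rfl c (by omega)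
          simp only [Fw] at this
          omega
        · by_cases hpQ : p = Q
          · subst hpQ; exact e5
          · rw [e7 p hpQ hpz]
            exact hb.1 (r + 1) le_rfl p (by omega)
      · exfalso
        have := loB B (r+1)
        have : (r + 1 + 1) * B = (r + 2) * B := by ring
        omega

lemma Tr.event {B D D' n P Q} (h : Tr B D D' n P Q) (hL : LegitG n D) (hQ : Q < B) (hP : B ≤ P) :
    ∃ z, Ev (Fw D n) Q z (Fw D' n) := by
  rcases n with _ | n
  · simp only [Tr] at h; omega
  · obtain ⟨M, h1, h2⟩ := h
    rcases h2.event (hL n (by omega)) with ⟨_, z, e⟩ | ⟨e1, e2, e3⟩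
    · exact ⟨z, e⟩
    · exfalso
      have := loB B (n+1)
      have : (n + 1 + 1) * B = (n + 2) * B := by ring
      omega

lemma Tr.sleep {B D D' n P} (hD : ∀ r < n, D r = D' r) (hP : (n + 1) * B ≤ P) : Tr B D D' n P P := by
  induction n with
  | zero => rfl
  | succ n ih =>
    refine ⟨P, ih (fun r hr => hD r (by omega)) (by nlinarith), Or.inl ⟨?_, ?_, (hD n (by omega)).symm, rfl⟩⟩
    · have : (n + 1 + 1) * B = (n + 2) * B := by ring
      omega
    · exact (Fw_congr n (fun s hs => hD s (by omega))).symm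

lemma Tr.sleep_eq {B D D' n P} (hB : 0 < B) (hP : B ≤ P) (h : Tr B D D' n P P) : (∀ r < n, D r = D' r) := by
  induction n with
  | zero => intro r hr; omega
  | succ n ih =>
    obtain ⟨M, h1, h2⟩ := h
    have := loB B n
    have := lohi B n
    rcases h2 with h2 | h2 | h2 | h2
    · obtain ⟨i1, i2, i3, rfl⟩ := h2
      have := ih h1
      intro r hr
      rcases Nat.lt_succ_iff_lt_or_eq.1 hr with h | h
      · exact this r h
      · subst h; exact i3.symm
    · have := h2.2.2.2.1; omega
    · have := h2.2.1; omega
    · have := h2.1; have := h2.2.2.2.2.1; omega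

/-- Change of the (irrelevant) index of the letter. -/
lemma Tr.shift {B D D' n x i j Q} (hx : 1 ≤ x) (hi : i < B) (hj : j < B)
    (h : Tr B D D' n (x * B + i) Q) : Tr B D D' n (x * B + j) (if Q < B then Q else x * B + j) := by
  induction n generalizing Q with
  | zero =>
    simp only [Tr] at h ⊢
    rw [if_neg]; nlinarith
  | succ n ih =>
    obtain ⟨M, h1, h2⟩ := h
    refine ⟨_, ih h1, ?_⟩
    have hb := loB B n
    have hh := lohi B n
    have hc : n + 2 ≤ x ∨ x = n + 1 ∨ x ≤ n := by omega
    have hxB : B ≤ x * B := by nlinarith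
    rcases h1.inv (by omega) with hM | ⟨rfl, hM⟩
    · rw [if_pos hM]
      have : Q < B := by
        rcases h2 with h2 | h2 | h2 | h2
        · have := h2.1; omega
        · exact h2.2.2.2.1
        · exact h2.2.1
        · have := h2.1; have := h2.2.2.2.2.1; omega
      rw [if_pos this]; exact h2
    · rw [if_neg (by omega)]
      rcases h2 with h2 | h2 | h2 | h2
      · obtain ⟨i1, i2, i3, i4⟩ := h2
        rw [if_neg (by omega)]
        refine Or.inl ⟨?_, i2, i3, rfl⟩
        rcases hc with h | h | h
        · nlinarith
        · subst h; nlinarith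
        · nlinarith
      · obtain ⟨i1, i2, i3⟩ := h2
        rw [if_pos i3.2.1]
        refine Or.inr (Or.inl ⟨?_, ?_, i3⟩)
        · rcases hc with h | h | h <;> nlinarith
        · rcases hc with h | h | h
          · nlinarith
          · subst h; nlinarith
          · nlinarith
      · have := h2.1; omega
      · have := h2.1; omega

lemma Tr.det {B D D' D'' n P Q Q'} (h : Tr B D D' n P Q) (h' : Tr B D D'' n P Q') :
    Q = Q' ∧ ∀ r < n, D' r = D'' r := by
  induction n generalizing Q Q' with
  | zero =>
    simp only [Tr] at h h'
    exact ⟨by omega, fun r hr => by omega⟩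
  | succ n ih =>
    obtain ⟨M, h1, h2⟩ := h
    obtain ⟨M', h1', h2'⟩ := h'
    obtain ⟨rfl, hD⟩ := ih h1 h1'
    obtain ⟨e1, e2, e3⟩ := RowStep.det (loB B n) (lohi B n) h2 h2' (Or.inl rfl)
    refine ⟨e3, fun r hr => ?_⟩
    rcases Nat.lt_succ_iff_lt_or_eq.1 hr with h | h
    · exact hD r h
    · subst h; exact e2

lemma Tr.det_left {B D1 D2 D' n x1 x2 Q} (hB : 0 < B) (hx1 : 1 ≤ x1) (hx2 : 1 ≤ x2)
    (hL1 : LegitG n D1) (hL2 : LegitG n D2)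
    (h1 : Tr B D1 D' n (x1 * B) Q) (h2 : Tr B D2 D' n (x2 * B) Q) (ho : Fw D1 n = Fw D2 n) :
    x1 = x2 ∧ ∀ r < n, D1 r = D2 r := by
  induction n generalizing Q with
  | zero =>
    simp only [Tr] at h1 h2
    have : x1 * B = x2 * B := by omega
    exact ⟨Nat.eq_of_mul_eq_mul_right hB this, fun r hr => by omega⟩
  | succ n ih =>
    obtain ⟨M, h1, h1'⟩ := h1
    obtain ⟨M', h2, h2'⟩ := h2
    obtain ⟨e1, e2, e3⟩ := RowStep.det_left (loB B n) (lohi B n) (hL1 n (by omega)) (hL2 n (by omega)) ho h1' h2'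
    have hM : M = M' := by
      rcases e3 with h | ⟨i1, i2, i3, i4⟩
      · exact h
      · have := loB B n
        have j1 := h1.inv (by nlinarith)
        have j2 := h2.inv (by nlinarith)
        obtain ⟨rfl, _⟩ : M = x1 * B ∧ _ := by rcases j1 with h | h <;> [omega; exact h]
        obtain ⟨rfl, _⟩ : M' = x2 * B ∧ _ := by rcases j2 with h | h <;> [omega; exact h]
        have k1 := Nat.lt_of_mul_lt_mul_right i2
        have k2 := Nat.lt_of_mul_lt_mul_right i4
        have k3 := Nat.le_of_mul_le_mul_right i1 hB
        have k4 := Nat.le_of_mul_le_mul_right i3 hB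
        have : x1 = x2 := by omega
        rw [this]
    subst hM
    obtain ⟨k1, k2⟩ := ih (fun r hr => hL1 r (by omega)) (fun r hr => hL2 r (by omega)) h1 h2 e1
    refine ⟨k1, fun r hr => ?_⟩
    rcases Nat.lt_succ_iff_lt_or_eq.1 hr with h | h
    · exact k2 r h
    · subst h; exact e2

lemma Tr.congr {B D1 D2 D1' D2' n P Q} (h1 : ∀ r < n, D1 r = D2 r) (h2 : ∀ r < n, D1' r = D2' r)
    (h : Tr B D1 D1' n P Q) : Tr B D2 D2' n P Q := by
  induction n generalizing Q with
  | zero => exact h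
  | succ n ih =>
    obtain ⟨M, h3, h4⟩ := h
    refine ⟨M, ih (fun r hr => h1 r (by omega)) (fun r hr => h2 r (by omega)) h3, ?_⟩
    rw [← Fw_congr n (fun s hs => h1 s (by omega)), ← Fw_congr n (fun s hs => h2 s (by omega)), ← h1 n (by omega), ← h2 n (by omega)]
    exact h4

lemma LegitG.congr {D1 D2 n} (h1 : ∀ r < n, D1 r = D2 r) (h : LegitG n D1) : LegitG n D2 := by
  intro r hr
  rw [← h1 r hr, ← Fw_congr r (fun s hs => h1 s (by omega))]
  exact h r hr

/-- Existence of inverse insertions. -/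
lemma Tr.exists_left {B D' n g Q} (hB : 0 < B) (hL : LegitG n D') (hb : BdG n B D')
    (h : (Q < B ∧ ∃ z, Ev g Q z (Fw D' n)) ∨ (∃ x, n + 1 ≤ x ∧ Q = x * B ∧ g = Fw D' n)) :
    ∃ D x, 1 ≤ x ∧ Tr B D D' n (x * B) Q ∧ LegitG n D ∧ Fw D n = g ∧ (Q < B → x ≤ n) := by
  induction n generalizing Q g with
  | zero =>
    rcases h with ⟨_, z, e⟩ | ⟨x, h1, rfl, rfl⟩
    · have h1 := e.2.2.2.2.2.1; have h2 := e.2.1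
      simp only [Fw] at h1
      omega
    · refine ⟨D', x, h1, rfl, by intro r hr; omega, rfl, ?_⟩
      intro h; exfalso; nlinarith
  | succ n ih =>
    have hLn : LegitG n D' := fun r hr => hL r (by omega)
    have hbn : BdG n B D' := ⟨fun r hr => hb.1 r (by omega), fun r hr => hb.2 r (by omega)⟩
    have fin : ∀ f E M, RowStep B ((n + 1) * B) ((n + 2) * B) (n + 1) f E M (Fw D' n) (D' n) Q →
        Legit (n + 1) f E → out (n + 1) f E = g → ((M < B ∧ ∃ z, Ev f M z (Fw D' n)) ∨
           (∃ x, n + 1 ≤ x ∧ M = x * B ∧ f = Fw D' n)) → (∀ x, M = x * B → Q < B → x ≤ n + 1) → ∃ D x, 1 ≤ x ∧ Tr B D D' (n + 1) (x * B) Q ∧ LegitG (n + 1) D ∧ Fw D (n + 1) = g ∧ (Q < B → x ≤ n + 1) := by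
      intro f E M h1 h2 h3 h4 h5
      obtain ⟨D, x, k1, k2, k3, k4, k5⟩ := ih hLn hbn h4
      have hc : ∀ r < n, D r = Function.update D n E r := by
        intro r hr; rw [Function.update_of_ne (by omega)]
      have hF : Fw (Function.update D n E) n = f := by rw [← Fw_congr n hc, k4]
      refine ⟨Function.update D n E, x, k1, ⟨M, k2.congr hc (fun _ _ => rfl), ?_⟩, ?_, ?_, ?_⟩
      · rw [hF, Function.update_self]; exact h1
      · intro r hr
        rcases Nat.lt_succ_iff_lt_or_eq.1 hr with h | h
        · exact k3.congr hc r h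
        · subst h; rw [hF, Function.update_self]; exact h2
      · simp only [Fw]; rw [hF, Function.update_self]; exact h3
      · intro hQ
        rcases k2.inv (by nlinarith) with h | h
        · have := k5 h; omega
        · exact h5 x h.1 hQ
    rcases h with ⟨hQ, z, e⟩ | ⟨x, h1, rfl, rfl⟩
    · obtain ⟨f, E, M, s, l, o, r⟩ := RowStep.exists_left (lo := (n + 1) * B) (hi := (n + 2) * B) (by omega : 0 < n + 1) (hL n (by omega)) (hb.1 n (by omega)) (by nlinarith) e hQ
      refine fin f E M s l o ?_ ?_
      · rcases r with r | r
        · exact Or.inl r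
        · exact Or.inr ⟨n + 1, le_rfl, r.1, r.2⟩
      · intro x hx hQ
        rcases r with r | r
        · subst hx; have := r.1; have : x < 1 := by
            by_contra h; nlinarith
          omega
        · have : x * B = (n + 1) * B := by rw [← hx, r.1]
          have := Nat.eq_of_mul_eq_mul_right hB this
          omega
    · refine fin (Fw D' n) (D' n) (x * B) (Or.inl ⟨by nlinarith, rfl, rfl, rfl⟩) (hL n (by omega)) rfl (Or.inr ⟨x, by omega, rfl, rfl⟩) ?_
      intro y hy hQ
      exfalso; nlinarith

lemma row_bound {k f D c} (hL : Legit k f D) (h : ∀ p, c ≤ p → out k f D p = 0) :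
    (∀ p, c ≤ p → p ∉ D) ∧ ∀ p, c ≤ p → f p = 0 := by
  have h1 : ∀ p, c ≤ p → p ∉ D := by
    intro p hp hD
    have key : ∀ m, p + m ∈ D ∧ 0 < car k f D (p + m) := by
      intro m
      induction m with
      | zero => exact ⟨hD, by have := hL p hD; simp; omega⟩
      | succ m ih =>
        have hc : car k f D (p + m + 1) = car k f D (p + m) := by rw [car_succ, if_pos ih.1]
        have : p + m + 1 ∈ D := by
          by_contra hn
          have := h (p + m + 1) (by omega)
          unfold out at this
          rw [if_neg hn] at this
          omega
        exact ⟨this, by rw [← add_assoc]; omega⟩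
    have hle := Finset.le_sup (f := id) (key (D.sup id + 1)).1
    simp only [id] at hle
    omega
  refine ⟨h1, fun p hp => ?_⟩
  have := h (p + 1) (by omega)
  unfold out at this
  rw [if_neg (h1 (p + 1) (by omega)), car_succ, if_neg (h1 p hp)] at this
  exact this

lemma bdG_of_top {n c D} (hL : LegitG n D) (h : ∀ p, c ≤ p → Fw D n p = 0) : BdG n c D := by
  induction n with
  | zero =>
    refine ⟨fun r hr p hp => ?_, fun r hr => by omega⟩
    obtain rfl : r = 0 := by omega
    exact h p hp
  | succ n ih =>
    obtain ⟨h1, h2⟩ := row_bound (hL n (by omega)) h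
    obtain ⟨h3, h4⟩ := ih (fun r hr => hL r (by omega)) h2
    constructor
    · intro r hr
      rcases Nat.lt_or_eq_of_le hr with hr | rfl
      · exact h3 r (by omega)
      · exact h
    · intro r hr
      rcases Nat.lt_succ_iff_lt_or_eq.1 hr with hr | rfl
      · exact h4 r hr
      · exact h1

lemma Tr.total {B D n x c} (hx : 1 ≤ x) (hL : LegitG n D) (hb : BdG n c D) (hc : c < B) :
    ∃ D' Q, Tr B D D' n (x * B) Q := by
  induction n with
  | zero => exact ⟨D, _, rfl⟩
  | succ n ih =>
    have hLn : LegitG n D := fun r hr => hL r (by omega)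
    obtain ⟨D', M, h⟩ := ih hLn ⟨fun r hr => hb.1 r (by omega), fun r hr => hb.2 r (by omega)⟩
    have hst : ∃ E Q, RowStep B ((n + 1) * B) ((n + 2) * B) (n + 1) (Fw D n) (D n) M (Fw D' n) E Q := by
      have hxB : B ≤ x * B := by nlinarith
      have hinv := h.inv hxB
      have hcase : (n + 2) * B ≤ M ∨ ((n + 1) * B ≤ M ∧ M < (n + 2) * B) ∨ (M < B ∧ ∃ z f1, Ev (Fw D n) M z f1) := by
        rcases hinv with h1 | h1
        · right; right
          obtain ⟨z, e⟩ := h.event hLn h1 hxB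
          exact ⟨h1, z, _, e⟩
        · by_cases h2 : (n + 2) * B ≤ M
          · exact Or.inl h2
          · right; left; omega
      obtain ⟨f1, E, Q, s⟩ := RowStep.total (by omega : 0 < n + 1) (hL n (by omega)) (hb.1 n (by omega)) (hb.2 n (by omega)) hc hcase
      refine ⟨E, Q, ?_⟩
      have : f1 = Fw D' n := by
        rcases hinv with h1 | ⟨h1, h2⟩
        · obtain ⟨z, e⟩ := h.event hLn h1 hxB
          obtain ⟨z', e', -⟩ := s.gen (loB B n) (lohi B n) h1
          exact e'.f_unique e
        · subst h1
          have := (Fw_congr n (h.sleep_eq (by omega) hxB))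
          rw [← this]
          have := loB B n
          rcases s with s | s | s | s
          · exact s.2.1
          · exact s.2.2.1
          · have := s.1; omega
          · have := s.1; omega
      rw [← this]; exact s
    obtain ⟨E, Q, s⟩ := hst
    have hc : ∀ r < n, D' r = Function.update D' n E r := by
      intro r hr; rw [Function.update_of_ne (by omega)]
    refine ⟨Function.update D' n E, Q, M, h.congr (fun _ _ => rfl) hc, ?_⟩
    rw [← Fw_congr n hc, Function.update_self]; exact s

lemma Tr.order {B D D1 D2 n X Y X' Y'} (hL : LegitG n D) (hX : B ≤ X) (hY : B ≤ Y) (h1 : Tr B D D1 n X X') (h2 : Tr B D1 D2 n Y Y')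
    (hne : ∀ r, NI ((r + 1) * B) ((r + 2) * B) X Y) :
    (X < Y → X' < Y') ∧ (Y < X → Y' < X') := by
  induction n generalizing X' Y' with
  | zero => simp only [Tr] at h1 h2; subst h1 h2; exact ⟨id, id⟩
  | succ n ih =>
    obtain ⟨M, h1, s1⟩ := h1
    obtain ⟨N, h2, s2⟩ := h2
    have := ih (fun r hr => hL r (by omega)) h1 h2
    have hi1 := h1.inv hX
    have hi2 := h2.inv hY
    have := RowStep.order (loB B n) (lohi B n) (hL n (by omega)) s1 s2 (by
      rintro ⟨i1, i2, i3, i4, i5⟩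
      have := loB B n
      refine hne n ⟨?_, ?_, ?_, ?_, ?_⟩ <;> omega)
    grind

lemma Tr.knuth {B D D1 D2 D3 D1' D2' D3' n X Y Z X' Y' Z' P Q R P' Q' R'} (hL : LegitG n D)
    (hX : B ≤ X) (hY : B ≤ Y) (hZ : B ≤ Z)
    (hK : KRel B (Fw D 0) X Y Z X' Y' Z')
    (a1 : Tr B D D1 n X P) (a2 : Tr B D1 D2 n Y Q) (a3 : Tr B D2 D3 n Z R)
    (b1 : Tr B D D1' n X' P') (b2 : Tr B D1' D2' n Y' Q') (b3 : Tr B D2' D3' n Z' R')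
    (hn1 : ∀ r, NI ((r + 1) * B) ((r + 2) * B) X Y)
    (hn2 : ∀ r, NI ((r + 1) * B) ((r + 2) * B) X Z) :
    (∀ r < n, D3 r = D3' r) ∧ KRel B (Fw D n) P Q R P' Q' R' := by
  induction n generalizing P Q R P' Q' R' with
  | zero =>
    simp only [Tr] at a1 a2 a3 b1 b2 b3
    subst a1 a2 a3 b1 b2 b3
    exact ⟨fun r hr => by omega, hK⟩
  | succ n ih =>
    obtain ⟨M1, a1, s1⟩ := a1
    obtain ⟨M2, a2, s2⟩ := a2
    obtain ⟨M3, a3, s3⟩ := a3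
    obtain ⟨N1, b1, t1⟩ := b1
    obtain ⟨N2, b2, t2⟩ := b2
    obtain ⟨N3, b3, t3⟩ := b3
    obtain ⟨k1, k2⟩ := ih (fun r hr => hL r (by omega)) a1 a2 a3 b1 b2 b3
    have i1 := a1.inv hX
    have i2 := a2.inv hY
    have i3 := a3.inv hZ
    have := loB B n
    obtain ⟨e1, e2, e3⟩ := knuth_row (loB B n) (lohi B n) (hL n (by omega)) k2 s1 s2 s3 t1 t2 t3
      (by rintro ⟨j1, j2, j3, j4, j5⟩
          refine hn1 n ⟨?_, ?_, ?_, ?_, ?_⟩ <;> omega)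
      (by rintro ⟨j1, j2, j3, j4, j5⟩
          refine hn2 n ⟨?_, ?_, ?_, ?_, ?_⟩ <;> omega)
    refine ⟨fun r hr => ?_, e3⟩
    rcases Nat.lt_succ_iff_lt_or_eq.1 hr with h | h
    · exact k1 r h
    · subst h; exact e2

lemma Tr.small {B D D' n P Q} (hP : B ≤ P) (h : Tr B D D' n P Q) (hQ : Q < B) : P < (n + 1) * B := by
  induction n generalizing Q with
  | zero => simp only [Tr] at h; omega
  | succ n ih =>
    obtain ⟨M, h1, h2⟩ := h
    have := loB B n
    have := lohi B n
    have e : (n + 1 + 1) * B = (n + 2) * B := by ring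
    rcases h1.inv hP with h | ⟨rfl, h⟩
    · have := ih h1 h; omega
    · rcases h2 with h2 | h2 | h2 | h2
      · have := h2.1; have := h2.2.2.2; omega
      · have := h2.2.1; omega
      · have := h2.1; omega
      · have := h2.1; omega

lemma Tr.card {B D D' n x Q} (hx : 1 ≤ x) (hB : 0 < B) (h : Tr B D D' n (x * B) Q) :
    ∀ r < n, (D' r).card = (D r).card + if r + 1 = x then 1 else 0 := by
  induction n generalizing Q with
  | zero => intro r hr; omega
  | succ n ih =>
    obtain ⟨M, h1, h2⟩ := h
    intro r hr
    rcases Nat.lt_succ_iff_lt_or_eq.1 hr with h | h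
    · exact ih h1 r h
    subst h
    have := loB B r
    have := lohi B r
    have hP : B ≤ x * B := by nlinarith
    have hno : M < B → ¬ (r + 1 = x) := by
      rintro h rfl
      have := h1.small hP h
      omega
    rcases h2 with h2 | h2 | h2 | h2
    · rw [if_neg, h2.2.2.1]; · rfl
      rintro rfl
      have h3 := h2.1
      rcases h1.inv hP with h | ⟨rfl, h⟩
      · omega
      · nlinarith
    · obtain ⟨i1, i2, i3, i4, i5, i6, i7, i8, i9⟩ := h2
      rcases h1.inv hP with h | ⟨rfl, h⟩
      · omega
      · have k1 := Nat.lt_of_mul_lt_mul_right i2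
        have k3 := Nat.le_of_mul_le_mul_right i1 hB
        rw [if_pos (by omega), i9, Finset.card_insert_of_notMem i5]
    · obtain ⟨i1, i2, z, i3, i4, i5, i6⟩ := h2
      rw [if_neg (hno i1), i5]; rfl
    · obtain ⟨i1, i2, i3, i4, i5, i6, i7, i8, i9⟩ := h2
      rw [if_neg (hno i1), i9, Finset.card_insert_of_notMem, Finset.card_erase_of_mem i4]
      · have := Finset.card_pos.2 ⟨_, i4⟩
        omega
      · simp only [Finset.mem_erase, not_and]
        intro _; exact i6 Q le_rfl i5

def GD (n : ℕ) (D : ℕ → Finset ℕ) : Prop := LegitG n D ∧ ∀ r, n ≤ r → D r = ∅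

def InsX (n B : ℕ) (D : ℕ → Finset ℕ) (x : ℕ) (D' : ℕ → Finset ℕ) (Q : ℕ) : Prop :=
  1 ≤ x ∧ x ≤ n ∧ Tr B D D' n (x * B) Q ∧ ∀ r, n ≤ r → D r = D' r

def VanG (n c : ℕ) (D : ℕ → Finset ℕ) : Prop := ∀ p, c ≤ p → Fw D n p = 0

section
variable {n B : ℕ}

lemma InsX.top {D x D' Q} (hB : 0 < B) (h : InsX n B D x D' Q) : Q < B :=
  Tr.top (i := 0) h.1 h.2.1 hB h.2.2.1

lemma InsX.le {D x D' Q} (h : InsX n B D x D' Q) : B ≤ x * B := by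
  have := h.1; nlinarith

lemma InsX.gd {D x D' Q} (h : InsX n B D x D' Q) (hD : GD n D) : GD n D' :=
  ⟨h.2.2.1.legit hD.1, fun r hr => by rw [← h.2.2.2 r hr, hD.2 r hr]⟩

lemma InsX.event {D x D' Q} (hB : 0 < B) (h : InsX n B D x D' Q) (hD : GD n D) :
    ∃ z, Ev (Fw D n) Q z (Fw D' n) :=
  h.2.2.1.event hD.1 (h.top hB) h.le

lemma InsX.van {D x D' Q c} (hB : 0 < B) (h : InsX n B D x D' Q) (hD : GD n D) (hc : VanG n c D) :
    VanG n (c + 1) D' :=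
  (h.2.2.1.bd (bdG_of_top hD.1 hc) (h.top hB) h.le hD.1).1 n le_rfl

lemma InsX.van_left {D x D' Q c} (hB : 0 < B) (h : InsX n B D x D' Q) (hD : GD n D) (hc : VanG n c D') :
    VanG n c D := by
  obtain ⟨z, e1, e2, e3, e4, e5, e6, e7⟩ := h.event hB hD
  intro p hp
  have h1 := hc p hp
  by_cases hz : p = z
  · subst hz; omega
  · by_cases hq : p = Q
    · exfalso
      have := hc z (by omega)
      omega
    · rw [← e7 p hq hz, h1]

lemma InsX.det {D x D' Q D'' Q'} (h : InsX n B D x D' Q) (h' : InsX n B D x D'' Q') : D' = D'' ∧ Q = Q' := by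
  obtain ⟨h1, h2⟩ := h.2.2.1.det h'.2.2.1
  refine ⟨?_, h1⟩
  funext r
  by_cases hr : r < n
  · exact h2 r hr
  · rw [← h.2.2.2 r (by omega), ← h'.2.2.2 r (by omega)]

lemma InsX.det_left {D1 x1 D2 x2 D' Q} (hB : 0 < B) (h1 : InsX n B D1 x1 D' Q) (h2 : InsX n B D2 x2 D' Q)
    (hD1 : GD n D1) (hD2 : GD n D2) (ho : Fw D1 n = Fw D2 n) : D1 = D2 ∧ x1 = x2 := by
  obtain ⟨k1, k2⟩ := Tr.det_left hB h1.1 h2.1 hD1.1 hD2.1 h1.2.2.1 h2.2.2.1 ho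
  refine ⟨?_, k1⟩
  funext r
  by_cases hr : r < n
  · exact k2 r hr
  · rw [h1.2.2.2 r (by omega), ← h2.2.2.2 r (by omega)]

lemma InsX.total {D x c} (hx : 1 ≤ x) (hxn : x ≤ n) (hD : GD n D) (hc : VanG n c D) (hcB : c < B) :
    ∃ D' Q, InsX n B D x D' Q := by
  obtain ⟨D', Q, h⟩ := Tr.total hx hD.1 (bdG_of_top hD.1 hc) hcB
  refine ⟨fun r => if r < n then D' r else D r, Q, hx, hxn, ?_, fun r hr => ?_⟩
  · exact h.congr (fun _ _ => rfl) (fun r hr => by simp [hr])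
  · simp [Nat.not_lt.2 hr]

lemma InsX.exists_left {D' g Q z} (hB : 0 < B) (hD : GD n D') (hv : VanG n B D') (hQ : Q < B) (hE : Ev g Q z (Fw D' n)) :
    ∃ D x, InsX n B D x D' Q ∧ GD n D ∧ Fw D n = g := by
  obtain ⟨D, x, k1, k2, k3, k4, k5⟩ := Tr.exists_left hB hD.1 (bdG_of_top hD.1 hv) (Or.inl ⟨hQ, z, hE⟩)
  have hc : ∀ r < n, D r = if r < n then D r else D' r := fun r hr => by simp [hr]
  refine ⟨fun r => if r < n then D r else D' r, x, ⟨k1, k5 hQ, ?_, ?_⟩, ⟨k3.congr hc, ?_⟩, ?_⟩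
  · exact k2.congr hc (fun _ _ => rfl)
  · intro r hr; simp [Nat.not_lt.2 hr]
  · intro r hr; simp [Nat.not_lt.2 hr, hD.2 r hr]
  · rw [← Fw_congr n hc, k4]

lemma InsX.shift {D x D' Q} (hB : 0 < B) (h : InsX n B D x D' Q) (j : ℕ) (hj : j < B) :
    Tr B D D' n (x * B + j) Q := by
  have := Tr.shift (i := 0) h.1 hB hj h.2.2.1
  rwa [if_pos (h.top hB)] at this

lemma mul_add_lt {a b B j : ℕ} (h : a < b) (hj : j < B) : a * B + j < b * B := by nlinarith

lemma NI_of_lt {r a b B j : ℕ} (h : a < b) : NI ((r + 1) * B) ((r + 2) * B) (b * B) (a * B + j) := by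
  rintro ⟨i1, i2, i3, i4, i5⟩
  have k1 := Nat.lt_of_mul_lt_mul_right i2
  nlinarith

lemma InsX.order {D x D1 X y D2 Y} (hB : 1 < B) (hD : GD n D) (h1 : InsX n B D x D1 X) (h2 : InsX n B D1 y D2 Y) :
    x ≤ y ↔ X < Y := by
  have a1 := h1.shift (by omega) 0 (by omega)
  constructor
  · intro h
    have a2 := h2.shift (by omega) 1 hB
    refine (Tr.order hD.1 (by have := h1.le; omega) (by have := h2.le; omega) a1 a2 ?_).1 (by nlinarith)
    rintro r ⟨_, _, _, _, h⟩
    nlinarith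
  · intro h
    by_contra hlt
    have a2 := h2.shift (by omega) 0 (by omega)
    have := (Tr.order hD.1 (by have := h1.le; omega) (by have := h2.le; omega) a1 a2 (fun r => NI_of_lt (by omega))).2 (by nlinarith)
    omega

/-- Runs of insertions of words, with the list of top positions. -/
def IW (n B : ℕ) : (ℕ → Finset ℕ) → List ℕ → (ℕ → Finset ℕ) → List ℕ → Prop
  | D, [], D', Qs => D' = D ∧ Qs = []
  | D, x :: v, D', Qs => ∃ D1 Q Qt, Qs = Q :: Qt ∧ InsX n B D x D1 Q ∧ IW n B D1 v D' Qt

lemma IW.length {D v E Qs} (h : IW n B D v E Qs) : Qs.length = v.length := by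
  induction v generalizing D Qs with
  | nil => rw [h.2]
  | cons x v ih =>
    obtain ⟨D1, Q, Qt, rfl, _, h⟩ := h
    simp [ih h]

lemma IW.append {D u t E Qs} : IW n B D (u ++ t) E Qs ↔ ∃ M Q1 Q2, Qs = Q1 ++ Q2 ∧ IW n B D u M Q1 ∧ IW n B M t E Q2 := by
  induction u generalizing D Qs with
  | nil => simp [IW]
  | cons x u ih =>
    simp only [List.cons_append, IW, ih]
    constructor
    · rintro ⟨D1, Q, Qt, rfl, h1, M, Q1, Q2, rfl, h2, h3⟩
      exact ⟨M, Q :: Q1, Q2, rfl, ⟨D1, Q, Q1, rfl, h1, h2⟩, h3⟩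
    · rintro ⟨M, Q1, Q2, rfl, ⟨D1, Q, Qt, rfl, h1, h2⟩, h3⟩
      exact ⟨D1, Q, Qt ++ Q2, rfl, h1, M, Qt, Q2, rfl, h2, h3⟩

lemma IW.gd {D v E Qs} (h : IW n B D v E Qs) (hD : GD n D) : GD n E := by
  induction v generalizing D Qs with
  | nil => rw [h.1]; exact hD
  | cons x v ih =>
    obtain ⟨D1, Q, Qt, rfl, h1, h⟩ := h
    exact ih h (h1.gd hD)

lemma IW.van {D v E Qs c} (hB : 0 < B) (h : IW n B D v E Qs) (hD : GD n D) (hc : VanG n c D) : VanG n (c + v.length) E := by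
  induction v generalizing D Qs c with
  | nil => rw [h.1]; exact hc
  | cons x v ih =>
    obtain ⟨D1, Q, Qt, rfl, h1, h⟩ := h
    have := ih h (h1.gd hD) (h1.van hB hD hc)
    rw [List.length_cons, add_comm v.length, ← add_assoc]
    exact this

lemma IW.det {D v E Qs E' Qs'} (h : IW n B D v E Qs) (h' : IW n B D v E' Qs') : E = E' ∧ Qs = Qs' := by
  induction v generalizing D Qs Qs' with
  | nil => rw [h.1, h.2, h'.1, h'.2]; exact ⟨rfl, rfl⟩
  | cons x v ih =>
    obtain ⟨D1, Q, Qt, rfl, h1, h⟩ := h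
    obtain ⟨D1', Q', Qt', rfl, h1', h'⟩ := h'
    obtain ⟨rfl, rfl⟩ := h1.det h1'
    obtain ⟨rfl, rfl⟩ := ih h h'
    exact ⟨rfl, rfl⟩

lemma IW.total {D v c} (hv : ∀ x ∈ v, 1 ≤ x ∧ x ≤ n) (hD : GD n D) (hc : VanG n c D) (hcB : c + v.length < B) :
    ∃ E Qs, IW n B D v E Qs := by
  induction v generalizing D c with
  | nil => exact ⟨D, [], rfl, rfl⟩
  | cons x v ih =>
    rw [List.length_cons] at hcB
    obtain ⟨D1, Q, h⟩ := InsX.total (B := B) (hv x (by simp)).1 (hv x (by simp)).2 hD hc (by omega)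
    obtain ⟨E, Qs, h'⟩ := ih (fun y hy => hv y (by simp [hy])) (h.gd hD) (h.van (by omega) hD hc) (by omega)
    exact ⟨E, Q :: Qs, D1, Q, Qs, rfl, h, h'⟩

lemma IW.mem {D v E Qs} (h : IW n B D v E Qs) : ∀ x ∈ v, 1 ≤ x ∧ x ≤ n := by
  induction v generalizing D Qs with
  | nil => simp
  | cons x v ih =>
    obtain ⟨D1, Q, Qt, rfl, h1, h⟩ := h
    intro y hy
    rcases List.mem_cons.1 hy with rfl | hy
    · exact ⟨h1.1, h1.2.1⟩
    · exact ih h y hy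

/-- The top word after a run is determined by the top word before and the positions. -/
lemma IW.top {D v E Qs D' v' E'} (hB : 0 < B) (h : IW n B D v E Qs) (h' : IW n B D' v' E' Qs) (hD : GD n D) (hD' : GD n D')
    (ho : Fw D n = Fw D' n) : Fw E n = Fw E' n := by
  induction v generalizing D D' v' Qs with
  | nil =>
    obtain ⟨rfl, rfl⟩ := h
    rcases v' with _ | ⟨x, v'⟩
    · rw [h'.1, ho]
    · obtain ⟨_, _, _, h, _⟩ := h'; simp at h
  | cons x v ih =>
    obtain ⟨D1, Q, Qt, rfl, h1, h⟩ := h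
    rcases v' with _ | ⟨x', v'⟩
    · have := h'.2; simp at this
    · obtain ⟨D1', Q', Qt', e, h1', h'⟩ := h'
      obtain ⟨rfl, rfl⟩ := List.cons.inj e
      obtain ⟨z, e1⟩ := h1.event hB hD
      obtain ⟨z', e2⟩ := h1'.event hB hD'
      rw [← ho] at e2
      exact ih h h' (h1.gd hD) (h1'.gd hD') (e1.f_unique e2)

lemma IW.det_left {D v E Qs D' v'} (hB : 0 < B) (h : IW n B D v E Qs) (h' : IW n B D' v' E Qs) (hD : GD n D) (hD' : GD n D')
    (ho : Fw D n = Fw D' n) : D = D' ∧ v = v' := by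
  induction v generalizing D D' v' Qs with
  | nil =>
    obtain ⟨rfl, rfl⟩ := h
    rcases v' with _ | ⟨x, v'⟩
    · rw [h'.1]; exact ⟨rfl, rfl⟩
    · obtain ⟨_, _, _, h, _⟩ := h'; simp at h
  | cons x v ih =>
    obtain ⟨D1, Q, Qt, rfl, h1, h⟩ := h
    rcases v' with _ | ⟨x', v'⟩
    · have := h'.2; simp at this
    · obtain ⟨D1', Q', Qt', e, h1', h'⟩ := h'
      obtain ⟨rfl, rfl⟩ := List.cons.inj e
      obtain ⟨z, e1⟩ := h1.event hB hD
      obtain ⟨z', e2⟩ := h1'.event hB hD'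
      rw [← ho] at e2
      obtain ⟨rfl, rfl⟩ := ih h h' (h1.gd hD) (h1'.gd hD') (e1.f_unique e2)
      obtain ⟨rfl, rfl⟩ := h1.det_left hB h1' hD hD' ho
      exact ⟨rfl, rfl⟩

/-- Transport of a run to another diagram with the same final top word. -/
lemma IW.exists_left {D v E Qs E'} (hB : 0 < B) (h : IW n B D v E Qs) (hD : GD n D) (hE' : GD n E')
    (ho : Fw E n = Fw E' n) (hv : VanG n B E) :
    ∃ D' v', IW n B D' v' E' Qs ∧ GD n D' ∧ Fw D n = Fw D' n := by
  induction v generalizing D Qs with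
  | nil =>
    obtain ⟨rfl, rfl⟩ := h
    exact ⟨E', [], ⟨rfl, rfl⟩, hE', ho⟩
  | cons x v ih =>
    obtain ⟨D1, Q, Qt, rfl, h1, h⟩ := h
    obtain ⟨D1', v', k1, k2, k3⟩ := ih h (h1.gd hD)
    obtain ⟨z, e1⟩ := h1.event hB hD
    rw [k3] at e1
    have hv1 : VanG n B D1' := by
      have : ∀ (v) (D Qt), IW n B D v E' Qt → GD n D → VanG n B D := by
        intro v
        induction v with
        | nil => intro D Qt h _; rw [← h.1]; intro p hp; rw [← ho]; exact hv p hp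
        | cons x v ih =>
          intro D Qt h hD
          obtain ⟨D1, Q, Qt, rfl, h1, h⟩ := h
          exact h1.van_left hB hD (ih _ _ h (h1.gd hD))
      exact this _ _ _ k1 k2
    obtain ⟨D', x', m1, m2, m3⟩ := InsX.exists_left hB k2 hv1 (h1.top hB) e1
    exact ⟨D', x' :: v', ⟨D1', Q, Qt, rfl, m1, k1⟩, m2, m3.symm⟩

def Kf (a b c : ℕ) : List ℕ := if c < a then [a, c, b] else [b, a, c]

lemma IW.three {D a b c E Qs} : IW n B D [a, b, c] E Qs ↔ ∃ D1 D2 P Q R, Qs = [P, Q, R] ∧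
    InsX n B D a D1 P ∧ InsX n B D1 b D2 Q ∧ InsX n B D2 c E R := by
  simp only [IW]
  constructor
  · rintro ⟨D1, P, _, rfl, h1, D2, Q, _, rfl, h2, D3, R, _, rfl, h3, rfl, rfl⟩
    exact ⟨D1, D2, P, Q, R, rfl, h1, h2, h3⟩
  · rintro ⟨D1, D2, P, Q, R, rfl, h1, h2, h3⟩
    exact ⟨D1, P, _, rfl, h1, D2, Q, _, rfl, h2, E, R, _, rfl, h3, rfl, rfl⟩

lemma IW.kstep {D a b c E Qs m} (hD : GD n D) (hm : VanG n m D) (hmB : m + 3 < B)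
    (h : IW n B D [a, b, c] E Qs) (hab : a ≤ b) (hbc : c < b) :
    ∃ P1 P2 P3 Q1 Q2 Q3, Qs = [Q1, Q2, Q3] ∧ IW n B D (Kf a b c) E [P1, P2, P3] ∧
      KRel B (Fw D n) P1 P2 P3 Q1 Q2 Q3 ∧ ∃ z g, Ev (Fw D n) P1 z g := by
  have hB : 0 < B := by omega
  have hmem := h.mem
  have ha := hmem a (by simp)
  have hb := hmem b (by simp)
  have hc := hmem c (by simp)
  obtain ⟨D1, D2, P, Q, R, rfl, h1, h2, h3⟩ := IW.three.1 h
  have hgd := h3.gd (h2.gd (h1.gd hD))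
  unfold Kf
  have hfin : ∀ {E' : ℕ → Finset ℕ}, E' = E ∨ ((∀ r < n, E' r = E r) ∧ GD n E') → E' = E := by
    rintro E' (h | ⟨h, h'⟩)
    · exact h
    · funext r
      by_cases hr : r < n
      · exact h r hr
      · rw [h'.2 r (by omega), hgd.2 r (by omega)]
  split_ifs with hca
  · obtain ⟨E', Qs, hk⟩ := IW.total (v := [a, c, b]) (by simp; tauto) hD hm (by simpa using hmB)
    obtain ⟨D1', D2', P', Q', R', rfl, k1, k2, k3⟩ := IW.three.1 hk
    have s1 := k1.shift hB 0 hB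
    have s2 := k2.shift hB 0 hB
    have s3 := k3.shift hB 1 (by omega)
    have t1 := h1.shift hB 0 hB
    have t2 := h2.shift hB 1 (by omega)
    have t3 := h3.shift hB 0 hB
    obtain ⟨e1, e2⟩ := Tr.knuth hD.1 (by have := k1.le; omega) (by have := k2.le; omega) (by have := k3.le; omega)
      (Or.inl ⟨by nlinarith, by nlinarith, rfl, rfl, rfl⟩) s1 s2 s3 t1 t2 t3 (fun r => NI_of_lt hca)
      (by rintro r ⟨_, _, _, _, h⟩; nlinarith)
    obtain rfl : E' = E := hfin (Or.inr ⟨e1, hk.gd hD⟩)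
    obtain ⟨z, e⟩ := k1.event hB hD
    exact ⟨P', Q', R', P, Q, R, rfl, hk, e2, z, _, e⟩
  · obtain ⟨E', Qs, hk⟩ := IW.total (v := [b, a, c]) (by simp; tauto) hD hm (by simpa using hmB)
    obtain ⟨D1', D2', P', Q', R', rfl, k1, k2, k3⟩ := IW.three.1 hk
    have s1 := k1.shift hB 0 hB
    have s2 := k2.shift hB 0 hB
    have s3 := k3.shift hB 1 (by omega)
    have t1 := h1.shift hB 0 hB
    have t2 := h2.shift hB 0 hB
    have t3 := h3.shift hB 1 (by omega)
    obtain ⟨e1, e2⟩ := Tr.knuth hD.1 (by have := k1.le; omega) (by have := k2.le; omega) (by have := k3.le; omega)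
      (Or.inr (Or.inl ⟨by nlinarith, by nlinarith, rfl, rfl, rfl⟩)) s1 s2 s3 t1 t2 t3 (fun r => NI_of_lt (by omega))
      (fun r => NI_of_lt hbc)
    obtain rfl : E' = E := hfin (Or.inr ⟨e1, hk.gd hD⟩)
    obtain ⟨z, e⟩ := k1.event hB hD
    exact ⟨P', Q', R', P, Q, R, rfl, hk, e2, z, _, e⟩

lemma KRel.unique {f P Q R P' Q' R' X Y Z} (h : KRel B f P Q R X Y Z) (h' : KRel B f P' Q' R' X Y Z)
    (he : ∃ z g, Ev f P z g) (he' : ∃ z g, Ev f P' z g) : P = P' ∧ Q = Q' ∧ R = R' := by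
  obtain ⟨z, g, he⟩ := he
  obtain ⟨z', g', he'⟩ := he'
  have h1 := he.2.1
  have h2 := he'.2.1
  rcases h with ⟨i1, i2, i3, i4, i5⟩ | ⟨i1, i2, i3, i4, i5⟩ | ⟨i1, i2, i3, i4, i5, i6, g1, i7⟩ <;>
  rcases h' with ⟨j1, j2, j3, j4, j5⟩ | ⟨j1, j2, j3, j4, j5⟩ | ⟨j1, j2, j3, j4, j5, j6, g2, j7⟩
  · omega
  · omega
  · omega
  · omega
  · omega
  · exfalso; have := j7.2.2.1; rw [i4] at this; omega
  · omega
  · exfalso; have := i7.2.2.1; rw [j4] at this; omega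
  · omega

/-- Words with the same sequence of top positions. -/
def Sim (n B : ℕ) (v v' : List ℕ) : Prop :=
  ∃ c D D' E E' Qs, GD n D ∧ GD n D' ∧ Fw D n = Fw D' n ∧ VanG n c D ∧ c + v.length + 1 < B ∧
    IW n B D v E Qs ∧ IW n B D' v' E' Qs

lemma Sim.symm {v v'} (h : Sim n B v v') : Sim n B v' v := by
  obtain ⟨c, D, D', E, E', Qs, h1, h2, h3, h4, h5, h6, h7⟩ := h
  refine ⟨c, D', D, E', E, Qs, h2, h1, h3.symm, ?_, ?_, h7, h6⟩
  · intro p hp; rw [← h3]; exact h4 p hp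
  · rw [← h7.length, h6.length]; exact h5

lemma Sim.asc {u a b t u' a' b' t'} (h : Sim n B (u ++ a :: b :: t) (u' ++ a' :: b' :: t')) (hl : u.length = u'.length) :
    a ≤ b ↔ a' ≤ b' := by
  obtain ⟨c, D, D', E, E', Qs, h1, h2, h3, h4, h5, h6, h7⟩ := h
  have hB : 1 < B := by omega
  obtain ⟨M, Q1, Q2, rfl, k1, k2⟩ := IW.append.1 h6
  obtain ⟨M', Q1', Q2', e, k1', k2'⟩ := IW.append.1 h7
  obtain ⟨rfl, rfl⟩ := List.append_inj e (by rw [k1.length, k1'.length, hl])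
  obtain ⟨M1, X, _, rfl, m1, M2, Y, Qt, rfl, m2, m3⟩ := k2
  obtain ⟨M1', X', _, e1, m1', M2', Y', Qt', rfl, m2', m3'⟩ := k2'
  simp only [List.cons.injEq] at e1
  obtain ⟨rfl, rfl, rfl⟩ := e1
  rw [InsX.order hB (k1.gd h1) m1 m2, InsX.order hB (k1'.gd h2) m1' m2']

lemma Sim.knuth {u a b c t u' a' b' c' t'} (h : Sim n B (u ++ (a :: b :: c :: t)) (u' ++ (a' :: b' :: c' :: t')))
    (hl : u.length = u'.length) (h1 : a ≤ b) (h2 : c < b) (h1' : a' ≤ b') (h2' : c' < b') :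
    Sim n B (u ++ (Kf a b c ++ t)) (u' ++ (Kf a' b' c' ++ t')) := by
  obtain ⟨m, D, D', E, E', Qs, i1, i2, i3, i4, i5, i6, i7⟩ := h
  have hB : 0 < B := by omega
  obtain ⟨M, Q1, Q2, rfl, k1, k2⟩ := IW.append.1 i6
  obtain ⟨M', Q1', Q2', e, k1', k2'⟩ := IW.append.1 i7
  obtain ⟨rfl, rfl⟩ := List.append_inj e (by rw [k1.length, k1'.length, hl])
  rw [show a :: b :: c :: t = [a, b, c] ++ t from rfl] at k2
  rw [show a' :: b' :: c' :: t' = [a', b', c'] ++ t' from rfl] at k2'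
  obtain ⟨N, Q3, Q4, rfl, l1, l2⟩ := IW.append.1 k2
  obtain ⟨N', Q3', Q4', e, l1', l2'⟩ := IW.append.1 k2'
  obtain ⟨rfl, rfl⟩ := List.append_inj e (by rw [l1.length, l1'.length]; rfl)
  have htop := k1.top hB k1' i1 i2 i3
  have hvan := k1.van hB i1 i4
  have hvan' : VanG n (m + u.length) M' := by intro p hp; rw [← htop]; exact hvan p hp
  simp only [List.length_append, List.length_cons] at i5
  obtain ⟨P1, P2, P3, R1, R2, R3, rfl, p1, p2, p3⟩ := l1.kstep (k1.gd i1) hvan (by omega) h1 h2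
  obtain ⟨P1', P2', P3', R1', R2', R3', e, p1', p2', p3'⟩ := l1'.kstep (k1'.gd i2) hvan' (by omega) h1' h2'
  simp only [List.cons.injEq, and_true] at e
  obtain ⟨rfl, rfl, rfl⟩ := e
  rw [← htop] at p2' p3'
  obtain ⟨rfl, rfl, rfl⟩ := p2.unique p2' p3 p3'
  refine ⟨m, D, D', E, E', Q1 ++ ([P1, P2, P3] ++ Q4), i1, i2, i3, i4, ?_, ?_, ?_⟩
  · have : (Kf a b c).length = 3 := by unfold Kf; split_ifs <;> rfl
    simp only [List.length_append, this]; omega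
  · exact IW.append.2 ⟨M, Q1, _, rfl, k1, IW.append.2 ⟨N, _, Q4, rfl, p1, l2⟩⟩
  · exact IW.append.2 ⟨M', Q1, _, rfl, k1', IW.append.2 ⟨N', _, Q4, rfl, p1', l2'⟩⟩

end

section
variable {n B : ℕ}

lemma Sim.length {v v'} (h : Sim n B v v') : v.length = v'.length := by
  obtain ⟨c, D, D', E, E', Qs, h1, h2, h3, h4, h5, h6, h7⟩ := h
  rw [← h6.length, h7.length]

/-- Weakly increasing blocks correspond. -/
lemma Sim.sorted {A : List ℕ} : ∀ {u t u' A' t' : List ℕ}, Sim n B (u ++ (A ++ t)) (u' ++ (A' ++ t')) →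
    u.length = u'.length → A.length = A'.length → A.IsChain (· ≤ ·) → A'.IsChain (· ≤ ·) := by
  induction A with
  | nil =>
    intro u t u' A' t' h hu hA _
    rcases A' with _ | ⟨a, A'⟩
    · exact List.isChain_nil
    · simp at hA
  | cons a A ih =>
    intro u t u' A' t' h hu hA hs
    rcases A' with _ | ⟨a', A'⟩
    · simp at hA
    rcases A with _ | ⟨b, A⟩
    · rcases A' with _ | ⟨b', A'⟩
      · exact List.isChain_singleton _
      · simp at hA
    rcases A' with _ | ⟨b', A'⟩
    · simp at hA
    rw [List.isChain_cons_cons] at hs ⊢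
    refine ⟨(Sim.asc (t := A ++ t) (t' := A' ++ t') h hu).1 hs.1, ?_⟩
    refine ih (u := u ++ [a]) (u' := u' ++ [a']) (t := t) (t' := t') ?_ (by simp [hu]) (by simpa using hA) hs.2
    simpa using h

lemma Sim.slide {x x' : ℕ} {A : List ℕ} : ∀ {u t u' A' t' : List ℕ} {a a' : ℕ},
    Sim n B (u ++ (a :: A ++ x :: t)) (u' ++ (a' :: A' ++ x' :: t')) →
    u.length = u'.length → A.length = A'.length → (a :: A).IsChain (· ≤ ·) → (∀ y ∈ a :: A, x < y) →
    ∃ p q C, Sim n B (u ++ (a :: x :: A ++ t)) (u' ++ (p :: q :: C ++ t')) ∧ C.length = A.length ∧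
      ((p = a' ∧ q = x' ∧ C = A') ∨ x' ∈ C) := by
  induction A with
  | nil =>
    intro u t u' A' t' a a' h hu hA _ _
    obtain rfl : A' = [] := by simpa [eq_comm] using hA
    exact ⟨a', x', [], h, rfl, Or.inl ⟨rfl, rfl, rfl⟩⟩
  | cons b A ih =>
    intro u t u' A' t' a a' h hu hA hs hx
    rcases A' with _ | ⟨b', A'⟩
    · simp at hA
    rw [List.isChain_cons_cons] at hs
    obtain ⟨p, q, C, k1, k2, k3⟩ := ih (u := u ++ [a]) (u' := u' ++ [a']) (t := t) (t' := t') (a := b) (a' := b') (A' := A')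
      (by simpa using h) (by simp [hu]) (by simpa using hA) hs.2 (fun y hy => hx y (by simp at hy ⊢; tauto))
    have h0 : Sim n B (u ++ (a :: b :: x :: (A ++ t))) (u' ++ (a' :: p :: q :: (C ++ t'))) := by simpa using k1
    have i1 : a' ≤ p := (Sim.asc h0 hu).1 hs.1
    have i2 : q < p := by
      have h1 : Sim n B (u ++ [a] ++ (b :: x :: (A ++ t))) (u' ++ [a'] ++ (p :: q :: (C ++ t'))) := by simpa using h0
      have := Sim.asc h1 (by simp [hu])
      have := hx b (by simp)
      omega
    have hxa := hx a (by simp)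
    have h2 := Sim.knuth h0 hu hs.1 (hx b (by simp)) i1 i2
    unfold Kf at h2
    rw [if_pos hxa] at h2
    split_ifs at h2 with hq
    · refine ⟨a', q, p :: C, by simpa using h2, by simp [k2], ?_⟩
      rcases k3 with ⟨rfl, rfl, rfl⟩ | k3
      · exact Or.inl ⟨rfl, rfl, rfl⟩
      · right; simp [k3]
    · refine ⟨p, a', q :: C, by simpa using h2, by simp [k2], ?_⟩
      rcases k3 with ⟨rfl, rfl, rfl⟩ | k3
      · right; simp
      · right; simp [k3]

/-- Column strictness between a lower row `A` and an upper row `B`. -/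
def colS : List ℕ → List ℕ → Prop
  | [], _ => True
  | _ :: _, [] => False
  | a :: A, b :: B => b < a ∧ colS A B

lemma colS.mem {A : List ℕ} : ∀ {C : List ℕ} {x}, colS A C → x ∈ A → ∃ b ∈ C, b < x := by
  induction A with
  | nil => intro C x _ h; simp at h
  | cons a A ih =>
    intro C x h hx
    rcases C with _ | ⟨b, C⟩
    · exact h.elim
    · rcases List.mem_cons.1 hx with rfl | hx
      · exact ⟨b, by simp, h.1⟩
      · obtain ⟨c, h1, h2⟩ := ih h.2 hx
        exact ⟨c, by simp [h1], h2⟩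

lemma chain_le {a : ℕ} {A : List ℕ} (h : (a :: A).IsChain (· ≤ ·)) : ∀ y ∈ A, a ≤ y := by
  have := List.isChain_iff_pairwise.1 h
  exact (List.pairwise_cons.1 this).1

lemma chain_tail {a : ℕ} {A : List ℕ} (h : (a :: A).IsChain (· ≤ ·)) : A.IsChain (· ≤ ·) := by
  exact h.tail

lemma Sim.col {A : List ℕ} : ∀ {u C t u' A' C' t' : List ℕ},
    Sim n B (u ++ (A ++ (C ++ t))) (u' ++ (A' ++ (C' ++ t'))) →
    u.length = u'.length → A.length = A'.length → C.length = C'.length → A.IsChain (· ≤ ·) → C.IsChain (· ≤ ·) →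
    C'.IsChain (· ≤ ·) → colS A C → colS A' C' := by
  induction A with
  | nil =>
    intro u C t u' A' C' t' h hu hA hC _ _ _ _
    obtain rfl : A' = [] := by simpa [eq_comm] using hA
    trivial
  | cons a A ih =>
    intro u C t u' A' C' t' h hu hA hC hAs hCs hCs' hcol
    rcases A' with _ | ⟨a', A'⟩
    · simp at hA
    rcases C with _ | ⟨x, C⟩
    · exact hcol.elim
    rcases C' with _ | ⟨x', C'⟩
    · simp at hC
    have hx : ∀ y ∈ a :: A, x < y := by
      intro y hy
      rcases List.mem_cons.1 hy with rfl | hy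
      · exact hcol.1
      · exact lt_of_lt_of_le hcol.1 (chain_le hAs y hy)
    obtain ⟨p, q, E, k1, k2, k3⟩ := Sim.slide (u := u) (u' := u') (A := A) (A' := A') (x := x) (x' := x') (t := C ++ t) (t' := C' ++ t')
      (a := a) (a' := a') (by simpa using h) hu (by simpa using hA) hAs hx
    have hcolE : colS E C' := by
      refine ih (u := u ++ [a, x]) (C := C) (t := t) (u' := u' ++ [p, q]) (t' := t') (by simpa using k1) (by simp [hu]) k2.symm (by simpa using hC) (chain_tail hAs) (chain_tail hCs) (chain_tail hCs') hcol.2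
    rcases k3 with ⟨rfl, rfl, rfl⟩ | k3
    · refine ⟨?_, hcolE⟩
      have h1 : Sim n B (u ++ (a :: x :: (A ++ (C ++ t)))) (u' ++ (p :: q :: (E ++ (C' ++ t')))) := by simpa using k1
      have := Sim.asc h1 hu
      have := hcol.1
      omega
    · exfalso
      obtain ⟨b, h1, h2⟩ := hcolE.mem k3
      have := chain_le hCs' b h1
      omega

/-- A list of rows (bottom to top) forming a tableau. -/
def TabRows : List (List ℕ) → Prop
  | [] => True
  | [A] => A.IsChain (· ≤ ·)
  | A :: C :: L => A.IsChain (· ≤ ·) ∧ colS A C ∧ TabRows (C :: L)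

lemma TabRows.head {A L} (h : TabRows (A :: L)) : A.IsChain (· ≤ ·) := by
  rcases L with _ | ⟨C, L⟩
  · exact h
  · exact h.1

lemma Sim.tab {L : List (List ℕ)} : ∀ {u t u' t' : List ℕ} {L' : List (List ℕ)},
    Sim n B (u ++ (L.flatten ++ t)) (u' ++ (L'.flatten ++ t')) → u.length = u'.length →
    L.map List.length = L'.map List.length → TabRows L → TabRows L' := by
  induction L with
  | nil =>
    intro u t u' t' L' h hu hL _
    obtain rfl : L' = [] := by simpa [eq_comm] using hL
    trivial
  | cons A L ih =>
    intro u t u' t' L' h hu hL hT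
    rcases L' with _ | ⟨A', L'⟩
    · simp at hL
    simp only [List.map_cons, List.cons.injEq] at hL
    have hA' : A'.IsChain (· ≤ ·) :=
      Sim.sorted (u := u) (A := A) (t := L.flatten ++ t) (u' := u') (t' := L'.flatten ++ t') (by simpa using h) hu hL.1 hT.head
    rcases L with _ | ⟨C, L⟩
    · obtain rfl : L' = [] := by simpa [eq_comm] using hL.2
      exact hA'
    rcases L' with _ | ⟨C', L'⟩
    · simp at hL
    have hT' : TabRows (C' :: L') := by
      refine ih (u := u ++ A) (t := t) (u' := u' ++ A') (t' := t') (by simpa using h) (by simp [hu, hL.1]) hL.2 hT.2.2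
    refine ⟨hA', ?_, hT'⟩
    refine Sim.col (u := u) (A := A) (C := C) (t := L.flatten ++ t) (u' := u') (t' := L'.flatten ++ t') (by simpa using h) hu hL.1 ?_ hT.head hT.2.2.head hT'.head hT.2.1
    have := hL.2
    simp only [List.map_cons, List.cons.injEq] at this
    exact this.1

lemma exists_split (ls : List ℕ) : ∀ v : List ℕ, v.length = ls.sum → ∃ L : List (List ℕ), L.flatten = v ∧ L.map List.length = ls := by
  induction ls with
  | nil => intro v hv; exact ⟨[], by simpa [eq_comm] using hv, rfl⟩
  | cons l ls ih =>
    intro v hv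
    simp only [List.sum_cons] at hv
    obtain ⟨L, h1, h2⟩ := ih (v.drop l) (by simp; omega)
    exact ⟨v.take l :: L, by simp [h1], by simp [h2]; omega⟩

/-- `v` is the reading word of a tableau whose rows, bottom to top, have lengths `ls`. -/
def IsTab (ls : List ℕ) (v : List ℕ) : Prop := ∃ L : List (List ℕ), L.flatten = v ∧ L.map List.length = ls ∧ TabRows L

lemma Sim.isTab {v v' ls} (h : Sim n B v v') (hv : IsTab ls v) : IsTab ls v' := by
  obtain ⟨L, rfl, h2, h3⟩ := hv
  obtain ⟨L', rfl, h5⟩ := exists_split ls v' (by rw [← h.length, ← h2]; simp)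
  exact ⟨L', rfl, h5, Sim.tab (u := []) (t := []) (u' := []) (t' := []) (by simpa using h) rfl (by rw [h2, h5]) h3⟩

end

/-- The list of rows (bottom to top). -/
def rowsOf (μ : ℕ → ℕ) (g : ℕ → ℕ → ℕ) (m : ℕ) : List (List ℕ) :=
  ((List.range m).reverse.map (· + 1)).map fun j => (List.range (μ j)).map (g j)

lemma rowsOf_succ (μ g m) : rowsOf μ g (m + 1) = (List.range (μ (m + 1))).map (g (m + 1)) :: rowsOf μ g m := by
  simp [rowsOf, List.range_succ]

lemma readingWord_eq (n μ) (Y : SSYT n μ) : readingWord n μ Y = (rowsOf μ Y.entry n).flatten := by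
  simp only [readingWord, rowsOf, List.flatMap]

lemma colS_shift (f h : ℕ → ℕ) : ∀ a b, colS ((List.range a).map f) ((List.range b).map h) ↔ a ≤ b ∧ ∀ c < a, h c < f c := by
  intro a
  induction a generalizing f h with
  | zero => intro b; simp [colS]
  | succ a ih =>
    intro b
    rcases b with _ | b
    · simp [List.range_succ_eq_map, colS]
    · rw [List.range_succ_eq_map, List.range_succ_eq_map]
      simp only [List.map_cons, List.map_map, colS]
      rw [ih]
      constructor
      · rintro ⟨h1, h2, h3⟩
        refine ⟨by omega, fun c hc => ?_⟩
        rcases c with _ | c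
        · exact h1
        · exact h3 c (by omega)
      · rintro ⟨h1, h2⟩
        exact ⟨h2 0 (by omega), by omega, fun c hc => h2 (c + 1) (by omega)⟩

lemma chain_range (f : ℕ → ℕ) (a : ℕ) : ((List.range a).map f).IsChain (· ≤ ·) ↔ ∀ c₁ c₂, c₁ ≤ c₂ → c₂ < a → f c₁ ≤ f c₂ := by
  rw [List.isChain_iff_pairwise, List.pairwise_iff_getElem]
  simp only [List.length_map, List.length_range, List.getElem_map, List.getElem_range]
  constructor
  · intro h c₁ c₂ h1 h2
    rcases Nat.lt_or_eq_of_le h1 with h1 | rfl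
    · exact h c₁ c₂ (by omega) h2 h1
    · exact le_rfl
  · intro h i j _ h2 h3
    exact h i j h3.le h2

lemma tabRows_iff (μ g m) : TabRows (rowsOf μ g m) ↔ (∀ j, 1 ≤ j → j ≤ m → ∀ c₁ c₂, c₁ ≤ c₂ → c₂ < μ j → g j c₁ ≤ g j c₂) ∧
    ∀ j, 1 ≤ j → j < m → μ (j + 1) ≤ μ j ∧ ∀ c < μ (j + 1), g j c < g (j + 1) c := by
  induction m with
  | zero =>
    simp only [rowsOf, List.range_zero, List.reverse_nil, List.map_nil, TabRows, true_iff]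
    exact ⟨fun j h1 h2 => by omega, fun j h1 h2 => by omega⟩
  | succ m ih =>
    rw [rowsOf_succ]
    rcases m with _ | m
    · simp only [rowsOf, List.range_zero, List.reverse_nil, List.map_nil, TabRows]
      rw [chain_range]
      constructor
      · intro h
        refine ⟨fun j h1 h2 => ?_, fun j h1 h2 => by omega⟩
        obtain rfl : j = 1 := by omega
        exact h
      · intro h; exact h.1 1 le_rfl le_rfl
    · rw [rowsOf_succ] at ih ⊢
      simp only [TabRows]
      rw [ih, chain_range, colS_shift]
      constructor
      · rintro ⟨h1, h2, h3, h4⟩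
        refine ⟨fun j i1 i2 => ?_, fun j i1 i2 => ?_⟩
        · rcases Nat.lt_or_eq_of_le i2 with i2 | rfl
          · exact h3 j i1 (by omega)
          · exact h1
        · by_cases hj : j = m + 1
          · subst hj; exact h2
          · exact h4 j i1 (by omega)
      · rintro ⟨h1, h2⟩
        exact ⟨h1 _ (by omega) le_rfl, h2 _ (by omega) (by omega), fun j i1 i2 => h1 j i1 (by omega), fun j i1 i2 => h2 j i1 (by omega)⟩

def lensOf (μ : ℕ → ℕ) (m : ℕ) : List ℕ := ((List.range m).reverse.map (· + 1)).map μ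

lemma rowsOf_lens (μ g m) : (rowsOf μ g m).map List.length = lensOf μ m := by
  simp [rowsOf, lensOf, Function.comp_def]

lemma exists_rowsOf (μ m) : ∀ L : List (List ℕ), L.map List.length = lensOf μ m → ∃ g, L = rowsOf μ g m := by
  induction m with
  | zero =>
    intro L hL
    exact ⟨fun _ _ => 0, by simpa [lensOf, rowsOf] using hL⟩
  | succ m ih =>
    intro L hL
    rcases L with _ | ⟨A, L⟩
    · simp [lensOf, List.range_succ] at hL
    · simp only [lensOf, List.range_succ, List.map_cons, List.reverse_append, List.reverse_cons, List.reverse_nil,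
        List.nil_append, List.singleton_append, List.cons.injEq] at hL
      obtain ⟨g, rfl⟩ := ih L hL.2
      refine ⟨fun j c => if j = m + 1 then A.getD c 0 else g j c, ?_⟩
      rw [rowsOf_succ]
      congr 1
      · rw [← hL.1]
        apply List.ext_getElem
        · simp
        · intro i h1 h2
          simp [h1]
      · unfold rowsOf
        simp only [List.map_map]
        apply List.map_congr_left
        intro a ha
        simp only [List.mem_reverse, List.mem_range] at ha
        simp only [Function.comp]
        apply List.map_congr_left
        intro c _
        rw [if_neg (by omega)]

lemma rowsOf_inj (μ) {g g'} (m) (h : rowsOf μ g m = rowsOf μ g' m) : ∀ j, 1 ≤ j → j ≤ m → ∀ c < μ j, g j c = g' j c := by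
  induction m with
  | zero => intro j h1 h2; omega
  | succ m ih =>
    rw [rowsOf_succ, rowsOf_succ, List.cons.injEq] at h
    intro j h1 h2 c hc
    rcases Nat.lt_or_eq_of_le h2 with h2 | rfl
    · exact ih h.2 j h1 (by omega) c hc
    · have := (List.map_inj_left (l := List.range (μ (m + 1)))).1 h.1 c (by simpa using hc)
      exact this

lemma flatten_inj : ∀ {L L' : List (List ℕ)}, L.flatten = L'.flatten → L.map List.length = L'.map List.length → L = L' := by
  intro L
  induction L with
  | nil => intro L' _ h; simpa [eq_comm] using h
  | cons A L ih =>
    intro L' h1 h2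
    rcases L' with _ | ⟨A', L'⟩
    · simp at h2
    simp only [List.map_cons, List.cons.injEq, List.flatten_cons] at h1 h2
    obtain ⟨rfl, h3⟩ := List.append_inj h1 h2.1
    rw [ih h3 h2.2]

lemma mem_rowsOf {μ g m x} (h : x ∈ (rowsOf μ g m).flatten) : ∃ j c, 1 ≤ j ∧ j ≤ m ∧ c < μ j ∧ x = g j c := by
  simp only [rowsOf, List.mem_flatten, List.mem_map, List.mem_reverse, List.mem_range] at h
  obtain ⟨l, ⟨j, ⟨i, hi, rfl⟩, rfl⟩, hx⟩ := h
  simp only [List.mem_map, List.mem_range] at hx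
  obtain ⟨c, hc, rfl⟩ := hx
  exact ⟨i + 1, c, by omega, by omega, hc, rfl⟩

lemma mem_rowsOf' {μ g m j c} (h1 : 1 ≤ j) (h2 : j ≤ m) (h3 : c < μ j) : g j c ∈ (rowsOf μ g m).flatten := by
  simp only [rowsOf, List.mem_flatten, List.mem_map, List.mem_reverse, List.mem_range]
  refine ⟨_, ⟨j, ⟨j - 1, by omega, by omega⟩, rfl⟩, ?_⟩
  simp only [List.mem_map, List.mem_range]
  exact ⟨c, h3, rfl⟩

lemma readingWord_inj {n μ} : Function.Injective (readingWord n μ) := by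
  intro Y Y' h
  rw [readingWord_eq, readingWord_eq] at h
  have h1 := rowsOf_inj μ n (flatten_inj h (by rw [rowsOf_lens, rowsOf_lens]))
  obtain ⟨e, a1, a2, a3, a4⟩ := Y
  obtain ⟨e', b1, b2, b3, b4⟩ := Y'
  congr 1
  funext j c
  by_cases hj : 1 ≤ j ∧ j ≤ n ∧ c < μ j
  · exact h1 j hj.1 hj.2.1 c hj.2.2
  · rw [a4 j c (by omega), b4 j c (by omega)]

lemma readingWord_isTab {n μ} (hμ : IsPartition n μ) (Y : SSYT n μ) :
    IsTab (lensOf μ n) (readingWord n μ Y) ∧ ∀ x ∈ readingWord n μ Y, 1 ≤ x ∧ x ≤ n := by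
  rw [readingWord_eq]
  refine ⟨⟨_, rfl, rowsOf_lens _ _ _, ?_⟩, ?_⟩
  · rw [tabRows_iff]
    refine ⟨fun j h1 h2 c₁ c₂ h3 h4 => Y.row_weak j c₁ c₂ h1 h2 h3 h4, fun j h1 h2 => ⟨hμ.1 j h1 h2, fun c hc => ?_⟩⟩
    exact Y.col_strict j (j + 1) c h1 (by omega) (by omega) hc
  · intro x hx
    obtain ⟨j, c, h1, h2, h3, rfl⟩ := mem_rowsOf hx
    exact Y.entry_mem j c h1 h2 h3

lemma exists_SSYT {n μ v} (hv : IsTab (lensOf μ n) v) (hm : ∀ x ∈ v, 1 ≤ x ∧ x ≤ n) :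
    ∃ Y : SSYT n μ, readingWord n μ Y = v := by
  obtain ⟨L, rfl, h2, h3⟩ := hv
  obtain ⟨g, rfl⟩ := exists_rowsOf μ n L h2
  rw [tabRows_iff] at h3
  obtain ⟨h3, h4⟩ := h3
  have hin : ∀ j c, 1 ≤ j → j ≤ n → c < μ j → (if 1 ≤ j ∧ j ≤ n ∧ c < μ j then g j c else 0) = g j c := by
    intro j c i1 i2 i3; rw [if_pos ⟨i1, i2, i3⟩]
  have hcol : ∀ j₁ c d, 1 ≤ j₁ → j₁ + d + 1 ≤ n → c < μ (j₁ + d + 1) → g j₁ c < g (j₁ + d + 1) c ∧ c < μ j₁ := by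
    intro j c d
    induction d with
    | zero => intro i1 i2 i3; have := h4 j i1 (by omega); exact ⟨this.2 c i3, by simp at i3; omega⟩
    | succ d ih =>
      intro i1 i2 i3
      have h := h4 (j + d + 1) (by omega) (by omega)
      have := ih i1 (by omega) (lt_of_lt_of_le i3 h.1)
      exact ⟨this.1.trans (h.2 c i3), this.2⟩
  refine ⟨⟨fun j c => if 1 ≤ j ∧ j ≤ n ∧ c < μ j then g j c else 0, ?_, ?_, ?_, ?_⟩, ?_⟩
  · intro j c i1 i2 i3
    rw [hin j c i1 i2 i3]
    exact hm _ (mem_rowsOf' i1 i2 i3)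
  · intro j c₁ c₂ i1 i2 i3 i4
    rw [hin j c₁ i1 i2 (by omega), hin j c₂ i1 i2 i4]
    exact h3 j i1 i2 c₁ c₂ i3 i4
  · intro j₁ j₂ c i1 i2 i3 i4
    obtain ⟨d, rfl⟩ : ∃ d, j₂ = j₁ + d + 1 := ⟨j₂ - j₁ - 1, by omega⟩
    have := hcol j₁ c d i1 i3 i4
    rw [hin j₁ c i1 (by omega) this.2, hin _ c (by omega) i3 i4]
    exact this.1
  · intro j c hj
    rw [if_neg (by omega)]
  · rw [readingWord_eq]
    congr 1
    unfold rowsOf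
    apply List.map_congr_left
    intro j hj
    simp only [List.mem_map, List.mem_reverse, List.mem_range] at hj
    obtain ⟨i, hi, rfl⟩ := hj
    apply List.map_congr_left
    intro c hc
    simp only [List.mem_range] at hc
    exact hin _ _ (by omega) (by omega) hc

lemma readingWord_length {n μ} (Y : SSYT n μ) : (readingWord n μ Y).length = (lensOf μ n).sum := by
  rw [readingWord_eq, List.length_flatten, rowsOf_lens]

lemma finite_SSYT (n μ) (hμ : IsPartition n μ) : Finite (SSYT n μ) := by
  have hf : {v : List ℕ | v.length = (lensOf μ n).sum ∧ ∀ x ∈ v, x < n + 1}.Finite := by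
    refine ((List.finite_length_eq (Fin (n + 1)) ((lensOf μ n).sum)).image (List.map (fun i : Fin (n + 1) => (i : ℕ)))).subset ?_
    rintro v ⟨h1, h2⟩
    refine ⟨v.pmap (fun x hx => (⟨x, hx⟩ : Fin (n + 1))) h2, by simp [h1], ?_⟩
    simp [List.map_pmap]
  have : Finite {v : List ℕ | v.length = (lensOf μ n).sum ∧ ∀ x ∈ v, x < n + 1} := hf
  refine Finite.of_injective (β := {v : List ℕ | v.length = (lensOf μ n).sum ∧ ∀ x ∈ v, x < n + 1}) (fun Y => ⟨readingWord n μ Y, readingWord_length Y, fun x hx => ?_⟩) ?_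
  · have := (readingWord_isTab hμ Y).2 x hx; omega
  · intro Y Y' h
    exact readingWord_inj (Subtype.ext_iff.1 h)

lemma sT_l (j : ℤ) : sT j j = j + 1 := Equiv.swap_apply_left _ _
lemma sT_r (j : ℤ) : sT j (j + 1) = j := Equiv.swap_apply_right _ _
lemma sT_o {j x : ℤ} (h1 : x ≠ j) (h2 : x ≠ j + 1) : sT j x = x := Equiv.swap_apply_of_ne_of_ne h1 h2
lemma sT_sq (j : ℤ) : sT j * sT j = 1 := Equiv.swap_mul_self _ _
lemma sT_inv (j : ℤ) : (sT j)⁻¹ = sT j := Equiv.swap_inv _ _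
lemma sT_sT (j x : ℤ) : sT j (sT j x) = x := Equiv.swap_apply_self _ _ _

def ws (l : List ℤ) : Equiv.Perm ℤ := (l.map sT).prod

@[simp] lemma ws_nil : ws [] = 1 := rfl
@[simp] lemma ws_cons (j l) : ws (j :: l) = sT j * ws l := by simp [ws]
lemma ws_append (l l') : ws (l ++ l') = ws l * ws l' := by simp [ws]
lemma ws_reverse (l : List ℤ) : ws l.reverse = (ws l)⁻¹ := by
  induction l with
  | nil => simp
  | cons j l ih => rw [List.reverse_cons, ws_append, ih, ws_cons, ws_cons, ws_nil, mul_inv_rev, sT_inv, mul_one]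

lemma exch (l : List ℤ) (j : ℤ) (h : ws l (j + 1) < ws l j) : ∃ l', l'.length + 1 = l.length ∧ ws l' = ws l * sT j := by
  induction l with
  | nil => simp at h
  | cons i l ih =>
    by_cases h1 : ws l (j + 1) < ws l j
    · obtain ⟨l', e1, e2⟩ := ih h1
      exact ⟨i :: l', by simp [e1], by rw [ws_cons, ws_cons, e2, mul_assoc]⟩
    · have hne : ws l j ≠ ws l (j + 1) := fun e => by have := (ws l).injective e; omega
      refine ⟨l, by simp, ?_⟩
      rw [ws_cons, Equiv.Perm.mul_apply, Equiv.Perm.mul_apply] at h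
      have h2 : ws l j = i ∧ ws l (j + 1) = i + 1 := by
        simp only [sT, Equiv.swap_apply_def] at h
        split_ifs at h <;> omega
      have : ws l * sT j = sT i * ws l := by
        unfold sT
        rw [Equiv.mul_swap_eq_swap_mul, h2.1, h2.2]
      rw [ws_cons, mul_assoc, this, ← mul_assoc, sT_sq, one_mul]

lemma exch' (l : List ℤ) (j : ℤ) (h : (ws l)⁻¹ (j + 1) < (ws l)⁻¹ j) : ∃ l', l'.length + 1 = l.length ∧ ws l' = sT j * ws l := by
  rw [← ws_reverse] at h
  obtain ⟨l', h1, h2⟩ := exch _ _ h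
  refine ⟨l'.reverse, by simpa using h1, ?_⟩
  rw [ws_reverse, h2, ws_reverse, mul_inv_rev, sT_inv, inv_inv]

lemma len_le {w l} (h : ws l = w) : len w ≤ l.length := Nat.sInf_le ⟨l, rfl, h⟩
lemma len_ex (l) : ∃ l', l'.length = len (ws l) ∧ ws l' = ws l := by
  have : len (ws l) ∈ {m : ℕ | ∃ l' : List ℤ, l'.length = m ∧ (l'.map sT).prod = ws l} := Nat.sInf_mem ⟨_, l, rfl, rfl⟩
  exact this

def GoodW : List ℤ → Prop
  | [] => True
  | j :: l => GoodW l ∧ (ws l)⁻¹ j < (ws l)⁻¹ (j + 1)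

lemma reduced_iff (l : List ℤ) : len (ws l) = l.length ↔ GoodW l := by
  induction l with
  | nil => simp only [GoodW, iff_true]; have := len_le (l := []) rfl; simpa using this
  | cons j l ih =>
    have hne : (ws l)⁻¹ j ≠ (ws l)⁻¹ (j + 1) := fun e => by have := (ws l)⁻¹.injective e; omega
    constructor
    · intro h
      constructor
      · rw [← ih]
        obtain ⟨l', h1, h2⟩ := len_ex l
        have h3 := len_le (l := l) rfl
        have h4 := len_le (l := j :: l') (w := ws (j :: l)) (by rw [ws_cons, h2, ws_cons])
        simp only [List.length_cons] at h h4
        omega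
      · by_contra hlt
        obtain ⟨l', h1, h2⟩ := exch' l j (by omega)
        have := len_le (l := l') (w := ws (j :: l)) (by rw [h2, ws_cons])
        simp only [List.length_cons] at h
        omega
    · rintro ⟨h1, h2⟩
      rw [← ih] at h1
      obtain ⟨l', k1, k2⟩ := len_ex (j :: l)
      have h3 := len_le (l := j :: l) rfl
      obtain ⟨l'', m1, m2⟩ := exch' l' j (by
        rw [k2, ws_cons, mul_inv_rev, sT_inv, Equiv.Perm.mul_apply, Equiv.Perm.mul_apply, sT_l, sT_r]
        exact h2)
      have := len_le (l := l'') (w := ws l) (by rw [m2, k2, ws_cons, ← mul_assoc, sT_sq, one_mul])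
      simp only [List.length_cons] at h3 ⊢
      omega

lemma GoodW.of_append {l l'} (h : GoodW (l ++ l')) : GoodW l' := by
  induction l with
  | nil => exact h
  | cons j l ih => exact ih h.1

/-- Inversions persist. -/
lemma GoodW.persist {l l'} (h : GoodW (l ++ l')) {a b : ℤ} (hab : a < b) (h1 : ws l' b < ws l' a) : ws (l ++ l') b < ws (l ++ l') a := by
  induction l with
  | nil => exact h1
  | cons j l ih =>
    have h2 := ih h.1
    rw [List.cons_append, ws_cons, Equiv.Perm.mul_apply, Equiv.Perm.mul_apply]
    have h3 : (ws (l ++ l'))⁻¹ j < (ws (l ++ l'))⁻¹ (j + 1) := h.2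
    set w := ws (l ++ l')
    by_cases hc : w b = j ∧ w a = j + 1
    · have e1 : w⁻¹ j = b := by rw [← hc.1]; simp
      have e2 : w⁻¹ (j + 1) = a := by rw [← hc.2]; simp
      omega
    · simp only [sT, Equiv.swap_apply_def]
      split_ifs <;> omega

/-- A crossing inverts its two strands. -/
lemma GoodW.inverted {l j l'} (h : GoodW (l ++ j :: l')) :
    ws (l ++ j :: l') ((ws l')⁻¹ (j + 1)) < ws (l ++ j :: l') ((ws l')⁻¹ j) := by
  refine h.persist h.of_append.2 ?_
  rw [ws_cons, Equiv.Perm.mul_apply, Equiv.Perm.mul_apply]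
  simp [sT_l, sT_r]

/-- order of a pair of strands is preserved if they never cross -/
lemma ws_mono {P : ℤ → Prop} {l : List ℤ} (h : ∀ l1 j l2, l = l1 ++ j :: l2 → ¬ (P ((ws l2)⁻¹ j) ∧ P ((ws l2)⁻¹ (j + 1))))
    {a b : ℤ} (hab : a < b) (ha : P a) (hb : P b) : ws l a < ws l b := by
  induction l with
  | nil => exact hab
  | cons j l ih =>
    have h2 := ih (fun l1 i l2 e => h (j :: l1) i l2 (by rw [e]; rfl))
    have h3 := h [] j l rfl
    rw [ws_cons, Equiv.Perm.mul_apply, Equiv.Perm.mul_apply]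
    set w := ws l
    by_cases hc : w a = j ∧ w b = j + 1
    · have e1 : w⁻¹ j = a := by rw [← hc.1]; simp
      have e2 : w⁻¹ (j + 1) = b := by rw [← hc.2]; simp
      rw [e1, e2] at h3
      exact absurd ⟨ha, hb⟩ h3
    · simp only [sT, Equiv.swap_apply_def]
      split_ifs <;> omega

lemma ws_fix {l : List ℤ} {x : ℤ} (h : ∀ j ∈ l, x ≠ j ∧ x ≠ j + 1) : ws l x = x := by
  induction l with
  | nil => rfl
  | cons j l ih =>
    rw [ws_cons, Equiv.Perm.mul_apply, ih (fun i hi => h i (by simp [hi])), sT_o (h j (by simp)).1 (h j (by simp)).2]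

lemma ws_fix_inv {l : List ℤ} {x : ℤ} (h : ∀ j ∈ l, x ≠ j ∧ x ≠ j + 1) : (ws l)⁻¹ x = x := by
  rw [Equiv.Perm.inv_eq_iff_eq, ws_fix h]

/-! ### Reading lists -/

def lt (n : ℤ) (p : ℤ × ℤ) : ℤ := p.1 + p.2 - n - 1

lemma wR_eq (n R) : wR n R = ws ((R.sort rcOrder).map (lt n)) := by
  simp only [wR, ws, List.map_map]; rfl

lemma sort_unique {R : Finset (ℤ × ℤ)} {l : List (ℤ × ℤ)} (hs : l.Pairwise rcOrder) (hn : l.Nodup) (hm : ∀ x, x ∈ l ↔ x ∈ R) :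
    R.sort rcOrder = l := by
  refine List.Perm.eq_of_pairwise' (r := rcOrder) (Finset.pairwise_sort R rcOrder) hs ?_
  refine (List.perm_ext_iff_of_nodup (Finset.sort_nodup R rcOrder) hn).2 ?_
  intro x; rw [Finset.mem_sort, hm]

lemma rc_sorted (R : Finset (ℤ × ℤ)) : (R.sort rcOrder).Pairwise rcOrder := Finset.pairwise_sort R rcOrder

/-- flow-earlier crossings -/
def bef (R : Finset (ℤ × ℤ)) (i k : ℤ) : Finset (ℤ × ℤ) := R.filter fun t => t.2 < k ∨ (t.2 = k ∧ i < t.1)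

lemma rc_split {R : Finset (ℤ × ℤ)} {p} (hp : p ∈ R) : ∃ α, R.sort rcOrder = α ++ p :: (bef R p.1 p.2).sort rcOrder ∧
    (R.erase p).sort rcOrder = α ++ (bef R p.1 p.2).sort rcOrder := by
  obtain ⟨α, β, h⟩ := List.append_of_mem ((Finset.mem_sort rcOrder).2 hp)
  have hs := rc_sorted R
  have hn := Finset.sort_nodup R rcOrder
  have hm : ∀ x, x ∈ R ↔ x ∈ α ++ p :: β := by intro x; rw [← h, Finset.mem_sort]
  rw [h] at hs hn
  have hsub : (α ++ β).Sublist (α ++ p :: β) := (List.sublist_cons_self p β).append_left α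
  rw [List.pairwise_append, List.pairwise_cons] at hs
  rw [List.nodup_append, List.nodup_cons] at hn
  have hβ : (bef R p.1 p.2).sort rcOrder = β := by
    refine sort_unique hs.2.1.2 hn.2.1.2 ?_
    intro x
    rw [bef, Finset.mem_filter, hm]
    constructor
    · intro hx
      refine ⟨by simp [hx], ?_⟩
      have h1 := hs.2.1.1 x hx
      have h2 : x ≠ p := fun e => hn.2.1.1 (e ▸ hx)
      unfold rcOrder at h1
      have : ¬ (x.1 = p.1 ∧ x.2 = p.2) := fun e => h2 (Prod.ext e.1 e.2)
      omega
    · rintro ⟨h1, h2⟩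
      rcases List.mem_append.1 h1 with h1 | h1
      · have := hs.2.2 x h1 p (by simp)
        unfold rcOrder at this
        omega
      · rcases List.mem_cons.1 h1 with rfl | h1
        · omega
        · exact h1
  refine ⟨α, by rw [hβ, h], ?_⟩
  rw [hβ]
  refine sort_unique ?_ ?_ ?_
  · have := rc_sorted R
    rw [h] at this
    exact this.sublist hsub
  · have := Finset.sort_nodup R rcOrder
    rw [h] at this
    exact this.sublist hsub
  · intro x
    rw [Finset.mem_erase, hm]
    simp only [List.mem_append, List.mem_cons]
    constructor
    · intro hx
      refine ⟨fun e => ?_, by tauto⟩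
      rw [e] at hx
      rcases hx with hx | hx
      · exact hn.2.2 p hx p (by simp) rfl
      · exact hn.2.1.1 hx
    · tauto

lemma wR_union {A C : Finset (ℤ × ℤ)} (n) (h : ∀ a ∈ A, ∀ c ∈ C, rcOrder a c ∧ a ≠ c) : wR n (A ∪ C) = wR n A * wR n C := by
  rw [wR_eq, wR_eq, wR_eq, ← ws_append, ← List.map_append]
  congr 2
  refine sort_unique ?_ ?_ ?_
  · rw [List.pairwise_append]
    refine ⟨rc_sorted _, rc_sorted _, ?_⟩
    intro a ha c hc
    exact (h a (by simpa using ha) c (by simpa using hc)).1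
  · rw [List.nodup_append]
    refine ⟨Finset.sort_nodup _ _, Finset.sort_nodup _ _, ?_⟩
    intro a ha c hc
    exact (h a (by simpa using ha) c (by simpa using hc)).2
  · intro x; simp

lemma wR_single (n p) : wR n {p} = sT (lt n p) := by
  rw [wR_eq]; simp

lemma wR_fix_inv {n R x} (h : ∀ p ∈ R, x ≠ lt n p ∧ x ≠ lt n p + 1) : (wR n R)⁻¹ x = x := by
  rw [wR_eq]
  apply ws_fix_inv
  intro j hj
  simp only [List.mem_map, Finset.mem_sort] at hj
  obtain ⟨p, hp, rfl⟩ := hj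
  exact h p hp

lemma bef_succ (n : ℤ) (R : Finset (ℤ × ℤ)) (i k : ℤ) : wR n (bef R i k) =
    if (i + 1, k) ∈ R then sT (i + k - n) * wR n (bef R (i + 1) k) else wR n (bef R (i + 1) k) := by
  split_ifs with h
  · have : bef R i k = {(i + 1, k)} ∪ bef R (i + 1) k := by
      ext ⟨x, y⟩
      simp only [bef, Finset.mem_filter, Finset.mem_union, Finset.mem_singleton, Prod.mk.injEq]
      constructor
      · rintro ⟨h1, h2⟩
        by_cases hx : x = i + 1 ∧ y = k
        · exact Or.inl hx
        · exact Or.inr ⟨h1, by omega⟩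
      · rintro (⟨rfl, rfl⟩ | h1)
        · exact ⟨h, by omega⟩
        · exact ⟨h1.1, by omega⟩
    rw [this, wR_union, wR_single]
    · congr 2; simp only [lt]; ring
    · rintro a ha ⟨x, y⟩ hc
      rw [Finset.mem_singleton] at ha
      subst ha
      simp only [bef, Finset.mem_filter] at hc
      simp only [rcOrder, ne_eq, Prod.mk.injEq]
      omega
  · congr 1
    ext ⟨x, y⟩
    simp only [bef, Finset.mem_filter]
    constructor
    · rintro ⟨h1, h2⟩
      refine ⟨h1, ?_⟩
      by_contra hh
      have e1 : x = i + 1 := by omega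
      have e2 : y = k := by omega
      subst e1 e2
      exact h h1
    · rintro ⟨h1, h2⟩
      exact ⟨h1, by omega⟩

lemma bef_diag (n : ℤ) (R : Finset (ℤ × ℤ)) (i k : ℤ) : (wR n (bef R i k))⁻¹ (i + k - n - 1) = (wR n (bef R (i - 1) (k - 1)))⁻¹ (i + k - n - 1) := by
  have : bef R i k = (R.filter fun t => (t.2 = k ∧ i < t.1) ∨ (t.2 = k - 1 ∧ t.1 ≤ i - 1)) ∪ bef R (i - 1) (k - 1) := by
    ext ⟨x, y⟩
    simp only [bef, Finset.mem_filter, Finset.mem_union]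
    constructor
    · rintro ⟨h1, h2⟩
      by_cases hx : (y = k ∧ i < x) ∨ (y = k - 1 ∧ x ≤ i - 1)
      · exact Or.inl ⟨h1, hx⟩
      · exact Or.inr ⟨h1, by omega⟩
    · rintro (⟨h1, h2⟩ | ⟨h1, h2⟩)
      · exact ⟨h1, by omega⟩
      · exact ⟨h1, by omega⟩
  rw [this, wR_union, mul_inv_rev, Equiv.Perm.mul_apply, wR_fix_inv (x := i + k - n - 1)]
  · rintro ⟨x, y⟩ h
    simp only [Finset.mem_filter] at h
    simp only [lt]
    omega
  · rintro ⟨x, y⟩ h ⟨x', y'⟩ h'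
    simp only [bef, Finset.mem_filter] at h h'
    simp only [rcOrder, ne_eq, Prod.mk.injEq]
    omega

lemma lab_eq (n : ℤ) (R : Finset (ℤ × ℤ)) (hR : ∀ p ∈ R, p.1 ≤ n ∧ 1 ≤ p.2) : ∀ (m : ℕ) (i k : ℤ), i ≤ n → (n - i).toNat + k.toNat ≤ m →
    lab n R true i k = (wR n (bef R i k))⁻¹ (i + k - n) ∧ lab n R false i k = (wR n (bef R i k))⁻¹ (i + k - n - 1) := by
  intro m
  induction m with
  | zero =>
    intro i k hi hm
    have hin : i = n := by omega
    subst hin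
    have hk : k ≤ 0 := by omega
    have he : bef R i k = ∅ := by
      rw [bef, Finset.filter_eq_empty_iff]
      intro p hp; have := hR p hp; omega
    rw [he]
    have h1 : wR i ∅ = 1 := by rw [wR_eq]; simp
    constructor
    · rw [lab, dif_pos le_rfl, h1]
      simp only [inv_one, Equiv.Perm.one_apply]
      omega
    · rw [lab, dif_pos hk, h1]
      simp only [inv_one, Equiv.Perm.one_apply]
  | succ m ih =>
    intro i k hi hm
    constructor
    · rw [lab]
      by_cases hin : n ≤ i
      · rw [dif_pos hin, wR_fix_inv]
        · omega
        · intro p hp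
          simp only [bef, Finset.mem_filter] at hp
          have := hR p hp.1
          simp only [lt]
          omega
      · rw [dif_neg hin, bef_succ]
        obtain ⟨h1, h2⟩ := ih (i + 1) k (by omega) (by omega)
        split_ifs with h
        · rw [h1, mul_inv_rev, Equiv.Perm.mul_apply, sT_inv, sT_l]
          congr 1; ring
        · rw [h2]; congr 1; ring
    · rw [lab]
      by_cases hk : k ≤ 0
      · rw [dif_pos hk, wR_fix_inv]
        intro p hp
        simp only [bef, Finset.mem_filter] at hp
        have := hR p hp.1
        omega
      · rw [dif_neg hk, bef_diag, bef_succ]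
        obtain ⟨h1, h2⟩ := ih i (k - 1) (by omega) (by omega)
        rw [sub_add_cancel]
        split_ifs with h
        · rw [h2, mul_inv_rev, Equiv.Perm.mul_apply, sT_inv]
          have : i + k - n - 1 = (i - 1 + (k - 1) - n) + 1 := by ring
          rw [this, sT_r]
          congr 1; ring
        · rw [h1]; congr 1; ring

lemma lab_true {n : ℤ} {R : Finset (ℤ × ℤ)} (hR : ∀ p ∈ R, p.1 ≤ n ∧ 1 ≤ p.2) {i k : ℤ} (hi : i ≤ n) :
    lab n R true i k = (wR n (bef R i k))⁻¹ (i + k - n) := (lab_eq n R hR _ i k hi le_rfl).1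
lemma lab_false {n : ℤ} {R : Finset (ℤ × ℤ)} (hR : ∀ p ∈ R, p.1 ≤ n ∧ 1 ≤ p.2) {i k : ℤ} (hi : i ≤ n) :
    lab n R false i k = (wR n (bef R i k))⁻¹ (i + k - n - 1) := (lab_eq n R hR _ i k hi le_rfl).2

lemma pinv1 (w : Equiv.Perm ℤ) (x : ℤ) : w⁻¹ (w x) = x := by simp
lemma pinv2 (w : Equiv.Perm ℤ) (x : ℤ) : w (w⁻¹ x) = x := by simp

lemma rc_split' {R : Finset (ℤ × ℤ)} {p α β} (h : R.sort rcOrder = α ++ p :: β) : β = (bef R p.1 p.2).sort rcOrder := by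
  have hp : p ∈ R := by rw [← Finset.mem_sort rcOrder, h]; simp
  obtain ⟨α', h', -⟩ := rc_split hp
  have hn := Finset.sort_nodup R rcOrder
  rw [h] at h'
  rw [h] at hn
  have key : ∀ (α α' : List (ℤ × ℤ)) (β β' : List (ℤ × ℤ)), (α ++ p :: β).Nodup → α ++ p :: β = α' ++ p :: β' → β = β' := by
    intro α
    induction α with
    | nil =>
      intro α' β β' hn he
      cases α' with
      | nil => simpa using he
      | cons c α' =>
        simp only [List.nil_append, List.cons_append, List.cons.injEq] at he
        obtain ⟨rfl, h'⟩ := he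
        rw [List.nil_append, List.nodup_cons, h'] at hn
        simp at hn
    | cons b α ih =>
      intro α' β β' hn he
      cases α' with
      | nil =>
        simp only [List.nil_append, List.cons_append, List.cons.injEq] at he
        rw [List.cons_append, List.nodup_cons] at hn
        rw [he.1] at hn
        simp at hn
      | cons c α' =>
        simp only [List.cons_append, List.cons.injEq] at he
        rw [List.cons_append, List.nodup_cons] at hn
        exact ih α' β β' hn.2 he.2
  exact key _ _ _ _ hn h'

lemma goodW_iff (l : List ℤ) : GoodW l ↔ ∀ l1 j l2, l = l1 ++ j :: l2 → (ws l2)⁻¹ j < (ws l2)⁻¹ (j + 1) := by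
  constructor
  · rintro h l1 j l2 rfl
    exact h.of_append.2
  · intro h
    induction l with
    | nil => trivial
    | cons j l ih =>
      exact ⟨ih fun l1 i l2 e => h (j :: l1) i l2 (by rw [e]; rfl), h [] j l rfl⟩

def Grid (n : ℤ) (R : Finset (ℤ × ℤ)) : Prop := ∀ p ∈ R, p.1 ≤ n ∧ 1 ≤ p.2 ∧ p.2 ≤ n

lemma Grid.g {n R} (h : Grid n R) : ∀ p ∈ R, p.1 ≤ n ∧ 1 ≤ p.2 := fun p hp => ⟨(h p hp).1, (h p hp).2.1⟩

lemma map_split {n : ℤ} {R : Finset (ℤ × ℤ)} {l1 j l2} (h : (R.sort rcOrder).map (lt n) = l1 ++ j :: l2) :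
    ∃ p ∈ R, j = lt n p ∧ ws l2 = wR n (bef R p.1 p.2) ∧ ∃ α, R.sort rcOrder = α ++ p :: (bef R p.1 p.2).sort rcOrder ∧ α.map (lt n) = l1 := by
  rw [List.map_eq_append_iff] at h
  obtain ⟨α, γ, h1, h2, h3⟩ := h
  rw [List.map_eq_cons_iff] at h3
  obtain ⟨p, β, rfl, rfl, rfl⟩ := h3
  have hb := rc_split' h1
  refine ⟨p, by rw [← Finset.mem_sort rcOrder, h1]; simp, rfl, by rw [wR_eq, hb], α, by rw [h1, ← hb], h2⟩

lemma isRC_iff {n : ℤ} {R : Finset (ℤ × ℤ)} (hR : ∀ p ∈ R, p.1 ≤ n ∧ p.2 ≤ n) : IsRC n R ↔ GoodW ((R.sort rcOrder).map (lt n)) := by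
  rw [IsRC, ← reduced_iff, wR_eq, List.length_map, Finset.length_sort]
  exact ⟨fun h => h.2, fun h => ⟨hR, h⟩⟩

lemma lab_lt {n : ℤ} {R : Finset (ℤ × ℤ)} (hR : Grid n R) {p : ℤ × ℤ} (hp : p ∈ R) :
    lab n R true p.1 p.2 = (wR n (bef R p.1 p.2))⁻¹ (lt n p + 1) ∧ lab n R false p.1 p.2 = (wR n (bef R p.1 p.2))⁻¹ (lt n p) := by
  rw [lab_true hR.g (hR p hp).1, lab_false hR.g (hR p hp).1]
  refine ⟨?_, rfl⟩
  simp only [lt]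
  congr 1; ring

lemma isRC_lab {n : ℤ} {R : Finset (ℤ × ℤ)} (hR : Grid n R) : IsRC n R ↔ ∀ p ∈ R, lab n R false p.1 p.2 < lab n R true p.1 p.2 := by
  rw [isRC_iff (fun p hp => ⟨(hR p hp).1, (hR p hp).2.2⟩), goodW_iff]
  constructor
  · intro h p hp
    obtain ⟨α, h1, -⟩ := rc_split hp
    have := h (α.map (lt n)) (lt n p) (((bef R p.1 p.2).sort rcOrder).map (lt n)) (by rw [h1]; simp)
    rw [← wR_eq] at this
    rw [(lab_lt hR hp).1, (lab_lt hR hp).2]; exact this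
  · intro h l1 j l2 e
    obtain ⟨p, hp, rfl, e2, -⟩ := map_split e
    rw [e2, ← (lab_lt hR hp).1, ← (lab_lt hR hp).2]; exact h p hp

lemma star_mono {w : Equiv.Perm ℤ} (h : ∀ i : ℤ, i ≤ 0 → w (i - 1) < w i) {a b : ℤ} (hab : a < b) (hb : b ≤ 0) : w a < w b := by
  have : ∀ m : ℕ, ∀ b : ℤ, b ≤ 0 → w (b - (m + 1)) < w b := by
    intro m
    induction m with
    | zero => intro b hb; simpa using h b hb
    | succ m ih =>
      intro b hb
      have h1 := h b hb
      have h2 := ih (b - 1) (by omega)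
      have e : b - 1 - ((m : ℤ) + 1) = b - (((m + 1 : ℕ) : ℤ) + 1) := by push_cast; ring
      rw [e] at h2
      exact h2.trans h1
  have h1 := this (b - a - 1).toNat b hb
  have e : b - (((b - a - 1).toNat : ℤ) + 1) = a := by omega
  rwa [e] at h1

lemma grid_of {n : ℤ} {R : Finset (ℤ × ℤ)} (h : IsRC n R) (hS : Star n R) : Grid n R := by
  intro p hp
  refine ⟨(h.1 p hp).1, ?_, (h.1 p hp).2⟩
  by_contra hlt
  have hne : R.sort rcOrder ≠ [] := by
    intro e; rw [← Finset.mem_sort rcOrder, e] at hp; simp at hp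
  obtain ⟨α, q, hq⟩ : ∃ α q, R.sort rcOrder = α ++ [q] := ⟨_, _, (List.dropLast_append_getLast hne).symm⟩
  have hqR : q ∈ R := by rw [← Finset.mem_sort rcOrder, hq]; simp
  have hq2 : q.2 ≤ 0 := by
    have hs := rc_sorted R
    rw [hq, List.pairwise_append] at hs
    rw [← Finset.mem_sort rcOrder, hq] at hp
    rcases List.mem_append.1 hp with hp | hp
    · have := hs.2.2 p hp q (by simp)
      unfold rcOrder at this; omega
    · simp only [List.mem_singleton] at hp
      rw [← hp]; omega
  have hG := (isRC_iff h.1).1 h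
  rw [hq] at hG
  simp only [List.map_append, List.map_cons, List.map_nil] at hG
  have h1 := hG.inverted
  simp only [ws_nil, inv_one, Equiv.Perm.one_apply] at h1
  have e : α.map (lt n) ++ [lt n q] = (R.sort rcOrder).map (lt n) := by rw [hq]; simp
  rw [e, ← wR_eq] at h1
  have h2 := hS (lt n q + 1) (by have := (h.1 q hqR).1; simp only [lt]; omega)
  rw [add_sub_cancel_right] at h2
  omega

def DR (n : ℕ) (R : Finset (ℤ × ℤ)) (r : ℕ) : Finset ℕ := (R.filter fun q : ℤ × ℤ => q.2 = (r : ℤ) + 1).image fun q : ℤ × ℤ => ((n : ℤ) - q.1).toNat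

def RD (n : ℕ) (D : ℕ → Finset ℕ) : Finset (ℤ × ℤ) := (Finset.range n).biUnion fun r => (D r).image fun p : ℕ => ((n : ℤ) - (p : ℤ), (r : ℤ) + 1)

lemma mem_DR {n : ℕ} {R} (hR : Grid n R) {r p : ℕ} : p ∈ DR n R r ↔ ((n : ℤ) - p, (r : ℤ) + 1) ∈ R := by
  simp only [DR, Finset.mem_image, Finset.mem_filter]
  constructor
  · rintro ⟨⟨x, y⟩, ⟨h1, h2⟩, h3⟩
    have := hR _ h1
    simp only at h2 h3 this
    have e1 : (n : ℤ) - p = x := by omega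
    rw [e1, ← h2]; exact h1
  · intro h
    exact ⟨_, ⟨h, rfl⟩, by simp⟩

lemma mem_RD {n : ℕ} {D : ℕ → Finset ℕ} {r p : ℕ} : ((n : ℤ) - p, (r : ℤ) + 1) ∈ RD n D ↔ r < n ∧ p ∈ D r := by
  simp only [RD, Finset.mem_biUnion, Finset.mem_range, Finset.mem_image, Prod.mk.injEq]
  constructor
  · rintro ⟨r', h1, p', h2, h3, h4⟩
    have e1 : r' = r := by omega
    have e2 : p' = p := by omega
    subst e1 e2
    exact ⟨h1, h2⟩
  · rintro ⟨h1, h2⟩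
    exact ⟨r, h1, p, h2, rfl, rfl⟩

lemma mem_RD' {n : ℕ} {D : ℕ → Finset ℕ} {q} (h : q ∈ RD n D) : ∃ r p : ℕ, r < n ∧ p ∈ D r ∧ q = ((n : ℤ) - p, (r : ℤ) + 1) := by
  simp only [RD, Finset.mem_biUnion, Finset.mem_range, Finset.mem_image] at h
  obtain ⟨r, h1, p, h2, h3⟩ := h
  exact ⟨r, p, h1, h2, h3.symm⟩

lemma RD_grid (n : ℕ) (D) : Grid n (RD n D) := by
  intro q hq
  obtain ⟨r, p, h1, h2, rfl⟩ := mem_RD' hq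
  simp only
  omega

lemma DR_RD (n : ℕ) {D : ℕ → Finset ℕ} (h : ∀ r, n ≤ r → D r = ∅) : DR n (RD n D) = D := by
  funext r
  ext p
  rw [mem_DR (RD_grid n D), mem_RD]
  constructor
  · exact fun h => h.2
  · intro hp
    refine ⟨?_, hp⟩
    by_contra hr
    rw [h r (by omega)] at hp
    simp at hp

lemma Grid.rep {n : ℕ} {R} (hR : Grid n R) {q} (hq : q ∈ R) : ∃ r p : ℕ, r < n ∧ q = ((n : ℤ) - p, (r : ℤ) + 1) := by
  have := hR q hq
  refine ⟨(q.2 - 1).toNat, (n - q.1).toNat, by omega, Prod.ext ?_ ?_⟩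
  · simp only; omega
  · simp only; omega

lemma grid_ext {n : ℕ} {R R'} (hR : Grid n R) (hR' : Grid n R') (h : ∀ r < n, ∀ p : ℕ, ((n : ℤ) - p, (r : ℤ) + 1) ∈ R ↔ ((n : ℤ) - p, (r : ℤ) + 1) ∈ R') : R = R' := by
  ext q
  constructor
  · intro hq
    obtain ⟨r, p, hr, rfl⟩ := hR.rep hq
    exact (h r hr p).1 hq
  · intro hq
    obtain ⟨r, p, hr, rfl⟩ := hR'.rep hq
    exact (h r hr p).2 hq

lemma DR_empty {n : ℕ} {R} (hR : Grid n R) : ∀ r, n ≤ r → DR n R r = ∅ := by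
  intro r hr
  ext p
  rw [mem_DR hR]
  constructor
  · intro h
    have := hR _ h
    simp only at this
    omega
  · simp

lemma RD_DR {n : ℕ} {R} (hR : Grid n R) : RD n (DR n R) = R := by
  refine grid_ext (RD_grid _ _) hR ?_
  intro r hr p
  rw [mem_RD, mem_DR hR]
  exact ⟨fun h => h.2, fun h => ⟨hr, h⟩⟩

lemma lab_Fw {n : ℕ} {R} (hR : Grid n R) : ∀ (r p : ℕ),
    (lab n R false ((n : ℤ) - p) ((r : ℤ) + 1)).toNat = Fw (DR n R) r p ∧
    (lab n R true ((n : ℤ) - p) ((r : ℤ) + 1)).toNat = car (r + 1) (Fw (DR n R) r) (DR n R r) p := by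
  intro r
  induction r with
  | zero =>
    have h0 : ∀ p : ℕ, (lab n R false ((n : ℤ) - p) ((0 : ℕ) + 1)).toNat = Fw (DR n R) 0 p := by
      intro p
      rw [lab, dif_neg (by omega), if_neg, lab_true hR.g (by omega), wR_fix_inv]
      · simp [Fw]
      · intro q hq
        simp only [bef, Finset.mem_filter] at hq
        have := hR q hq.1
        omega
      · intro h; have := hR _ h; simp at this
    intro p
    refine ⟨h0 p, ?_⟩
    induction p with
    | zero => rw [lab, dif_pos (by simp)]; simp [car]
    | succ p ih =>
      have e : (n : ℤ) - ((p + 1 : ℕ) : ℤ) + 1 = n - p := by push_cast; ring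
      rw [lab, dif_neg (by omega), e, car, ← h0 p, ← ih]
      simp only [mem_DR hR]
      split_ifs <;> rfl
  | succ r ihr =>
    have h0 : ∀ p : ℕ, (lab n R false ((n : ℤ) - p) (((r + 1 : ℕ) : ℤ) + 1)).toNat = Fw (DR n R) (r + 1) p := by
      intro p
      have e : (((r + 1 : ℕ) : ℤ) + 1) - 1 = r + 1 := by push_cast; ring
      rw [lab, dif_neg (by omega), e, Fw, out, ← (ihr p).1, ← (ihr p).2]
      simp only [mem_DR hR]
      split_ifs <;> rfl
    intro p
    refine ⟨h0 p, ?_⟩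
    induction p with
    | zero => rw [lab, dif_pos (by simp)]; simp only [car]; omega
    | succ p ih =>
      have e : (n : ℤ) - ((p + 1 : ℕ) : ℤ) + 1 = n - p := by push_cast; ring
      rw [lab, dif_neg (by omega), e, car, ← h0 p, ← ih]
      simp only [mem_DR hR]
      split_ifs <;> rfl

lemma Fw_top {n : ℕ} {R} (hR : Grid n R) (p : ℕ) : Fw (DR n R) n p = ((wR n R)⁻¹ ((n : ℤ) - p)).toNat := by
  rw [← (lab_Fw hR n p).1, lab_false hR.g (by omega)]
  have : bef R ((n : ℤ) - p) (n + 1) = R := by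
    rw [bef, Finset.filter_eq_self]
    intro q hq; have := hR q hq; omega
  rw [this]
  congr 2; ring

/-- Good rc-graphs. -/
def Good (n : ℕ) (R : Finset (ℤ × ℤ)) : Prop := IsRC n R ∧ Star n R

lemma Good.grid {n : ℕ} {R} (h : Good n R) : Grid n R := grid_of h.1 h.2

lemma good_iff {n : ℕ} {R} (hR : Grid n R) : Good n R ↔ LegitG n (DR n R) := by
  constructor
  · rintro ⟨h1, h2⟩ r hr p hp
    rw [mem_DR hR] at hp
    rw [← (lab_Fw hR r p).1, ← (lab_Fw hR r p).2]
    have h3 := (isRC_lab hR).1 h1 _ hp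
    have h4 : 0 < lab n R true ((n : ℤ) - p) ((r : ℤ) + 1) := by
      by_contra hle
      obtain ⟨α, e1, -⟩ := rc_split hp
      have hG := (isRC_iff h1.1).1 h1
      rw [e1, List.map_append, List.map_cons] at hG
      have h5 := hG.inverted
      rw [← List.map_cons, ← List.map_append, ← e1, ← wR_eq, ← wR_eq, ← (lab_lt hR hp).1, ← (lab_lt hR hp).2] at h5
      have := star_mono h2 h3 (by simp only; omega)
      omega
    simp only at h3
    omega
  · intro hL
    have key : ∀ q ∈ R, lab n R false q.1 q.2 < lab n R true q.1 q.2 ∧ 0 < lab n R true q.1 q.2 := by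
      intro q hq
      obtain ⟨r, p, hr, rfl⟩ := hR.rep hq
      have := hL r hr p ((mem_DR hR).2 hq)
      rw [← (lab_Fw hR r p).1, ← (lab_Fw hR r p).2] at this
      simp only
      omega
    refine ⟨(isRC_lab hR).2 fun q hq => (key q hq).1, ?_⟩
    intro i hi
    rw [wR_eq]
    refine ws_mono (P := fun x => x ≤ 0) ?_ (by omega) (by omega) hi
    intro l1 j l2 e
    obtain ⟨q, hq, rfl, e2, -⟩ := map_split e
    rw [e2, ← (lab_lt hR hq).1]
    have := (key q hq).2
    omega

lemma Good.gd {n : ℕ} {R} (h : Good n R) : GD n (DR n R) := ⟨(good_iff h.grid).1 h, DR_empty h.grid⟩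

lemma GD.good {n : ℕ} {D} (h : GD n D) : Good n (RD n D) := by
  rw [good_iff (RD_grid n D), DR_RD n h.2]; exact h.1

lemma wR_fix {n : ℤ} {R} (hR : ∀ p ∈ R, p.1 ≤ n ∧ p.2 ≤ n) : ∀ i : ℤ, n < i → (wR n R)⁻¹ i = i := by
  intro i hi
  apply wR_fix_inv
  intro p hp
  have := hR p hp
  simp only [lt]
  omega

lemma wR_low {n : ℤ} (R) : ∃ N : ℤ, ∀ i < N, (wR n R)⁻¹ i = i := by
  obtain ⟨N, hN⟩ : ∃ N : ℤ, ∀ p ∈ R, N ≤ lt n p := by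
    obtain ⟨N, hN⟩ := (R.image (lt n)).bddBelow
    exact ⟨N, fun p hp => hN (by simpa using ⟨_, _, hp, rfl⟩)⟩
  refine ⟨N, fun i hi => wR_fix_inv ?_⟩
  intro p hp
  have := hN p hp
  omega

lemma inc_ge {g : ℤ → ℤ} (h : ∀ a b, a < b → b ≤ 0 → g a < g b) {N : ℤ} (hN : ∀ i < N, g i = i) : ∀ a ≤ 0, a ≤ g a := by
  have : ∀ m : ℕ, ∀ a : ℤ, a ≤ 0 → a < N + m → a ≤ g a := by
    intro m
    induction m with
    | zero => intro a h0 ha; rw [hN a (by simpa using ha)]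
    | succ m ih =>
      intro a h0 ha
      have h1 := ih (a - 1) (by omega) (by push_cast at ha; omega)
      have h2 := h (a - 1) a (by omega) h0
      omega
  intro a ha
  exact this (a - N + 1).toNat a ha (by omega)

lemma perm_det {n : ℤ} {w w' : Equiv.Perm ℤ} (h1 : ∀ i, n < i → w⁻¹ i = i) (h2 : ∀ i, n < i → w'⁻¹ i = i)
    (s1 : ∀ i : ℤ, i ≤ 0 → w (i - 1) < w i) (s2 : ∀ i : ℤ, i ≤ 0 → w' (i - 1) < w' i)
    (l1 : ∃ N : ℤ, ∀ i < N, w⁻¹ i = i) (l2 : ∃ N : ℤ, ∀ i < N, w'⁻¹ i = i)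
    (he : ∀ i ≤ n, (w⁻¹ i).toNat = (w'⁻¹ i).toNat) : w = w' := by
  have he' : ∀ i, (w⁻¹ i).toNat = (w'⁻¹ i).toNat := by
    intro i
    by_cases hi : i ≤ n
    · exact he i hi
    · rw [h1 i (by omega), h2 i (by omega)]
  have key : ∀ {w w' : Equiv.Perm ℤ}, (∀ i : ℤ, i ≤ 0 → w (i - 1) < w i) → (∀ i : ℤ, i ≤ 0 → w' (i - 1) < w' i) →
      (∃ N : ℤ, ∀ i < N, w⁻¹ i = i) → (∃ N : ℤ, ∀ i < N, w'⁻¹ i = i) → (∀ i, (w⁻¹ i).toNat = (w'⁻¹ i).toNat) →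
      ∀ a ≤ 0, w'⁻¹ (w a) ≤ 0 ∧ a ≤ w'⁻¹ (w a) := by
    intro w w' s1 s2 l1 l2 he
    have hneg : ∀ a ≤ 0, w'⁻¹ (w a) ≤ 0 := by
      intro a ha
      have := he (w a)
      rw [pinv1] at this
      omega
    obtain ⟨N, hN⟩ := l1
    obtain ⟨N', hN'⟩ := l2
    have := inc_ge (g := fun a => w'⁻¹ (w a)) (N := min N N') ?_ ?_
    · exact fun a ha => ⟨hneg a ha, this a ha⟩
    · intro a b hab hb
      by_contra hle
      have e1 := star_mono s1 hab hb
      rcases (not_lt.1 hle).eq_or_lt with e | e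
      · have := w.injective (w'⁻¹.injective e); omega
      · have := star_mono s2 e (hneg a (by omega))
        rw [pinv2, pinv2] at this
        omega
    · intro i hi
      have e : w i = i := by
        have := hN i (by omega)
        rw [Equiv.Perm.inv_eq_iff_eq] at this
        exact this.symm
      simp only [e]
      exact hN' i (by omega)
  have k1 := key s1 s2 l1 l2 he'
  have k2 := key s2 s1 l2 l1 (fun i => (he' i).symm)
  ext a
  by_cases ha : a ≤ 0
  · obtain ⟨m1, m2⟩ := k1 a ha
    obtain ⟨m3, m4⟩ := k2 _ m1
    rw [pinv2, pinv1] at m4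
    have e : w'⁻¹ (w a) = a := by omega
    rw [Equiv.Perm.inv_eq_iff_eq] at e
    exact e
  · have := he' (w a)
    rw [pinv1] at this
    have e : w'⁻¹ (w a) = a := by omega
    rw [Equiv.Perm.inv_eq_iff_eq] at e
    exact e

lemma top_det {n : ℕ} {R R'} (h : Good n R) (h' : Good n R') (he : Fw (DR n R) n = Fw (DR n R') n) : wR n R = wR n R' := by
  refine perm_det (n := n) (wR_fix h.1.1) (wR_fix h'.1.1) h.2 h'.2 (wR_low R) (wR_low R') ?_
  intro i hi
  have h1 := congrFun he (n - i).toNat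
  rw [Fw_top h.grid, Fw_top h'.grid] at h1
  have e : (n : ℤ) - ((n - i).toNat : ℤ) = i := by omega
  rwa [e] at h1

lemma top_eq {n : ℕ} {R R'} (h : Good n R) (h' : Good n R') (he : wR n R = wR n R') : Fw (DR n R) n = Fw (DR n R') n := by
  funext p
  rw [Fw_top h.grid, Fw_top h'.grid, he]

lemma exists_van (n : ℕ) {w : Equiv.Perm ℤ} (hw : ∃ N : ℤ, ∀ i < N, w⁻¹ i = i) : ∃ c, ∀ R, Good n R → wR n R = w → VanG n c (DR n R) := by
  obtain ⟨N, hN⟩ := hw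
  refine ⟨n + N.natAbs + 1, ?_⟩
  intro R hR e p hp
  rw [Fw_top hR.grid, e, hN _ (by omega)]
  omega

lemma finite_RC (n : ℕ) {w : Equiv.Perm ℤ} (hw : ∃ N : ℤ, ∀ i < N, w⁻¹ i = i) : {R | Good n R ∧ wR n R = w}.Finite := by
  obtain ⟨c, hc⟩ := exists_van n hw
  refine Set.Finite.subset (Finset.finite_toSet (Finset.powerset ((Finset.Icc ((n : ℤ) - c) n) ×ˢ (Finset.Icc 1 (n : ℤ))))) ?_
  rintro R ⟨hR, e⟩
  rw [Finset.mem_coe, Finset.mem_powerset]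
  intro q hq
  obtain ⟨r, p, hr, rfl⟩ := hR.grid.rep hq
  have h1 := (bdG_of_top hR.gd.1 (hc R hR e)).2 r hr p
  rw [mem_DR hR.grid] at h1
  have : p < c := by
    by_contra hh; exact h1 (by omega) hq
  simp only [Finset.mem_product, Finset.mem_Icc]
  omega

lemma Grid.mono {n R R'} (h : Grid n R) (hs : R' ⊆ R) : Grid n R' := fun p hp => h p (hs hp)

lemma bef_sub (R i k) : bef R i k ⊆ R := Finset.filter_subset _ _

lemma mem_bef {R : Finset (ℤ × ℤ)} {i k : ℤ} {t} : t ∈ bef R i k ↔ t ∈ R ∧ (t.2 < k ∨ (t.2 = k ∧ i < t.1)) := Finset.mem_filter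

lemma bef_bef {R : Finset (ℤ × ℤ)} {i k : ℤ} {q} (hq : q ∈ bef R i k) : bef (bef R i k) q.1 q.2 = bef R q.1 q.2 := by
  rw [mem_bef] at hq
  ext t
  simp only [mem_bef]
  constructor
  · exact fun h => ⟨h.1.1, h.2⟩
  · exact fun h => ⟨⟨h.1, by omega⟩, h.2⟩

lemma bef_erase {R : Finset (ℤ × ℤ)} {p : ℤ × ℤ} (i k : ℤ) : bef (R.erase p) i k = (bef R i k).erase p := by
  ext t
  simp only [mem_bef, Finset.mem_erase]
  tauto

lemma bef_erase_of {R : Finset (ℤ × ℤ)} {p : ℤ × ℤ} {i k : ℤ} (h : p ∉ bef R i k) : bef (R.erase p) i k = bef R i k := by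
  rw [bef_erase, Finset.erase_eq_of_notMem h]

lemma self_notMem_bef {R : Finset (ℤ × ℤ)} {p : ℤ × ℤ} : p ∉ bef R p.1 p.2 := by
  rw [mem_bef]; omega

lemma bef_tri {R : Finset (ℤ × ℤ)} {p q : ℤ × ℤ} (hp : p ∈ R) (hq : q ∈ R) (h : p ≠ q) : p ∈ bef R q.1 q.2 ∨ q ∈ bef R p.1 p.2 := by
  have : ¬ (p.1 = q.1 ∧ p.2 = q.2) := fun e => h (Prod.ext e.1 e.2)
  by_cases hc : p.2 < q.2 ∨ (p.2 = q.2 ∧ q.1 < p.1)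
  · exact Or.inl (mem_bef.2 ⟨hp, hc⟩)
  · exact Or.inr (mem_bef.2 ⟨hq, by omega⟩)

lemma lab_bef {n : ℤ} {R R'} (hR : Grid n R) (hR' : Grid n R') {i k : ℤ} (hi : i ≤ n) (h : bef R i k = bef R' i k) (b) :
    lab n R b i k = lab n R' b i k := by
  cases b
  · rw [lab_false hR.g hi, lab_false hR'.g hi, h]
  · rw [lab_true hR.g hi, lab_true hR'.g hi, h]

lemma inv_lab {n : ℤ} {R} (hR : Grid n R) (h : IsRC n R) {q} (hq : q ∈ R) :
    wR n R (lab n R true q.1 q.2) < wR n R (lab n R false q.1 q.2) := by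
  obtain ⟨α, e1, -⟩ := rc_split hq
  have hG := (isRC_iff h.1).1 h
  rw [e1, List.map_append, List.map_cons] at hG
  have h5 := hG.inverted
  rwa [← List.map_cons, ← List.map_append, ← e1, ← wR_eq, ← wR_eq, ← (lab_lt hR hq).1, ← (lab_lt hR hq).2] at h5

lemma isRC_bef {n : ℤ} {R} (hR : Grid n R) (h : IsRC n R) (i k : ℤ) : IsRC n (bef R i k) := by
  have hb := hR.mono (bef_sub R i k)
  rw [isRC_lab hb]
  intro q hq
  rw [lab_bef hb hR (hb q hq).1 (bef_bef hq), lab_bef hb hR (hb q hq).1 (bef_bef hq)]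
  exact (isRC_lab hR).1 h q (bef_sub _ _ _ hq)

/-- A pair of strands which crosses before `(i,k)` arrives inverted. -/
lemma arrive {n : ℤ} {R} (hR : Grid n R) {p : ℤ × ℤ} (hp : p ∈ R) (h : IsRC n (bef R p.1 p.2)) {q} (hq : q ∈ bef R p.1 p.2)
    (h1 : lab n R true q.1 q.2 = lab n R true p.1 p.2) (h2 : lab n R false q.1 q.2 = lab n R false p.1 p.2) : False := by
  have hb := hR.mono (bef_sub R p.1 p.2)
  have h3 := inv_lab hb h hq
  rw [lab_bef hb hR (hb q hq).1 (bef_bef hq), lab_bef hb hR (hb q hq).1 (bef_bef hq), h1, h2, (lab_lt hR hp).1, (lab_lt hR hp).2,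
    pinv2, pinv2] at h3
  omega

lemma lab_uniq {n : ℤ} {R} (hR : Grid n R) (h : IsRC n R) {p q : ℤ × ℤ} (hp : p ∈ R) (hq : q ∈ R)
    (h1 : lab n R true q.1 q.2 = lab n R true p.1 p.2) (h2 : lab n R false q.1 q.2 = lab n R false p.1 p.2) : p = q := by
  by_contra hne
  rcases bef_tri hp hq hne with hb | hb
  · exact arrive hR hq (isRC_bef hR h _ _) hb h1.symm h2.symm
  · exact arrive hR hp (isRC_bef hR h _ _) hb h1 h2

lemma wR_erase {n : ℤ} {R} {p : ℤ × ℤ} (hp : p ∈ R) : wR n R = wR n (R.erase p) *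
    Equiv.swap ((wR n (bef R p.1 p.2))⁻¹ (lt n p)) ((wR n (bef R p.1 p.2))⁻¹ (lt n p + 1)) := by
  obtain ⟨α, e1, e2⟩ := rc_split hp
  rw [wR_eq n R, e1, wR_eq n (R.erase p), e2, List.map_append, List.map_append, List.map_cons, ws_append, ws_append, ws_cons, ← wR_eq,
    mul_assoc, Equiv.mul_swap_eq_swap_mul, pinv2, pinv2]
  rfl

lemma wR_erase_lab {n : ℤ} {R} (hR : Grid n R) {p : ℤ × ℤ} (hp : p ∈ R) : wR n R = wR n (R.erase p) *
    Equiv.swap (lab n R false p.1 p.2) (lab n R true p.1 p.2) := by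
  rw [(lab_lt hR hp).1, (lab_lt hR hp).2]; exact wR_erase hp

lemma lab_erase {n : ℤ} {R} (hR : Grid n R) {p : ℤ × ℤ} {i k : ℤ} (hp : p ∈ bef R i k) (hi : i ≤ n) (c : Bool) :
    lab n R c i k = Equiv.swap (lab n R false p.1 p.2) (lab n R true p.1 p.2) (lab n (R.erase p) c i k) := by
  have hpR := bef_sub _ _ _ hp
  have hR' : Grid n (R.erase p) := hR.mono (Finset.erase_subset _ _)
  have h := wR_erase (n := n) hp
  rw [bef_bef hp, ← bef_erase, ← (lab_lt hR hpR).1, ← (lab_lt hR hpR).2] at h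
  cases c
  · rw [lab_false hR.g hi, h, lab_false hR'.g hi, mul_inv_rev, Equiv.swap_inv]; rfl
  · rw [lab_true hR.g hi, h, lab_true hR'.g hi, mul_inv_rev, Equiv.swap_inv]; rfl

lemma Good.lab_pos {n : ℕ} {R} (h : Good n R) {q} (hq : q ∈ R) : 0 < lab n R true q.1 q.2 := by
  have hL := (good_iff h.grid).1 h
  obtain ⟨r, p, hr, rfl⟩ := h.grid.rep hq
  have := hL r hr p ((mem_DR h.grid).2 hq)
  rw [← (lab_Fw h.grid r p).1, ← (lab_Fw h.grid r p).2] at this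
  simp only
  omega

/-- The unique other crossing. -/
lemma second_cross {n : ℕ} {S} (hS : Grid n S) {p q : ℤ × ℤ} (hp : p ∈ S) (h0 : Good n (S.erase p))
    (ha : 0 < lab n S true p.1 p.2) (hb : lab n S false p.1 p.2 ≤ 0) (hq : q ∈ S) (hpq : p ∈ bef S q.1 q.2)
    (hs : lab n S false q.1 q.2 = lab n S true p.1 p.2) (hw : lab n S true q.1 q.2 ≤ 0) :
    ¬ IsRC n S ∧ (S.filter fun t => t ≠ p ∧ ((lab n S true t.1 t.2 = lab n S true p.1 p.2 ∧ lab n S false t.1 t.2 = lab n S false p.1 p.2) ∨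
                     (lab n S true t.1 t.2 = lab n S false p.1 p.2 ∧ lab n S false t.1 t.2 = lab n S true p.1 p.2))) = {q} ∧
    Good n (S.erase q) := by
  set a := lab n S true p.1 p.2 with ha'
  set b := lab n S false p.1 p.2 with hb'
  have hS0 := h0.grid
  have hne : q ≠ p := by rintro rfl; exact self_notMem_bef hpq
  have hq0 : q ∈ S.erase p := Finset.mem_erase.2 ⟨hne, hq⟩
  have e1 := lab_erase hS hpq (hS q hq).1 true
  have e2 := lab_erase hS hpq (hS q hq).1 false
  rw [← ha', ← hb'] at e1 e2
  have hd := h0.lab_pos hq0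
  have hwb : lab n S true q.1 q.2 = b ∧ lab n (S.erase p) true q.1 q.2 = a := by
    rw [e1] at hw ⊢
    rw [Equiv.swap_apply_def] at hw ⊢
    split_ifs at hw ⊢ <;> omega
  have hsb : lab n (S.erase p) false q.1 q.2 = b := by
    rw [hs, Equiv.swap_apply_def] at e2
    split_ifs at e2 <;> omega
  refine ⟨?_, ?_, ?_⟩
  · rw [isRC_lab hS]
    intro h
    have := h q hq
    omega
  · ext t
    rw [Finset.mem_filter, Finset.mem_singleton]
    constructor
    · rintro ⟨h1, h2, h3⟩
      have ht0 : t ∈ S.erase p := Finset.mem_erase.2 ⟨h2, h1⟩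
      have hlt := (isRC_lab hS0).1 h0.1 t ht0
      rcases bef_tri h1 hp h2 with h4 | h4
      · exfalso
        have hT := isRC_bef hS0 h0.1 p.1 p.2
        rw [bef_erase_of self_notMem_bef] at hT
        have h5 : p ∉ bef S t.1 t.2 := by rw [mem_bef] at h4 ⊢; omega
        have h6 : bef (S.erase p) t.1 t.2 = bef S t.1 t.2 := bef_erase_of h5
        rw [lab_bef hS0 hS (hS t h1).1 h6, lab_bef hS0 hS (hS t h1).1 h6] at hlt
        refine arrive hS hp hT h4 ?_ ?_ <;> omega
      · have f1 := lab_erase hS h4 (hS t h1).1 true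
        have f2 := lab_erase hS h4 (hS t h1).1 false
        rw [← ha', ← hb', Equiv.swap_apply_def] at f1 f2
        refine lab_uniq hS0 h0.1 ht0 hq0 ?_ ?_
        · rw [hwb.2]; split_ifs at f1 f2 <;> omega
        · rw [hsb]; split_ifs at f1 f2 <;> omega
    · rintro rfl
      exact ⟨hq, hne, Or.inr ⟨hwb.1, hs⟩⟩
  · have hwr : wR n (S.erase q) = wR n (S.erase p) := by
      have g1 := wR_erase_lab hS hq
      have g2 := wR_erase_lab hS hp
      rw [hs, hwb.1] at g1
      rw [g1, Equiv.swap_comm, ← ha', ← hb'] at g2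
      exact mul_right_cancel g2
    refine ⟨⟨fun t ht => ?_, ?_⟩, ?_⟩
    · have := hS t (Finset.mem_of_mem_erase ht); omega
    · rw [hwr, h0.1.2, Finset.card_erase_of_mem hp, Finset.card_erase_of_mem hq]
    · unfold Star; rw [hwr]; exact h0.2

lemma Tr.pos {B D D' n P Q} (h : Tr B D D' n P Q) : ∃ pos : ℕ → ℕ, pos 0 = P ∧ pos n = Q ∧ ∀ r < n,
    RowStep B ((r + 1) * B) ((r + 2) * B) (r + 1) (Fw D r) (D r) (pos r) (Fw D' r) (D' r) (pos (r + 1)) := by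
  induction n generalizing Q with
  | zero => exact ⟨fun _ => P, rfl, h.symm, by omega⟩
  | succ n ih =>
    obtain ⟨M, h1, h2⟩ := h
    obtain ⟨pos, e1, e2, e3⟩ := ih h1
    refine ⟨fun r => if r ≤ n then pos r else Q, by simp [e1], by simp, ?_⟩
    intro r hr
    rcases Nat.lt_succ_iff_lt_or_eq.1 hr with h | rfl
    · simp only; rw [if_pos (by omega), if_pos (by omega)]; exact e3 r h
    · simp only; rw [if_pos le_rfl, if_neg (by omega), e2]; exact h2

def MX (D D' : ℕ → Finset ℕ) (r : ℕ) : ℕ → Finset ℕ := fun s => if s < r then D' s else D s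

lemma toNat_eq_pos {a b : ℤ} (h : a.toNat = b.toNat) (hb : 0 < b) : a = b := by omega

/-- The main loop. -/
lemma loop {n B : ℕ} {D D' : ℕ → Finset ℕ} {pos : ℕ → ℕ} (hD : GD n D) (hD' : GD n D')
    (m : ℕ) : ∀ (r : ℕ) (p : ℤ × ℤ) (fuel : ℕ), r + m = n →
    (∀ s, r ≤ s → s < n →
      RowStep B ((s + 1) * B) ((s + 2) * B) (s + 1) (Fw D s) (D s) (pos s) (Fw D' s) (D' s) (pos (s + 1))) →
    pos r < B → p ∈ RD n (MX D D' r) → Good n ((RD n (MX D D' r)).erase p) → p.2 ≤ r →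
    0 < lab n (RD n (MX D D' r)) true p.1 p.2 → lab n (RD n (MX D D' r)) false p.1 p.2 ≤ 0 →
    Fw D r (pos r) = (lab n (RD n (MX D D' r)) true p.1 p.2).toNat → m < fuel →
    ∀ d, ((insertSteps n fuel (RD n (MX D D' r)) p).getLast?.getD d).1 = RD n D' := by
  induction m with
  | zero =>
    intro r p fuel hr hst hpos hp h0 hp2 ha hb hval hf d
    have hrn : r = n := by omega
    subst hrn
    have hM : RD r (MX D D' r) = RD r D' := by
      refine grid_ext (RD_grid _ _) (RD_grid _ _) ?_
      intro s hs q
      rw [mem_RD, mem_RD, MX, if_pos hs]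
    obtain ⟨fuel, rfl⟩ : ∃ k, fuel = k + 1 := ⟨fuel - 1, by omega⟩
    rw [insertSteps, hM, if_pos hD'.good.1]
    rfl
  | succ m ih =>
    intro r p fuel hr hst hpos hp h0 hp2 ha hb hval hf d
    have hrn : r < n := by omega
    obtain ⟨z, hE, hcase⟩ := (hst r le_rfl hrn).gen (loB B r) (lohi B r) hpos
    rcases hcase with ⟨hnc, hDD, hQB, hQ⟩ | ⟨-, hC⟩
    · have hM : MX D D' (r + 1) = MX D D' r := by
        funext s
        simp only [MX]
        by_cases hs : s = r
        · subst hs; rw [if_pos (by omega), if_neg (by omega), hDD]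
        · split_ifs <;> first | rfl | omega
      have := ih (r + 1) p fuel (by omega) (fun s hs hsn => hst s (by omega) hsn) hQB
      rw [hM] at this
      refine this hp h0 (by push_cast; omega) ha hb ?_ (by omega) d
      rw [← hval, Fw, out, hQ]
      have hL := hD.1 r hrn
      by_cases hPD : pos r ∈ D r
      · rw [if_pos hPD, if_pos hPD]
      · rw [if_neg hPD]
        have hc : car (r + 1) (Fw D r) (D r) (pos r + 1) = Fw D r (pos r) := by rw [car_succ, if_neg hPD]
        by_cases hPD1 : pos r + 1 ∈ D r
        · exfalso
          have h1 := hL _ hPD1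
          rw [hc] at h1
          have hz : z ≠ pos r + 1 := fun e => hnc ⟨hPD, hPD1, e⟩
          have h2 := hE.1
          have h3 := hE.2.2.2.1 (pos r + 1) (by omega) (by omega)
          omega
        · rw [if_neg hPD1, hc]
    · obtain ⟨-, hE, hPD, hPD1, hQP, hQD, hQf, hcar, hD1⟩ := hC
      set P := pos r with hP
      set Q := pos (r + 1) with hQ
      set f := Fw D r with hf0
      set f1 := Fw D' r with hf1
      set S := RD n (MX D D' r) with hSdef
      have hSg : Grid n S := RD_grid _ _
      have hDS : DR n S = MX D D' r := DR_RD n (fun s hs => by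
        simp only [MX]; split_ifs
        · exact hD'.2 s hs
        · exact hD.2 s hs)
      have hFS : Fw (DR n S) r = f1 := by
        rw [hDS]
        refine Fw_congr r ?_
        intro s hs; simp [MX, hs]
      have hDSr : DR n S r = D r := by rw [hDS]; simp [MX]
      obtain ⟨q, hqdef⟩ : ∃ q : ℤ × ℤ, q = ((n : ℤ) - ((P + 1 : ℕ) : ℤ), (r : ℤ) + 1) := ⟨_, rfl⟩
      have hqS : q ∈ S := by
        rw [hqdef, ← mem_DR hSg, hDSr]; exact hPD1
      obtain ⟨hE1, hE2, hE3, hE4, hE5, hE6, hE7⟩ := hE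
      have hpq : p ∈ bef S q.1 q.2 := by
        rw [mem_bef, hqdef]; exact ⟨hp, Or.inl (by simp only; omega)⟩
      have hl := lab_Fw hSg r (P + 1)
      rw [hFS, hDSr, car_succ, if_neg hPD, hE5, hE6, hval] at hl
      have hs : lab n S false q.1 q.2 = lab n S true p.1 p.2 := by
        rw [hqdef]; exact toNat_eq_pos hl.1 ha
      have hw : lab n S true q.1 q.2 ≤ 0 := by
        rw [hqdef]; have := hl.2; simp only; omega
      obtain ⟨k1, k2, k3⟩ := second_cross hSg hp h0 ha hb hqS hpq hs hw
      set R' := S.erase q with hR'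
      have hR'g := k3.grid
      have hDR's : ∀ s < r, DR n R' s = D' s := by
        intro s hs
        ext t
        rw [mem_DR hR'g, hR', Finset.mem_erase, ← mem_DR hSg, hDS]
        simp only [MX, if_pos hs, hqdef, ne_eq, Prod.mk.injEq]
        constructor
        · exact fun h => h.2
        · exact fun h => ⟨by omega, h⟩
      have hDR'r : DR n R' r = (D r).erase (P + 1) := by
        ext t
        rw [mem_DR hR'g, hR', Finset.mem_erase, ← mem_DR hSg, hDSr, Finset.mem_erase]
        simp only [hqdef, ne_eq, Prod.mk.injEq]
        have : ((n : ℤ) - t = n - ((P + 1 : ℕ) : ℤ)) ↔ t = P + 1 := by omega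
        rw [this, and_true]
      have hFR' : Fw (DR n R') r = f1 := Fw_congr r hDR's
      have hlR := lab_Fw hR'g r
      rw [hFR', hDR'r] at hlR
      have hcarQ : car (r + 1) f1 ((D r).erase (P + 1)) Q = car (r + 1) f (D r) Q := by
        refine car_congr Q (fun s hs => hE7 s (by omega) (by omega)) (fun s hs => ?_)
        rw [Finset.mem_erase]
        exact ⟨fun h => h.2, fun h => ⟨by omega, h⟩⟩
      have hf1Q : f1 Q = 0 := by
        rcases hQP.eq_or_lt with e | e
        · rw [e]; exact hE5
        · rw [hE7 Q (by omega) (by omega)]; exact hQf Q le_rfl e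
      have hQnD : Q ∉ D r := hQD Q le_rfl hQP
      have hQnR' : ((n : ℤ) - Q, (r : ℤ) + 1) ∉ R' := by
        rw [← mem_DR hR'g, hDR'r, Finset.mem_erase]; exact fun h => hQnD h.2
      have hlQ := hlR Q
      rw [hf1Q, hcarQ] at hlQ
      have hlQ1 : lab n R' false ((n : ℤ) - Q) ((r : ℤ) + 1) ≤ 0 := by have := hlQ.1; omega
      have hlQ2 : 0 < lab n R' true ((n : ℤ) - Q) ((r : ℤ) + 1) := by have := hlQ.2; omega
      have hinf : sInf {x : ℤ | q.1 < x ∧ OpenSpace n R' x q.2} = (n : ℤ) - Q := by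
        refine IsLeast.csInf_eq ⟨?_, ?_⟩
        · rw [hqdef]
          refine ⟨by simp only; push_cast; omega, by omega, hQnR', hlQ1, hlQ2⟩
        · rintro x ⟨h1, h2, h3, h4, h5⟩
          rw [hqdef] at h1 h3 h4 h5
          simp only at h1 h3 h4 h5
          by_contra hlt
          obtain ⟨s, hs⟩ : ∃ s : ℕ, x = (n : ℤ) - ((s + 1 : ℕ) : ℤ) := ⟨((n : ℤ) - x - 1).toNat, by omega⟩
          subst hs
          have h6 := (hlR (s + 1)).2
          have h7 : s ∉ (D r).erase (P + 1) := fun h => hQD s (by omega) (by omega) (Finset.mem_of_mem_erase h)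
          rw [car_succ, if_neg h7] at h6
          have h8 : f1 s = 0 := by
            by_cases e : s = P
            · rw [e]; exact hE5
            · rw [hE7 s e (by omega)]; exact hQf s (by omega) (by omega)
          omega
      have hnew : insert ((n : ℤ) - Q, (r : ℤ) + 1) R' = RD n (MX D D' (r + 1)) := by
        refine grid_ext ?_ (RD_grid _ _) ?_
        · intro t ht
          rcases Finset.mem_insert.1 ht with rfl | ht
          · simp only; omega
          · exact hR'g t ht
        · intro s hsn t
          rw [Finset.mem_insert, mem_RD, ← mem_DR hR'g]
          simp only [Prod.mk.injEq, MX]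
          rcases lt_trichotomy s r with h | h | h
          · rw [if_pos (by omega), hDR's s h]
            constructor
            · rintro (h' | h')
              · omega
              · exact ⟨hsn, h'⟩
            · exact fun h' => Or.inr h'.2
          · subst h
            rw [if_pos (by omega), hDR'r, hD1, Finset.mem_insert]
            constructor
            · rintro (h' | h')
              · exact ⟨hsn, Or.inl (by omega)⟩
              · exact ⟨hsn, Or.inr h'⟩
            · rintro ⟨-, h' | h'⟩
              · subst h'; exact Or.inl ⟨rfl, rfl⟩
              · exact Or.inr h'
          · rw [if_neg (by omega), mem_DR hR'g, hR', Finset.mem_erase, ← mem_DR hSg, hDS]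
            simp only [MX, hqdef, ne_eq, Prod.mk.injEq]
            rw [if_neg (by omega)]
            constructor
            · rintro (h' | h')
              · omega
              · exact ⟨hsn, h'.2⟩
            · exact fun h' => Or.inr ⟨by omega, h'.2⟩
      obtain ⟨fuel, rfl⟩ : ∃ k, fuel = (k + 1) + 1 := ⟨fuel - 2, by omega⟩
      rw [insertSteps, if_neg k1]
      simp only
      rw [k2, Finset.sort_singleton]
      simp only [List.headI_cons]
      rw [hinf, hqdef]
      simp only
      rw [← hqdef, ← hR', hnew]
      have hgoal := ih (r + 1) ((n : ℤ) - Q, (r : ℤ) + 1) (fuel + 1) (by omega) (fun s hs hsn => hst s (by omega) hsn) (by omega)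
      rw [← hnew] at hgoal
      have hS'g : Grid n (insert ((n : ℤ) - Q, (r : ℤ) + 1) R') := by rw [hnew]; exact RD_grid _ _
      have her : (insert ((n : ℤ) - Q, (r : ℤ) + 1) R').erase ((n : ℤ) - Q, (r : ℤ) + 1) = R' := Finset.erase_insert hQnR'
      have hbf : bef (insert ((n : ℤ) - Q, (r : ℤ) + 1) R') ((n : ℤ) - Q) ((r : ℤ) + 1) = bef R' ((n : ℤ) - Q) ((r : ℤ) + 1) := by
        have := bef_erase_of (R := insert ((n : ℤ) - Q, (r : ℤ) + 1) R') (self_notMem_bef (p := ((n : ℤ) - Q, (r : ℤ) + 1)))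
        rw [her] at this; exact this.symm
      have hlb := fun c => lab_bef hS'g hR'g (by omega) hbf c
      have hg2 := hgoal (Finset.mem_insert_self _ _) (by rw [her]; exact k3) (by push_cast; exact le_rfl)
        (by simp only; rw [hlb]; exact hlQ2) (by simp only; rw [hlb]; exact hlQ1)
        (by
          simp only; rw [hlb, hlQ.2, Fw, out, if_neg hQnD]) (by omega) d
      rw [hnew, insertSteps] at hg2
      rw [insertSteps, List.getLast?_cons_cons]
      exact hg2

lemma Tr.sleeps {B x n : ℕ} {D D' : ℕ → Finset ℕ} {pos : ℕ → ℕ} (hB : 0 < B) (hx : 1 ≤ x) (hxn : x ≤ n) (h0 : pos 0 = x * B)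
    (hst : ∀ r < n, RowStep B ((r + 1) * B) ((r + 2) * B) (r + 1) (Fw D r) (D r) (pos r) (Fw D' r) (D' r) (pos (r + 1))) :
    ∀ r < x, pos r = x * B ∧ ∀ s < r, D' s = D s := by
  intro r
  induction r with
  | zero => exact fun _ => ⟨h0, by omega⟩
  | succ r ih =>
    intro hr
    obtain ⟨h1, h2⟩ := ih (by omega)
    have h3 := hst r (by omega)
    have hle : (r + 2) * B ≤ x * B := Nat.mul_le_mul_right _ (by omega)
    have hBx : B ≤ x * B := Nat.le_mul_of_pos_left _ (by omega)
    rw [h1] at h3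
    rcases h3 with h | h | h | h
    · refine ⟨h.2.2.2, fun s hs => ?_⟩
      rcases Nat.lt_succ_iff_lt_or_eq.1 hs with h' | rfl
      · exact h2 s h'
      · exact h.2.2.1
    · have := h.2.1; omega
    · have := h.1; omega
    · have := h.1; omega

lemma insertOne_eq {n B x Q : ℕ} {R} {D'} (hB : 0 < B) (hR : Good n R) (h : InsX n B (DR n R) x D' Q) : insertOne n R x = RD n D' := by
  have hD' : GD n D' := h.gd hR.gd
  obtain ⟨hx, hxn, hT, hge⟩ := h
  obtain ⟨pos, h0, -, hst⟩ := hT.pos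
  obtain ⟨k, rfl⟩ : ∃ k, x = k + 1 := ⟨x - 1, by omega⟩
  obtain ⟨hp, hs⟩ := Tr.sleeps hB hx hxn h0 hst k (by omega)
  have hstart := hst k (by omega)
  have hBx : B ≤ (k + 1) * B := loB B k
  have hlt : (k + 1) * B < (k + 2) * B := by nlinarith
  rw [hp] at hstart
  have hS : StartS B ((k + 1) * B) ((k + 2) * B) (k + 1) (Fw (DR n R) k) (DR n R k) ((k + 1) * B) (Fw D' k) (D' k) (pos (k + 1)) := by
    rcases hstart with h | h | h | h
    · have := h.1; omega
    · exact h
    · have := h.1; omega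
    · have := h.1; omega
  obtain ⟨-, -, hF, hQB, hQD, hcar, hfQ, htail, hD1⟩ := hS
  set P := pos (k + 1) with hP
  have hRg := hR.grid
  have hl := lab_Fw hRg k
  have hlQ := hl P
  have hlQ1 : lab n R false ((n : ℤ) - P) ((k : ℤ) + 1) ≤ 0 := by have := hlQ.1; omega
  have hlQ2 : 0 < lab n R true ((n : ℤ) - P) ((k : ℤ) + 1) := by have := hlQ.2; omega
  have hQnR : ((n : ℤ) - P, (k : ℤ) + 1) ∉ R := by rw [← mem_DR hRg]; exact hQD
  have hinf : sInf {x : ℤ | OpenSpace n R x ((k : ℤ) + 1)} = (n : ℤ) - P := by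
    refine IsLeast.csInf_eq ⟨⟨by omega, hQnR, hlQ1, hlQ2⟩, ?_⟩
    rintro x ⟨h2, h3, h4, h5⟩
    by_contra hlt
    obtain ⟨s, hs⟩ : ∃ s : ℕ, x = (n : ℤ) - ((s + 1 : ℕ) : ℤ) := ⟨((n : ℤ) - x - 1).toNat, by omega⟩
    subst hs
    have h6 := (hl (s + 1)).2
    have h7 : s ∉ DR n R k ∧ Fw (DR n R) k s = 0 := by
      by_cases e : s = P
      · rw [e]; exact ⟨hQD, hfQ⟩
      · exact htail s (by omega)
    rw [car_succ, if_neg h7.1, h7.2] at h6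
    omega
  have hnew : insert ((n : ℤ) - P, (k : ℤ) + 1) R = RD n (MX (DR n R) D' (k + 1)) := by
    refine grid_ext ?_ (RD_grid _ _) ?_
    · intro t ht
      rcases Finset.mem_insert.1 ht with rfl | ht
      · simp only; omega
      · exact hRg t ht
    · intro s hs' t
      rw [Finset.mem_insert, mem_RD, ← mem_DR hRg]
      simp only [Prod.mk.injEq, MX]
      rcases lt_trichotomy s k with h | h | h
      · rw [if_pos (by omega), hs s h]
        constructor
        · rintro (h' | h')
          · omega
          · exact ⟨hs', h'⟩
        · exact fun h' => Or.inr h'.2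
      · subst h
        rw [if_pos (by omega), hD1, Finset.mem_insert]
        constructor
        · rintro (h' | h')
          · exact ⟨hs', Or.inl (by omega)⟩
          · exact ⟨hs', Or.inr h'⟩
        · rintro ⟨-, h' | h'⟩
          · rw [h']; exact Or.inl ⟨rfl, rfl⟩
          · exact Or.inr h'
      · rw [if_neg (by omega)]
        constructor
        · rintro (h' | h')
          · omega
          · exact ⟨hs', h'⟩
        · exact fun h' => Or.inr h'.2
  have hS'g : Grid n (insert ((n : ℤ) - P, (k : ℤ) + 1) R) := by rw [hnew]; exact RD_grid _ _
  have her : (insert ((n : ℤ) - P, (k : ℤ) + 1) R).erase ((n : ℤ) - P, (k : ℤ) + 1) = R := Finset.erase_insert hQnR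
  have hbf : bef (insert ((n : ℤ) - P, (k : ℤ) + 1) R) ((n : ℤ) - P) ((k : ℤ) + 1) = bef R ((n : ℤ) - P) ((k : ℤ) + 1) := by
    have := bef_erase_of (R := insert ((n : ℤ) - P, (k : ℤ) + 1) R) (self_notMem_bef (p := ((n : ℤ) - P, (k : ℤ) + 1)))
    rw [her] at this; exact this.symm
  have hlb := fun c => lab_bef hS'g hRg (by omega) hbf c
  have hloop := loop (B := B) (pos := pos) hR.gd hD' (n - (k + 1)) (k + 1) ((n : ℤ) - P, (k : ℤ) + 1)
    (((n : ℤ) + 1 - ((k + 1 : ℕ) : ℤ)).toNat + 1) (by omega) (fun s _ hsn => hst s hsn) hQB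
  rw [← hnew] at hloop
  have := hloop (Finset.mem_insert_self _ _) (by rw [her]; exact hR) (by push_cast; exact le_rfl)
    (by simp only; rw [hlb]; exact hlQ2) (by simp only; rw [hlb]; exact hlQ1)
    (by simp only; rw [hlb, hlQ.2, Fw, out, if_neg hQD]) (by omega) (R, (0, 0))
  rw [insertOne, insertStepsOf]
  have ek : ((k + 1 : ℕ) : ℤ) = (k : ℤ) + 1 := by push_cast; rfl
  rw [ek] at this ⊢
  simp only [hinf]
  exact this

lemma insertWord_cons (n : ℤ) (R : Finset (ℤ × ℤ)) (x : ℕ) (v : List ℕ) : insertWord n R (x :: v) = insertWord n (insertOne n R (x : ℤ)) v := by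
  simp [insertWord]

lemma insertWord_eq {n B : ℕ} (hB : 0 < B) {v : List ℕ} : ∀ {R D' Qs}, Good n R → IW n B (DR n R) v D' Qs → insertWord n R v = RD n D' := by
  induction v with
  | nil =>
    intro R D' Qs hR h
    rw [h.1, RD_DR hR.grid]
    rfl
  | cons x v ih =>
    intro R D' Qs hR h
    obtain ⟨D1, Q, Qt, rfl, h1, h⟩ := h
    have hD1 := h1.gd hR.gd
    have e := insertOne_eq hB hR h1
    have hg : Good n (RD n D1) := hD1.good
    have := ih (R := RD n D1) (D' := D') (Qs := Qt) hg (by rw [DR_RD n hD1.2]; exact h)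
    rw [← this, insertWord_cons, e]

lemma xR_RD (n : ℕ) (D : ℕ → Finset ℕ) : xR (RD n D) = ∏ r ∈ Finset.range n, (MvPolynomial.X (r + 1) : MvPolynomial ℕ ℤ) ^ (D r).card := by
  rw [xR, RD, Finset.prod_biUnion]
  · refine Finset.prod_congr rfl fun r _ => ?_
    have e : ((r : ℤ) + 1).toNat = r + 1 := by omega
    rw [Finset.prod_image]
    · simp only [e, Finset.prod_const]
    · intro a _ b _ h
      simp only [Prod.mk.injEq] at h
      omega
  · intro r _ s _ hrs
    rw [Function.onFun, Finset.disjoint_left]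
    intro q h1 h2
    simp only [Finset.mem_image] at h1 h2
    obtain ⟨a, _, rfl⟩ := h1
    obtain ⟨b, _, h⟩ := h2
    simp only [Prod.mk.injEq] at h
    omega

lemma InsX.weight {n B x Q : ℕ} {D D'} (hB : 0 < B) (h : InsX n B D x D' Q) : xR (RD n D') = xR (RD n D) * MvPolynomial.X x := by
  obtain ⟨hx, hxn, hT, -⟩ := h
  have hc := Tr.card hx hB hT
  rw [xR_RD, xR_RD, Finset.prod_congr rfl (fun r hr => by rw [hc r (Finset.mem_range.1 hr), pow_add]), Finset.prod_mul_distrib]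
  congr 1
  rw [Finset.prod_eq_single (x - 1)]
  · have : x - 1 + 1 = x := by omega
    rw [this, if_pos rfl, pow_one]
  · intro r _ hr
    rw [if_neg (by omega), pow_zero]
  · intro h; simp only [Finset.mem_range] at h; omega

lemma IW.weight {n B : ℕ} (hB : 0 < B) {v : List ℕ} : ∀ {D D' Qs}, IW n B D v D' Qs → xR (RD n D') = xR (RD n D) * (v.map MvPolynomial.X).prod := by
  induction v with
  | nil =>
    intro D D' Qs h
    rw [h.1]; simp
  | cons x v ih =>
    intro D D' Qs h
    obtain ⟨D1, Q, Qt, rfl, h1, h⟩ := h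
    rw [ih h, h1.weight hB, List.map_cons, List.prod_cons, mul_assoc]

/-- The set of pairs counted by `N(U)`. -/
def NSet (n : ℕ) (w : Equiv.Perm ℤ) (μ : ℕ → ℕ) (U : Finset (ℤ × ℤ)) : Set (Finset (ℤ × ℤ) × SSYT n μ) :=
  {p | IsRC n p.1 ∧ wR n p.1 = w ∧ insertWord n p.1 (readingWord n μ p.2) = U}

lemma star_good {n : ℕ} {w : Equiv.Perm ℤ} (hw : ∀ i : ℤ, i ≤ 0 → w (i - 1) < w i) {R} (h : IsRC n R) (e : wR n R = w) : Good n R :=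
  ⟨h, by intro i hi; rw [e]; exact hw i hi⟩

lemma run {n c : ℕ} {w : Equiv.Perm ℤ} {μ : ℕ → ℕ} (hμ : IsPartition n μ)
    (hc : ∀ R, Good n R → wR n R = w → VanG n c (DR n R)) {R} (hR : Good n R) (e : wR n R = w) (Y : SSYT n μ) :
    Good n (insertWord n R (readingWord n μ Y)) ∧
    xR (insertWord n R (readingWord n μ Y)) = xR R * xY n μ Y ∧
    ∃ Qs, IW n (c + (lensOf μ n).sum + 2) (DR n R) (readingWord n μ Y) (DR n (insertWord n R (readingWord n μ Y))) Qs := by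
  have hB : 0 < c + (lensOf μ n).sum + 2 := by omega
  obtain ⟨E, Qs, h⟩ := IW.total (B := c + (lensOf μ n).sum + 2) (readingWord_isTab hμ Y).2 hR.gd (hc R hR e)
    (by rw [readingWord_length]; omega)
  have hE := h.gd hR.gd
  have e1 := insertWord_eq hB hR h
  rw [e1, DR_RD n hE.2]
  refine ⟨hE.good, ?_, Qs, h⟩
  rw [h.weight hB, RD_DR hR.grid, xY]

lemma N_le {n : ℕ} {w : Equiv.Perm ℤ} (hwperm : ∃ N : ℤ, ∀ i < N, w⁻¹ i = i) (hw : ∀ i : ℤ, i ≤ 0 → w (i - 1) < w i)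
    {μ : ℕ → ℕ} (hμ : IsPartition n μ) {U U'} (hU' : Good n U') (e : wR n U = wR n U')
    (hfin : (NSet n w μ U').Finite) :
    Nat.card (NSet n w μ U) ≤ Nat.card (NSet n w μ U') := by
  obtain ⟨c, hc⟩ := exists_van n hwperm
  set B := c + (lensOf μ n).sum + 2 with hBd
  have hB : 0 < B := by omega
  have key : ∀ p : NSet n w μ U, ∃ (p' : NSet n w μ U') (Qs : List ℕ),
      IW n B (DR n p.1.1) (readingWord n μ p.1.2) (DR n U) Qs ∧
      IW n B (DR n p'.1.1) (readingWord n μ p'.1.2) (DR n U') Qs := by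
    rintro ⟨⟨R, Y⟩, h1, h2, h3⟩
    simp only at h1 h2 h3
    have hR := star_good hw h1 h2
    obtain ⟨hg, -, Qs, h⟩ := run hμ hc hR h2 Y
    rw [h3] at h hg
    have hl := readingWord_length Y
    have hv : VanG n B (DR n U) := by
      have := h.van hB hR.gd (hc R hR h2)
      intro p hp
      exact this p (by omega)
    obtain ⟨D', v', k1, k2, k3⟩ := h.exists_left hB hR.gd hU'.gd (top_eq hg hU' e) hv
    have hs : Sim n B (readingWord n μ Y) v' :=
      ⟨c, DR n R, D', _, _, Qs, hR.gd, k2, k3, hc R hR h2, by omega, h, k1⟩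
    obtain ⟨Y', rfl⟩ := exists_SSYT (hs.isTab (readingWord_isTab hμ Y).1) k1.mem
    have hD : DR n (RD n D') = D' := DR_RD n k2.2
    have k1' : IW n B (DR n (RD n D')) (readingWord n μ Y') (DR n U') Qs := by rw [hD]; exact k1
    refine ⟨⟨(RD n D', Y'), k2.good.1, ?_, ?_⟩, Qs, h, k1'⟩
    · rw [← h2]
      exact (top_det hR k2.good (by rw [hD]; exact k3)).symm
    · rw [insertWord_eq hB k2.good k1', RD_DR hU'.grid]
  choose f Q hQ hQ' using key
  have : Finite (NSet n w μ U') := hfin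
  apply Nat.card_le_card_of_injective f
  intro p q hpq
  have a := hQ' p
  rw [hpq] at a
  have hQQ := (a.det (hQ' q)).2
  have b := hQ p
  rw [hQQ] at b
  have gp := star_good hw p.2.1 p.2.2.1
  have gq := star_good hw q.2.1 q.2.2.1
  obtain ⟨d1, d2⟩ := b.det_left hB (hQ q) gp.gd gq.gd (top_eq gp gq (p.2.2.1.trans q.2.2.1.symm))
  apply Subtype.ext
  apply Prod.ext
  · rw [← RD_DR gp.grid, ← RD_DR gq.grid, d1]
  · exact readingWord_inj d2

/-- Theorem 4.1: the generalized Littlewood–Richardson rule.  Let `w`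
satisfy `w(i) > w(i−1)` for all `i ≤ 0` and let `μ` be a partition.  For an rc-graph `U`,
the number `N(U)` of pairs `(R,Y)` of an rc-graph `R` with `w_R = w` and a semistandard
Young tableau `Y` of shape `μ` with `R ← Y = U` depends only on the permutation `w_U`;
writing `c^u_{w,μ}` for this common value, `S_w · s_μ = Σ_u c^u_{w,μ} S_u`. -/
theorem littlewood_richardson (n : ℕ) (hn : 0 < n) (w : Equiv.Perm ℤ)
    (hwperm : IsPermZ n w) (hw : ∀ i : ℤ, i ≤ 0 → w (i - 1) < w i)
    (μ : ℕ → ℕ) (hμ : IsPartition n μ) :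
    ∃ c : Equiv.Perm ℤ → ℕ,
      (∀ U : Finset (ℤ × ℤ), IsRC n U →
        c (wR n U) = Nat.card {p : Finset (ℤ × ℤ) × SSYT n μ //
          IsRC n p.1 ∧ wR n p.1 = w ∧
          insertWord n p.1 (readingWord n μ p.2) = U}) ∧
      Schub n w * SchurP n μ
        = ∑ᶠ u : Equiv.Perm ℤ, (c u : MvPolynomial ℕ ℤ) * Schub n u := by
  have hlow : ∃ N : ℤ, ∀ i < N, w⁻¹ i = i := by
    obtain ⟨N, hN⟩ := hwperm.2
    refine ⟨N, fun i hi => ?_⟩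
    have := pinv1 w i
    rwa [hN i hi] at this
  obtain ⟨b, hb⟩ := exists_van n hlow
  have := finite_SSYT n μ hμ
  letI := Fintype.ofFinite (SSYT n μ)
  have hPf := finite_RC n hlow
  -- the finite set of all pairs
  set P : Finset (Finset (ℤ × ℤ)) := hPf.toFinset with hP
  have hPm : ∀ R, R ∈ P ↔ IsRC n R ∧ wR n R = w := by
    intro R
    rw [hP, Set.Finite.mem_toFinset]
    exact ⟨fun h => ⟨h.1.1, h.2⟩, fun h => ⟨star_good hw h.1 h.2, h.2⟩⟩
  let A : Finset (Finset (ℤ × ℤ) × SSYT n μ) := P ×ˢ Finset.univ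
  let f : Finset (ℤ × ℤ) × SSYT n μ → Finset (ℤ × ℤ) := fun p => insertWord n p.1 (readingWord n μ p.2)
  have hN : ∀ U, Nat.card (NSet n w μ U) = (A.filter (fun p => f p = U)).card := by
    intro U
    refine Nat.subtype_card _ ?_
    intro p
    simp only [Finset.mem_filter, A, Finset.mem_product, Finset.mem_univ, and_true, hPm, f, NSet, Set.mem_setOf_eq, and_assoc]
  have hNf : ∀ U, (NSet n w μ U).Finite := by
    intro U
    refine Set.Finite.subset (Finset.finite_toSet A) ?_
    rintro p ⟨h1, h2, -⟩
    simp only [A, Finset.coe_product, Finset.coe_univ, Set.mem_prod, Set.mem_univ, and_true, Finset.mem_coe, hPm]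
    exact ⟨h1, h2⟩
  have hAg : ∀ p ∈ A, Good n (f p) ∧ xR (f p) = xR p.1 * xY n μ p.2 := by
    intro p hp
    simp only [A, Finset.mem_product, Finset.mem_univ, and_true, hPm] at hp
    have := run hμ hb (star_good hw hp.1 hp.2) hp.2 p.2
    exact ⟨this.1, this.2.1⟩
  have hpos : ∀ U, Nat.card (NSet n w μ U) ≠ 0 → ∃ p ∈ A, f p = U := by
    intro U h
    rw [hN, Finset.card_ne_zero] at h
    obtain ⟨p, hp⟩ := h
    exact ⟨p, (Finset.mem_filter.1 hp).1, (Finset.mem_filter.1 hp).2⟩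
  have hgood : ∀ U U', Good n U → IsRC n U' → wR n U' = wR n U → Good n U' := by
    intro U U' h h' e
    exact star_good (w := wR n U) h.2 h' e
  have hNeq : ∀ U U', IsRC n U → IsRC n U' → wR n U = wR n U' → Nat.card (NSet n w μ U) = Nat.card (NSet n w μ U') := by
    intro U U' h h' e
    by_cases hg : Good n U
    · have hg' := hgood U U' hg h' e.symm
      exact le_antisymm (N_le hlow hw hμ hg' e (hNf _)) (N_le hlow hw hμ hg e.symm (hNf _))
    · have hg' : ¬ Good n U' := fun hg' => hg (hgood U' U hg' h e)
      have z : ∀ V, ¬ Good n V → Nat.card (NSet n w μ V) = 0 := by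
        intro V hV
        by_contra hne
        obtain ⟨p, hp, rfl⟩ := hpos V hne
        exact hV (hAg p hp).1
      rw [z U hg, z U' hg']
  let c : Equiv.Perm ℤ → ℕ := fun u =>
    if h : ∃ U, IsRC n U ∧ wR n U = u then Nat.card (NSet n w μ h.choose) else 0
  have hcU : ∀ U, IsRC n U → c (wR n U) = Nat.card (NSet n w μ U) := by
    intro U hU
    have h : ∃ V, IsRC n V ∧ wR n V = wR n U := ⟨U, hU, rfl⟩
    simp only [c, dif_pos h]
    exact hNeq _ _ h.choose_spec.1 hU h.choose_spec.2
  refine ⟨c, fun U hU => hcU U hU, ?_⟩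
  -- Schubert polynomials as finite sums
  have hSch : ∀ (u : Equiv.Perm ℤ) (T : Finset (Finset (ℤ × ℤ))), (∀ R, R ∈ T ↔ IsRC n R ∧ wR n R = u) →
      Schub n u = ∑ R ∈ T, xR R := by
    intro u T hT
    rw [Schub]
    refine finsum_mem_eq_sum_of_subset _ ?_ ?_
    · intro R hR
      exact Finset.mem_coe.2 ((hT R).2 hR.1)
    · intro R hR
      exact (hT R).1 (Finset.mem_coe.1 hR)
  have hL : Schub n w * SchurP n μ = ∑ p ∈ A, xR (f p) := by
    rw [hSch w P hPm, SchurP, finsum_eq_sum_of_fintype, Finset.sum_mul_sum, ← Finset.sum_product']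
    exact Finset.sum_congr rfl fun p hp => (hAg p hp).2.symm
  have hRs : ∑ᶠ u : Equiv.Perm ℤ, (c u : MvPolynomial ℕ ℤ) * Schub n u
      = ∑ u ∈ A.image (fun p => wR n (f p)), (c u : MvPolynomial ℕ ℤ) * Schub n u := by
    refine finsum_eq_sum_of_support_subset _ ?_
    intro u hu
    have hu0 : c u ≠ 0 := by
      intro h0
      apply hu
      simp only [h0, Nat.cast_zero, zero_mul]
    have h : ∃ V, IsRC n V ∧ wR n V = u := by
      by_contra h
      exact hu0 (by simp only [c, dif_neg h])
    obtain ⟨V, hV, rfl⟩ := h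
    rw [hcU V hV] at hu0
    obtain ⟨p, hp, rfl⟩ := hpos V hu0
    exact Finset.mem_coe.2 (Finset.mem_image.2 ⟨p, hp, rfl⟩)
  rw [hL, hRs, ← Finset.sum_fiberwise_of_maps_to (g := fun p => wR n (f p)) (fun p hp => Finset.mem_image_of_mem (fun p => wR n (f p)) hp)]
  refine Finset.sum_congr rfl fun u hu => ?_
  obtain ⟨p0, hp0, rfl⟩ := Finset.mem_image.1 hu
  have hg0 := (hAg p0 hp0).1
  have hF := finite_RC n (wR_low (n := n) (f p0))
  have hFm : ∀ R, R ∈ hF.toFinset ↔ IsRC n R ∧ wR n R = wR n (f p0) := by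
    intro R
    rw [Set.Finite.mem_toFinset]
    exact ⟨fun h => ⟨h.1.1, h.2⟩, fun h => ⟨hgood _ _ hg0 h.1 h.2, h.2⟩⟩
  rw [hSch _ hF.toFinset hFm, Finset.mul_sum,
    ← Finset.sum_fiberwise_of_maps_to (g := f) (t := hF.toFinset)]
  · refine Finset.sum_congr rfl fun U hU => ?_
    obtain ⟨hU1, hU2⟩ := (hFm U).1 hU
    have e2 : c (wR n (f p0)) = (A.filter (fun p => f p = U)).card := by
      rw [← hU2, hcU U hU1, hN]
    have e3 : (A.filter (fun p => wR n (f p) = wR n (f p0))).filter (fun p => f p = U) = A.filter (fun p => f p = U) := by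
      ext p
      simp only [Finset.mem_filter]
      constructor
      · rintro ⟨⟨h1, -⟩, h2⟩
        exact ⟨h1, h2⟩
      · rintro ⟨h1, h2⟩
        exact ⟨⟨h1, by rw [h2, hU2]⟩, h2⟩
    rw [e3, e2, Finset.sum_congr rfl (fun p hp => by rw [(Finset.mem_filter.1 hp).2]), Finset.sum_const, nsmul_eq_mul]
  · intro p hp
    obtain ⟨h1, h2⟩ := Finset.mem_filter.1 hp
    exact (hFm _).2 ⟨(hAg p h1).1.1, h2⟩

end RCGraphs
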